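/- Let N > 1 be an integer, let α = q/p with p, q positive odd integers, let b > 0 > k with b^{1/α}·√(1+k²) > −k·N, and fix initial data u₀ ∈ C²([0,1]) with u₀'(0) = 0, u₀'(1) = k, u₀''(r) < 0 and H(r,0)^α + b > 0 for all r ∈ [0,1]. Then the flow has a unique global classical solution u on [0, ∞) with initial data u₀ and H(r,t) < 0 for all (r,t); there exist positive constants M₀, M₁, M₂, V_*, V^*, H_*, H^* such that for all t ≥ 0: |u(r,t) − c̃(b,k)·t| ≤ M₀ on [0,1], −M₁ ≤ u_r(r,t) < 0 on (0,1], V_* ≤ u_t(r,t) ≤ V^* on [0,1], −H^* ≤ H(r,t) ≤ −H_* on (0,1], and |u_rr(r,t)| ≤ M₂ on [0,1]; and there exists M ∈ ℝ such that sup_{r ∈ [0,1]} |u(r,t) − Φ̃(r) − c̃(b,k)·t| → M as t → ∞. -/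

import Mathlib

open Set Filter Topology

/-- Signed power: the usual real power for nonnegative arguments, extended oddly
to negative arguments (matching `x^{e}` for `1/e = p/q` with `p, q` odd). -/
noncomputable def oddPow (x e : ℝ) : ℝ := if 0 ≤ x then x ^ e else -((-x) ^ e)

/-- `φ`, with first derivative `φ'` and second derivative `φ''`, solves the
translating-profile equation
`φ''/(1+φ'²) + ((N−1)/r)·φ' = (c/√(1+φ'²) − b)^{1/α}·√(1+φ'²)` for `r ∈ J`, `r ≠ 0`,
with the initial conditions `φ(0) = φ'(0) = 0`. -/
def IsProfileSolOn (N : ℕ) (α b c : ℝ) (J : Set ℝ) (φ φ' φ'' : ℝ → ℝ) : Prop :=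
  φ 0 = 0 ∧ φ' 0 = 0 ∧
  (∀ r ∈ J, HasDerivWithinAt φ (φ' r) J r) ∧
  (∀ r ∈ J, HasDerivWithinAt φ' (φ'' r) J r) ∧
  (∀ r ∈ J, r ≠ 0 →
    φ'' r / (1 + φ' r ^ 2) + (((N : ℝ) - 1) / r) * φ' r
      = oddPow (c / Real.sqrt (1 + φ' r ^ 2) - b) (1 / α) * Real.sqrt (1 + φ' r ^ 2))

/-- `φ` is the unique solution of the translating-profile problem, defined on its
maximal existence interval `[0, R)`: it is a solution there, and any solution on any
interval `[0, S)` satisfies `S ≤ R` and coincides with `φ` on `[0, S)`. -/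
def IsMaxProfileSol (N : ℕ) (α b c R : ℝ) (φ φ' φ'' : ℝ → ℝ) : Prop :=
  0 < R ∧ IsProfileSolOn N α b c (Set.Ico 0 R) φ φ' φ'' ∧
  ∀ S ψ ψ' ψ'', 0 < S → IsProfileSolOn N α b c (Set.Ico 0 S) ψ ψ' ψ'' →
    S ≤ R ∧ Set.EqOn ψ φ (Set.Ico 0 S)

open scoped ENNReal

/-- The mean curvature of the radially symmetric graph with slope `ur` and second
derivative `urr` at radius `r`; at `r = 0` it equals `N·u_rr(0)`. -/
noncomputable def meanCurv (N : ℕ) (r ur urr : ℝ) : ℝ :=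
  if r = 0 then (N : ℝ) * urr
  else urr / (1 + ur ^ 2) ^ ((3 : ℝ) / 2)
    + ((N : ℝ) - 1) * ur / (r * Real.sqrt (1 + ur ^ 2))

/-- `u₀` is `C²` initial data on `[0,1]`, with derivative `u₀'`, second derivative
`u₀''`, and boundary slopes `u₀'(0) = 0`, `u₀'(1) = k`. -/
def IsC2Data (k : ℝ) (u₀ u₀' u₀'' : ℝ → ℝ) : Prop :=
  (∀ r ∈ Set.Icc (0:ℝ) 1, HasDerivWithinAt u₀ (u₀' r) (Set.Icc 0 1) r) ∧
  (∀ r ∈ Set.Icc (0:ℝ) 1, HasDerivWithinAt u₀' (u₀'' r) (Set.Icc 0 1) r) ∧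
  ContinuousOn u₀'' (Set.Icc (0:ℝ) 1) ∧ u₀' 0 = 0 ∧ u₀' 1 = k

/-- `u` (with spatial derivatives `ur`, `urr` and time derivative `ut`) is a classical
solution of the flow `u_t = (H^α + b)·√(1+u_r²)` on `[0,1] × I`, with initial data
`u₀` (whose derivatives are `u₀'`, `u₀''`) and boundary slopes `u_r(0,t) = 0`,
`u_r(1,t) = k`. -/
def IsFlowSol (N : ℕ) (α b k : ℝ) (u₀ u₀' u₀'' : ℝ → ℝ) (I : Set ℝ)
    (u ur urr ut : ℝ → ℝ → ℝ) : Prop :=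
  ContinuousOn (fun p : ℝ × ℝ => u p.1 p.2) (Set.Icc 0 1 ×ˢ I) ∧
  ContinuousOn (fun p : ℝ × ℝ => ur p.1 p.2) (Set.Icc 0 1 ×ˢ I) ∧
  ContinuousOn (fun p : ℝ × ℝ => urr p.1 p.2) (Set.Icc 0 1 ×ˢ I) ∧
  ContinuousOn (fun p : ℝ × ℝ => ut p.1 p.2) (Set.Icc 0 1 ×ˢ I) ∧
  (∀ t ∈ I, ∀ r ∈ Set.Icc (0:ℝ) 1,
    HasDerivWithinAt (fun s => u s t) (ur r t) (Set.Icc 0 1) r) ∧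
  (∀ t ∈ I, ∀ r ∈ Set.Icc (0:ℝ) 1,
    HasDerivWithinAt (fun s => ur s t) (urr r t) (Set.Icc 0 1) r) ∧
  (∀ r ∈ Set.Icc (0:ℝ) 1, ∀ t ∈ I, HasDerivWithinAt (fun s => u r s) (ut r t) I t) ∧
  (∀ r ∈ Set.Icc (0:ℝ) 1, u r 0 = u₀ r ∧ ur r 0 = u₀' r ∧ urr r 0 = u₀'' r) ∧
  (∀ t ∈ I, ur 0 t = 0 ∧ ur 1 t = k) ∧
  (∀ t ∈ I, ∀ r ∈ Set.Ioc (0:ℝ) 1,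
    ut r t = (oddPow (meanCurv N r (ur r t) (urr r t)) α + b) * Real.sqrt (1 + ur r t ^ 2))

/-- The time interval `[0, T)` for `T ∈ (0, ∞]`, as a set of real numbers. -/
def timeSet (T : ℝ≥0∞) : Set ℝ := {t : ℝ | 0 ≤ t ∧ ENNReal.ofReal t < T}


open Set Filter Topology

/-! ### Basic functions -/

noncomputable def wf (s : ℝ) : ℝ := Real.sqrt (1 + s ^ 2)

noncomputable def sg (s : ℝ) : ℝ := s / wf s

lemma wf_pos (s : ℝ) : 0 < wf s := Real.sqrt_pos.2 (by positivity)

lemma wf_sq (s : ℝ) : wf s ^ 2 = 1 + s ^ 2 := Real.sq_sqrt (by positivity)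

lemma one_le_wf (s : ℝ) : 1 ≤ wf s := by
  have := wf_sq s
  nlinarith [wf_pos s, sq_nonneg s]

lemma wf_zero : wf 0 = 1 := by simp [wf]

lemma wf_neg (s : ℝ) : wf (-s) = wf s := by simp [wf]

lemma sg_zero : sg 0 = 0 := by simp [sg]

lemma sg_neg (s : ℝ) : sg (-s) = - sg s := by simp [sg, wf_neg, neg_div]

lemma sg_mul_wf (s : ℝ) : sg s * wf s = s := by
  unfold sg; field_simp [(wf_pos s).ne']

lemma abs_lt_wf (s : ℝ) : |s| < wf s := by
  apply abs_lt_of_sq_lt_sq _ (wf_pos s).le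
  rw [wf_sq]; linarith

lemma abs_sg_lt (s : ℝ) : |sg s| < 1 := by
  unfold sg
  rw [abs_div, abs_of_pos (wf_pos s), div_lt_one (wf_pos s)]
  exact abs_lt_wf s

lemma sg_lt_one (s : ℝ) : sg s < 1 := (abs_lt.1 (abs_sg_lt s)).2

lemma sg_nonneg {s : ℝ} (h : 0 ≤ s) : 0 ≤ sg s := div_nonneg h (wf_pos s).le

lemma sg_pos {s : ℝ} (h : 0 < s) : 0 < sg s := div_pos h (wf_pos s)

lemma sg_le_self {s : ℝ} (h : 0 ≤ s) : sg s ≤ s := by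
  unfold sg; exact div_le_self h (one_le_wf s)

lemma hasDerivAt_wf (s : ℝ) : HasDerivAt wf (sg s) s := by
  have h1 : HasDerivAt (fun x : ℝ => 1 + x ^ 2) (2 * s) s := by
    have := (hasDerivAt_pow 2 s).const_add 1
    simpa using this
  have h2 := h1.sqrt (by positivity)
  refine HasDerivAt.congr_deriv (f := wf) h2 ?_
  unfold sg wf
  field_simp

lemma hasDerivAt_sg (s : ℝ) : HasDerivAt sg (1 / wf s ^ 3) s := by
  have h2 := (hasDerivAt_id s).div (hasDerivAt_wf s) (wf_pos s).ne'
  have e : sg = (id / wf) := rfl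
  rw [e]
  refine h2.congr_deriv ?_
  have h3 := wf_sq s
  have h4 := wf_pos s
  unfold sg
  simp only [id]
  field_simp
  linarith

lemma continuous_wf : Continuous wf := by unfold wf; fun_prop

lemma continuous_sg : Continuous sg := by
  unfold sg; exact continuous_id.div continuous_wf (fun x => (wf_pos x).ne')

lemma sg_strictMono : StrictMono sg := by
  apply strictMono_of_deriv_pos
  intro x
  rw [(hasDerivAt_sg x).deriv]
  have := wf_pos x
  positivity

lemma sg_mono : Monotone sg := sg_strictMono.monotone

lemma wf_le_wf {x y : ℝ} (h : |x| ≤ |y|) : wf x ≤ wf y := by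
  unfold wf
  apply Real.sqrt_le_sqrt
  have := sq_le_sq.2 h
  linarith

lemma wf_le_of_nonneg {x y : ℝ} (hx : 0 ≤ x) (h : x ≤ y) : wf x ≤ wf y := by
  apply wf_le_wf; rwa [abs_of_nonneg hx, abs_of_nonneg (hx.trans h)]

/-- convexity inequality -/
lemma wf_sub_le (x s : ℝ) : wf s - wf x ≤ (s - x) * sg s := by
  have hs := wf_pos s
  have hx := wf_pos x
  have h1 : 1 + x * s ≤ wf x * wf s := by
    apply le_of_sq_le_sq _ (by positivity)
    rw [mul_pow, wf_sq, wf_sq]; nlinarith [sq_nonneg (x - s)]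
  have h2 := wf_sq s
  have : (s - x) * sg s = (s - x) * s / wf s := by unfold sg; ring
  rw [this, le_div_iff₀ hs]
  nlinarith

lemma abs_wf_sub_le (x y : ℝ) : |wf x - wf y| ≤ |x - y| := by
  have h1 := wf_sub_le x y
  have h2 := wf_sub_le y x
  have a1 := (abs_sg_lt y).le
  have a2 := (abs_sg_lt x).le
  have b1 : (y - x) * sg y ≤ |x - y| := by
    calc (y - x) * sg y ≤ |(y - x) * sg y| := le_abs_self _
      _ = |y - x| * |sg y| := abs_mul _ _
      _ ≤ |y - x| * 1 := by gcongr
      _ = |x - y| := by rw [mul_one, abs_sub_comm]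
  have b2 : (x - y) * sg x ≤ |x - y| := by
    calc (x - y) * sg x ≤ |(x - y) * sg x| := le_abs_self _
      _ = |x - y| * |sg x| := abs_mul _ _
      _ ≤ |x - y| * 1 := by gcongr
      _ = |x - y| := by rw [mul_one]
  rw [abs_le]; constructor <;> linarith

lemma sg_sub_le {x y : ℝ} (h : x ≤ y) : sg y - sg x ≤ y - x := by
  have hm : Monotone (fun z => z - sg z) := by
    apply monotone_of_deriv_nonneg
    · exact fun z => ((hasDerivAt_id z).sub (hasDerivAt_sg z)).differentiableAt
    · intro z
      have := ((hasDerivAt_id z).sub (hasDerivAt_sg z)).deriv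
      have e : (fun z => z - sg z) = (id - sg) := rfl
      rw [e, this]
      have h1 : 1 / wf z ^ 3 ≤ 1 := by
        rw [div_le_one (by have := wf_pos z; positivity)]
        exact one_le_pow₀ (one_le_wf z)
      linarith
  have := hm h
  simp only at this
  linarith

lemma abs_sg_sub_le (x y : ℝ) : |sg x - sg y| ≤ |x - y| := by
  rcases le_total x y with h | h
  · rw [abs_sub_comm, abs_sub_comm x, abs_of_nonneg (sub_nonneg.2 (sg_mono h)),
      abs_of_nonneg (sub_nonneg.2 h)]
    exact sg_sub_le h
  · rw [abs_of_nonneg (sub_nonneg.2 (sg_mono h)),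
      abs_of_nonneg (sub_nonneg.2 h)]
    exact sg_sub_le h

lemma sub_le_sg_sub {K x y : ℝ} (hx : 0 ≤ x) (h : x ≤ y) (hy : y ≤ K) :
    y - x ≤ wf K ^ 3 * (sg y - sg x) := by
  have hm : MonotoneOn (fun z => wf K ^ 3 * sg z - z) (Icc 0 K) := by
    have hd : ∀ z, HasDerivAt (fun z => wf K ^ 3 * sg z - z) (wf K ^ 3 * (1 / wf z ^ 3) - 1) z :=
      fun z => ((hasDerivAt_sg z).const_mul _).sub (hasDerivAt_id z)
    apply monotoneOn_of_deriv_nonneg (convex_Icc 0 K)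
    · exact fun z _ => (hd z).continuousAt.continuousWithinAt
    · exact fun z _ => (hd z).differentiableAt.differentiableWithinAt
    · intro z hz
      rw [interior_Icc] at hz
      rw [(hd z).deriv]
      have h1 : wf z ≤ wf K := wf_le_of_nonneg hz.1.le hz.2.le
      have h2 := wf_pos z
      have h3 : wf z ^ 3 ≤ wf K ^ 3 := by gcongr
      have : 1 ≤ wf K ^ 3 * (1 / wf z ^ 3) := by
        rw [mul_one_div, le_div_iff₀ (by positivity)]; linarith
      linarith
  have := hm ⟨hx, h.trans hy⟩ ⟨hx.trans h, hy⟩ h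
  simp only at this
  linarith

lemma inv_cube_sub_le {x y : ℝ} (hx : 0 ≤ x) (h : x ≤ y) :
    1 / wf x ^ 3 - 1 / wf y ^ 3 ≤ 3 * (y - x) := by
  have hX := one_le_wf x
  have hXY : wf x ≤ wf y := wf_le_of_nonneg hx h
  have hd : wf y - wf x ≤ y - x := by
    have := abs_wf_sub_le y x
    rw [abs_of_nonneg (sub_nonneg.2 h)] at this
    exact (le_abs_self _).trans this
  set X := wf x
  set Y := wf y
  have hX0 : 0 < X := by linarith
  have hY0 : 0 < Y := by linarith
  rw [div_sub_div _ _ (by positivity) (by positivity), div_le_iff₀ (by positivity)]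
  have h1 : 1 * Y ^ 3 - X ^ 3 * 1 ≤ 3 * (Y - X) * Y ^ 2 := by
    nlinarith [mul_nonneg (sub_nonneg.2 hXY) (sub_nonneg.2 hXY), mul_nonneg (mul_nonneg (sub_nonneg.2 hXY) (sub_nonneg.2 hXY)) hX0.le, mul_nonneg (mul_nonneg (sub_nonneg.2 hXY) (sub_nonneg.2 hXY)) hY0.le]
  have h2 : Y ^ 2 ≤ X ^ 3 * Y ^ 3 := by
    have a : 1 ≤ X ^ 3 := one_le_pow₀ hX
    have c : Y ^ 2 ≤ Y ^ 3 := pow_le_pow_right₀ (hX.trans hXY) (by norm_num)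
    nlinarith [pow_pos hY0 3, pow_pos hY0 2]
  calc 1 * Y ^ 3 - X ^ 3 * 1 ≤ 3 * (Y - X) * Y ^ 2 := h1
    _ ≤ 3 * (y - x) * (X ^ 3 * Y ^ 3) := by
      apply mul_le_mul _ h2 (by positivity) (by linarith)
      linarith

/-! ### oddPow -/

lemma oddPow_of_nonneg {x : ℝ} (e : ℝ) (h : 0 ≤ x) : oddPow x e = x ^ e := by simp [oddPow, h]

lemma oddPow_neg_of_nonneg {x e : ℝ} (he : 0 < e) (h : 0 ≤ x) : oddPow (-x) e = -(x ^ e) := by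
  rcases h.eq_or_lt with h0 | h0
  · subst h0; simp [oddPow, Real.zero_rpow he.ne']
  · have : ¬ (0 ≤ -x) := by linarith
    simp only [oddPow, this, if_false, neg_neg]

lemma oddPow_neg {x e : ℝ} (he : 0 < e) : oddPow (-x) e = - oddPow x e := by
  rcases le_total 0 x with h | h
  · rw [oddPow_neg_of_nonneg he h, oddPow_of_nonneg e h]
  · have : 0 ≤ -x := by linarith
    rw [oddPow_of_nonneg e this]
    have h2 := oddPow_neg_of_nonneg he this
    rw [neg_neg] at h2
    rw [h2, neg_neg]

lemma oddPow_mono {e : ℝ} (he : 0 < e) : Monotone (fun x => oddPow x e) := by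
  intro x y h
  simp only
  rcases le_total 0 x with hx | hx
  · rw [oddPow_of_nonneg e hx, oddPow_of_nonneg e (hx.trans h)]
    exact Real.rpow_le_rpow hx h he.le
  · have ex : oddPow x e = -((-x) ^ e) := by
      have := oddPow_neg_of_nonneg he (neg_nonneg.2 hx); rwa [neg_neg] at this
    rcases le_total 0 y with hy | hy
    · rw [ex, oddPow_of_nonneg e hy]
      have := Real.rpow_nonneg (neg_nonneg.2 hx) e
      have := Real.rpow_nonneg hy e
      linarith
    · have ey : oddPow y e = -((-y) ^ e) := by
        have := oddPow_neg_of_nonneg he (neg_nonneg.2 hy); rwa [neg_neg] at this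
      rw [ex, ey]
      have := Real.rpow_le_rpow (neg_nonneg.2 hy) (neg_le_neg h) he.le
      linarith

lemma oddPow_continuous {e : ℝ} (he : 0 < e) : Continuous (fun x => oddPow x e) := by
  have : (fun x => oddPow x e) = fun x => (max x 0) ^ e - (max (-x) 0) ^ e := by
    funext x
    rcases le_total 0 x with h | h
    · rw [oddPow_of_nonneg e h, max_eq_left h, max_eq_right (by linarith), Real.zero_rpow he.ne',
        sub_zero]
    · have := oddPow_neg_of_nonneg he (neg_nonneg.2 h)
      rw [neg_neg] at this
      rw [this, max_eq_right h, max_eq_left (by linarith), Real.zero_rpow he.ne', zero_sub]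
  rw [this]
  apply Continuous.sub
  · exact Continuous.rpow_const (by fun_prop) (fun _ => Or.inr he.le)
  · exact Continuous.rpow_const (by fun_prop) (fun _ => Or.inr he.le)

lemma oddPow_oddPow {x a : ℝ} (ha : 0 < a) : oddPow (oddPow x (1 / a)) a = x := by
  have h1 : 0 < 1 / a := by positivity
  have key : ∀ y : ℝ, 0 ≤ y → oddPow (oddPow y (1 / a)) a = y := by
    intro y hy
    rw [oddPow_of_nonneg _ hy, oddPow_of_nonneg _ (Real.rpow_nonneg hy _), ← Real.rpow_mul hy,
      one_div_mul_cancel ha.ne', Real.rpow_one]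
  rcases le_total 0 x with h | h
  · exact key x h
  · have := key (-x) (by linarith)
    rw [oddPow_neg h1, oddPow_neg ha] at this
    linarith

/-! ### First touch -/

lemma first_touch {ι : Type*} [Finite ι] (g : ι → ℝ → ℝ) (t0 T : ℝ)
    (hcont : ∀ i, ContinuousOn (g i) (Icc t0 T)) (h0 : ∀ i, 0 < g i t0)
    (htouch : ∀ t ∈ Ioc t0 T, (∀ j, 0 ≤ g j t) → ∀ i, g i t = 0 →
      ∃ g', HasDerivWithinAt (g i) g' (Icc t0 T) t ∧ 0 < g') :
    ∀ t ∈ Icc t0 T, ∀ i, 0 < g i t := by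
  by_contra hcon
  push Not at hcon
  obtain ⟨t1, ht1, i1, hi1⟩ := hcon
  set B : Set ℝ := ⋃ i, {t ∈ Icc t0 T | g i t ≤ 0} with hB
  have hBc : IsClosed B := by
    apply isClosed_iUnion_of_finite
    intro i
    exact (hcont i).preimage_isClosed_of_isClosed isClosed_Icc isClosed_Iic
  have hBne : B.Nonempty := ⟨t1, mem_iUnion.2 ⟨i1, ht1, hi1⟩⟩
  have hBb : BddBelow B := ⟨t0, by
    intro t ht; obtain ⟨i, hi⟩ := mem_iUnion.1 ht; exact hi.1.1⟩
  have hmem := hBc.csInf_mem hBne hBb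
  set τ := sInf B with hτ
  obtain ⟨i, hiI, hi0⟩ := mem_iUnion.1 hmem
  have hlt : t0 < τ := by
    rcases hiI.1.eq_or_lt with h | h
    · exfalso
      have := h0 i
      rw [h] at this
      linarith
    · exact h
  have hpos : ∀ s ∈ Ico t0 τ, ∀ j, 0 < g j s := by
    intro s hs j
    by_contra hc
    push Not at hc
    have : s ∈ B := mem_iUnion.2 ⟨j, ⟨hs.1, hs.2.le.trans hiI.2⟩, hc⟩
    exact absurd (csInf_le hBb this) (not_le.2 hs.2)
  have hcl : τ ∈ closure (Ico t0 τ) := by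
    rw [closure_Ico hlt.ne]; exact ⟨hlt.le, le_rfl⟩
  have hne : (𝓝[Ico t0 τ] τ).NeBot := mem_closure_iff_nhdsWithin_neBot.1 hcl
  have hsub : Ico t0 τ ⊆ Icc t0 T := fun s hs => ⟨hs.1, hs.2.le.trans hiI.2⟩
  have hge : ∀ j, 0 ≤ g j τ := by
    intro j
    have hc := ((hcont j) τ hiI).mono hsub
    refine ge_of_tendsto hc ?_
    filter_upwards [self_mem_nhdsWithin] with s hs using (hpos s hs j).le
  obtain ⟨g', hg', hg0⟩ := htouch τ ⟨hlt, hiI.2⟩ hge i (le_antisymm hi0 (hge i))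
  have hsl := hasDerivWithinAt_iff_tendsto_slope.1 (hg'.mono hsub)
  have e : Ico t0 τ \ {τ} = Ico t0 τ := by
    ext s; simp only [Set.mem_sdiff, mem_singleton_iff, and_iff_left_iff_imp]
    intro hs; exact hs.2.ne
  rw [e] at hsl
  have : g' ≤ 0 := by
    refine le_of_tendsto hsl ?_
    filter_upwards [self_mem_nhdsWithin] with s hs
    rw [slope_def_field]
    apply div_nonpos_of_nonneg_of_nonpos
    · have := hpos s hs i
      have h2 : g i τ = 0 := le_antisymm hi0 (hge i)
      linarith
    · linarith [hs.2]
  linarith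

open Set Filter Topology

/-! ### ODE existence for the discrete scheme -/

lemma rpow_lipschitz {lo hi a : ℝ} (hlo : 0 < lo) :
    ∃ K, 0 ≤ K ∧ ∀ x ∈ Icc lo hi, ∀ y ∈ Icc lo hi, |x ^ a - y ^ a| ≤ K * |x - y| := by
  have hc : ContinuousOn (fun x : ℝ => a * x ^ (a - 1)) (Icc lo hi) := by
    apply ContinuousOn.mul continuousOn_const
    apply ContinuousOn.rpow_const continuousOn_id
    intro x hx; left; exact (hlo.trans_le hx.1).ne'
  obtain ⟨C, hC⟩ := isCompact_Icc.exists_bound_of_continuousOn hc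
  refine ⟨max C 0, le_max_right _ _, ?_⟩
  intro x hx y hy
  have := (convex_Icc lo hi).norm_image_sub_le_of_norm_hasDerivWithin_le
    (f := fun x : ℝ => x ^ a) (f' := fun x => a * x ^ (a - 1)) (C := max C 0) (s := Icc lo hi)
    (fun z hz => (Real.hasDerivAt_rpow_const (Or.inl (hlo.trans_le hz.1).ne')).hasDerivWithinAt)
    (fun z hz => (hC z hz).trans (le_max_left _ _)) hy hx
  simpa [Real.norm_eq_abs] using this

noncomputable def cl (lo hi x : ℝ) : ℝ := max lo (min x hi)

lemma cl_mem {lo hi : ℝ} (h : lo ≤ hi) (x : ℝ) : cl lo hi x ∈ Icc lo hi :=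
  ⟨le_max_left _ _, max_le h (min_le_right _ _)⟩

lemma cl_eq {lo hi x : ℝ} (h : x ∈ Icc lo hi) : cl lo hi x = x := by
  unfold cl; rw [min_eq_left h.2, max_eq_right h.1]

lemma cl_lip (lo hi x y : ℝ) : |cl lo hi x - cl lo hi y| ≤ |x - y| := by
  unfold cl
  calc |max lo (min x hi) - max lo (min y hi)| ≤ |min x hi - min y hi| := by
        rw [max_comm lo, max_comm lo]; exact abs_max_sub_max_le_abs _ _ _
    _ ≤ |x - y| := abs_inf_sub_inf_le_abs _ _ _

lemma cl_mono (lo hi : ℝ) : Monotone (cl lo hi) := by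
  intro x y h; unfold cl; gcongr

def Lip {E : Type*} [PseudoMetricSpace E] (f : E → ℝ) : Prop :=
  ∃ K, 0 ≤ K ∧ ∀ x y, |f x - f y| ≤ K * dist x y

lemma Lip.const {E : Type*} [PseudoMetricSpace E] (c : ℝ) : Lip (fun _ : E => c) :=
  ⟨0, le_rfl, fun x y => by simp⟩

lemma Lip.add {E : Type*} [PseudoMetricSpace E] {f g : E → ℝ} (hf : Lip f) (hg : Lip g) :
    Lip (fun x => f x + g x) := by
  obtain ⟨K, hK, h⟩ := hf
  obtain ⟨L, hL, h'⟩ := hg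
  refine ⟨K + L, by positivity, fun x y => ?_⟩
  have e : f x + g x - (f y + g y) = (f x - f y) + (g x - g y) := by ring
  rw [e, add_mul]
  exact (abs_add_le _ _).trans (add_le_add (h x y) (h' x y))

lemma Lip.const_mul {E : Type*} [PseudoMetricSpace E] {f : E → ℝ} (hf : Lip f) (c : ℝ) :
    Lip (fun x => c * f x) := by
  obtain ⟨K, hK, h⟩ := hf
  refine ⟨|c| * K, by positivity, fun x y => ?_⟩
  rw [← mul_sub, abs_mul, mul_assoc]
  exact mul_le_mul_of_nonneg_left (h x y) (abs_nonneg c)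

lemma Lip.sub {E : Type*} [PseudoMetricSpace E] {f g : E → ℝ} (hf : Lip f) (hg : Lip g) :
    Lip (fun x => f x - g x) := by
  have := hf.add (hg.const_mul (-1))
  simpa [sub_eq_add_neg] using this

lemma Lip.comp {E : Type*} [PseudoMetricSpace E] {f : E → ℝ} (hf : Lip f) {φ : ℝ → ℝ} {L : ℝ}
    (hL : 0 ≤ L) (hφ : ∀ x y, |φ x - φ y| ≤ L * |x - y|) : Lip (fun x => φ (f x)) := by
  obtain ⟨K, hK, h⟩ := hf
  refine ⟨L * K, by positivity, fun x y => ?_⟩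
  rw [mul_assoc]
  exact (hφ _ _).trans (mul_le_mul_of_nonneg_left (h x y) hL)

lemma Lip.mul {E : Type*} [PseudoMetricSpace E] {f g : E → ℝ} (hf : Lip f) (hg : Lip g)
    {A B : ℝ} (hA : ∀ x, |f x| ≤ A) (hB : ∀ x, |g x| ≤ B) : Lip (fun x => f x * g x) := by
  obtain ⟨K, hK, h⟩ := hf
  obtain ⟨L, hL, h'⟩ := hg
  refine ⟨|A| * L + |B| * K, by positivity, fun x y => ?_⟩
  have e : f x * g x - f y * g y = f x * (g x - g y) + g y * (f x - f y) := by ring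
  rw [e]
  refine (abs_add_le _ _).trans ?_
  rw [abs_mul, abs_mul, add_mul, mul_assoc, mul_assoc]
  apply add_le_add
  · exact mul_le_mul ((hA x).trans (le_abs_self _)) (h' x y) (abs_nonneg _) (abs_nonneg _)
  · exact mul_le_mul ((hB y).trans (le_abs_self _)) (h x y) (abs_nonneg _) (abs_nonneg _)

lemma ode_global {n : ℕ} (F : (Fin n → ℝ) → (Fin n → ℝ)) (L : ℝ) (hL : 0 ≤ L)
    (hb : ∀ x i, |F x i| ≤ L) (hl : ∀ i, Lip (fun x => F x i)) (x0 : Fin n → ℝ) (T : ℝ)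
    (hT : 0 ≤ T) : ∃ X : ℝ → Fin n → ℝ, X 0 = x0 ∧ ∀ t ∈ Icc 0 T, ∀ i,
      HasDerivWithinAt (fun t => X t i) (F (X t) i) (Icc 0 T) t := by
  choose K hK hKl using hl
  set KK : NNReal := ⟨∑ i, K i, Finset.sum_nonneg (fun i _ => hK i)⟩ with hKK
  have hlip : LipschitzWith KK F := by
    apply LipschitzWith.of_dist_le_mul
    intro x y
    rw [dist_pi_le_iff (by positivity)]
    intro i
    rw [Real.dist_eq]
    refine (hKl i x y).trans ?_
    apply mul_le_mul_of_nonneg_right _ dist_nonneg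
    exact Finset.single_le_sum (fun i _ => hK i) (Finset.mem_univ i)
  have hpl : IsPicardLindelof (fun _ : ℝ => F) (⟨0, ⟨le_rfl, hT⟩⟩ : Icc (0:ℝ) T) x0
      (⟨L * T, by positivity⟩ : NNReal) 0 ⟨L, hL⟩ KK := by
    apply IsPicardLindelof.of_time_independent
    · intro x _
      rw [pi_norm_le_iff_of_nonneg (by positivity)]
      intro i; exact hb x i
    · exact hlip.lipschitzOnWith
    · simp [hT]; exact le_rfl
  obtain ⟨X, hX0, hX⟩ := hpl.exists_eq_forall_mem_Icc_hasDerivWithinAt₀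
  refine ⟨X, hX0, fun t ht i => ?_⟩
  exact (hasDerivWithinAt_pi.1 (hX t ht)) i

/-- face slopes from cell values -/
noncomputable def Sf (n : ℕ) (κ : ℝ) (y : ℕ → ℝ) (j : ℕ) : ℝ :=
  if j = 0 then 0 else if j < n then n * (y (j - 1) - y j) else κ

/-- discrete curvature of cell `j` -/
noncomputable def dh (N n : ℕ) (S : ℕ → ℝ) (j : ℕ) : ℝ :=
  n * (sg (S (j + 1)) - sg (S j)) + (N - 1) * (n / (j + 1)) * sg (S (j + 1))

/-- clamped velocity -/
noncomputable def dVc (N n : ℕ) (α b κ lo hi : ℝ) (S : ℕ → ℝ) (j : ℕ) : ℝ :=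
  (b - (cl lo hi (dh N n S j)) ^ α) * wf (cl (-1) (κ + 1) (S j))

lemma scheme_exists (N n : ℕ) (α b κ lo hi : ℝ) (hκ : 0 < κ) (hlo : 0 < lo)
    (hhi : lo ≤ hi) (U0 : ℕ → ℝ) (T : ℝ) (hT : 0 ≤ T) :
    ∃ U : ℕ → ℝ → ℝ, (∀ j < n, U j 0 = U0 j) ∧ ∀ t ∈ Icc 0 T, ∀ j < n,
      HasDerivWithinAt (U j) (dVc N n α b κ lo hi (Sf n κ (fun i => U i t)) j) (Icc 0 T) t := by
  set ex : (Fin n → ℝ) → ℕ → ℝ := fun x j => if h : j < n then x ⟨j, h⟩ else 0 with hex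
  have hexl : ∀ j, Lip (fun x => ex x j) := by
    intro j
    by_cases h : j < n
    · refine ⟨1, zero_le_one, fun x y => ?_⟩
      simp only [hex, h, dif_pos, one_mul]
      rw [← Real.dist_eq]; exact dist_le_pi_dist x y _
    · simp only [hex, h, dif_neg, not_false_eq_true]; exact Lip.const 0
  have hSl : ∀ j, Lip (fun x => Sf n κ (ex x) j) := by
    intro j
    unfold Sf
    by_cases h0 : j = 0
    · simp only [h0, if_true]; exact Lip.const 0
    · by_cases h : j < n
      · simp only [h0, h, if_true, if_false]
        exact ((hexl (j-1)).sub (hexl j)).const_mul _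
      · simp only [h0, h, if_false]; exact Lip.const κ
  have hsgl : ∀ j, Lip (fun x => sg (Sf n κ (ex x) j)) := fun j =>
    (hSl j).comp zero_le_one (fun x y => by rw [one_mul]; exact abs_sg_sub_le x y)
  have hhl : ∀ j, Lip (fun x => dh N n (Sf n κ (ex x)) j) := by
    intro j; unfold dh
    exact (((hsgl (j+1)).sub (hsgl j)).const_mul _).add ((hsgl (j+1)).const_mul _)
  obtain ⟨K, hK, hKl⟩ := rpow_lipschitz (a := α) (hi := hi) hlo
  have hfl : ∀ j, Lip (fun x => b - (cl lo hi (dh N n (Sf n κ (ex x)) j)) ^ α) := by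
    intro j
    apply (Lip.const b).sub
    apply (hhl j).comp (φ := fun z => (cl lo hi z) ^ α) hK
    intro x y
    exact (hKl _ (cl_mem hhi x) _ (cl_mem hhi y)).trans
      (mul_le_mul_of_nonneg_left (cl_lip _ _ _ _) hK)
  have hwl : ∀ j, Lip (fun x => wf (cl (-1) (κ + 1) (Sf n κ (ex x) j))) := by
    intro j
    apply (hSl j).comp (φ := fun z => wf (cl (-1) (κ+1) z)) zero_le_one
    intro x y
    rw [one_mul]; exact (abs_wf_sub_le _ _).trans (cl_lip _ _ _ _)
  have hwb : ∀ z, |wf (cl (-1) (κ + 1) z)| ≤ wf (κ + 1) := by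
    intro z
    rw [abs_of_pos (wf_pos _)]
    apply wf_le_wf
    have := cl_mem (lo := -1) (hi := κ + 1) (by linarith) z
    rw [abs_of_pos (by linarith : 0 < κ + 1), abs_le]
    exact ⟨by linarith [this.1], this.2⟩
  have hcc : ContinuousOn (fun z : ℝ => b - z ^ α) (Icc lo hi) := by
    apply ContinuousOn.sub continuousOn_const
    apply ContinuousOn.rpow_const continuousOn_id
    intro x hx; left; exact (hlo.trans_le hx.1).ne'
  obtain ⟨A, hA⟩ := isCompact_Icc.exists_bound_of_continuousOn hcc
  have hfb : ∀ z, |b - (cl lo hi z) ^ α| ≤ A := fun z => hA _ (cl_mem hhi z)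
  have hA0 : 0 ≤ A := (abs_nonneg _).trans (hfb 0)
  set F : (Fin n → ℝ) → (Fin n → ℝ) := fun x i => dVc N n α b κ lo hi (Sf n κ (ex x)) i with hF
  obtain ⟨X, hX0, hX⟩ := ode_global F (A * wf (κ + 1)) (mul_nonneg hA0 (wf_pos _).le)
    (fun x i => by
      simp only [hF, dVc]
      rw [abs_mul]
      exact mul_le_mul (hfb _) (hwb _) (abs_nonneg _) hA0)
    (fun i => (hfl i).mul (hwl i) (fun x => hfb _) (fun x => hwb _))
    (fun i => U0 i) T hT
  refine ⟨fun j t => ex (X t) j, ?_, ?_⟩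
  · intro j hj; simp [hex, hj, hX0]
  · intro t ht j hj
    have := hX t ht ⟨j, hj⟩
    simp only [hex, hj, dif_pos]
    simp only [hF, hex] at this
    exact this

open Set Filter Topology

/-! ### Discrete invariants -/

/-- unclamped velocity -/
noncomputable def dV (N n : ℕ) (α b : ℝ) (S : ℕ → ℝ) (j : ℕ) : ℝ :=
  (b - (dh N n S j) ^ α) * wf (S j)

structure Reg (N n : ℕ) (α b κ e : ℝ) (s v : ℕ → ℝ) : Prop where
  hs0 : s 0 = 0
  hsn : s n = κ
  hA : ∀ j, 1 ≤ j → j ≤ n → e * (j / n) ≤ sg (s j)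
  hB : ∀ j < n, s j ≤ s (j + 1)
  hV : ∀ j < n, v j = dV N n α b s j
  hpos : ∀ j < n, 0 < v j

namespace Reg

variable {N n : ℕ} {α b κ e : ℝ} {s v : ℕ → ℝ}

lemma hA' (h : Reg N n α b κ e s v) (j : ℕ) (hj : j ≤ n) : e * (j / n) ≤ sg (s j) := by
  rcases Nat.eq_zero_or_pos j with h0 | h0
  · subst h0; simp [h.hs0, sg_zero]
  · exact h.hA j h0 hj

lemma mono (h : Reg N n α b κ e s v) : ∀ i j, i ≤ j → j ≤ n → s i ≤ s j := by
  intro i j hij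
  induction j, hij using Nat.le_induction with
  | base => intro _; exact le_rfl
  | succ j hj ih => intro hn; exact (ih (by omega)).trans (h.hB j (by omega))

lemma s_nonneg (h : Reg N n α b κ e s v) (j : ℕ) (hj : j ≤ n) : 0 ≤ s j := by
  have := h.mono 0 j (Nat.zero_le _) hj; rwa [h.hs0] at this

lemma s_le (h : Reg N n α b κ e s v) (j : ℕ) (hj : j ≤ n) : s j ≤ κ := by
  have := h.mono j n hj le_rfl; rwa [h.hsn] at this

lemma dh_ge (hN : 1 < N) (h : Reg N n α b κ e s v) (j : ℕ) (hj : j < n) {x : ℝ}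
    (hx : x ≤ sg (s (j + 1))) :
    (N - 1) * (n / (j + 1)) * x ≤ dh N n s j := by
  have hN' : (1:ℝ) < N := by exact_mod_cast hN
  have h1 : 0 ≤ (n:ℝ) * (sg (s (j + 1)) - sg (s j)) :=
    mul_nonneg (Nat.cast_nonneg _) (sub_nonneg.2 (sg_mono (h.hB j hj)))
  have h2 : ((N:ℝ) - 1) * (n / (j + 1)) * x ≤ (N - 1) * (n / (j + 1)) * sg (s (j+1)) := by
    apply mul_le_mul_of_nonneg_left hx
    have : (0:ℝ) < N - 1 := by linarith
    positivity
  unfold dh; linarith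

lemma dh_ge_e (hN : 1 < N) (h : Reg N n α b κ e s v) (j : ℕ) (hj : j < n) :
    (N - 1) * e ≤ dh N n s j := by
  have h1 := h.hA (j + 1) (by omega) (by omega)
  have h2 := h.dh_ge hN j hj h1
  have hn : (0:ℝ) < n := by exact_mod_cast (by omega : 0 < n)
  have e1 : ((N:ℝ) - 1) * (n / (j + 1)) * (e * (((j + 1 : ℕ) : ℝ) / n)) = (N - 1) * e := by
    push_cast; field_simp
  rwa [e1] at h2

lemma dh_pos (hN : 1 < N) (he : 0 < e) (h : Reg N n α b κ e s v) (j : ℕ) (hj : j < n) :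
    0 < dh N n s j := by
  have hN' : (1:ℝ) < N := by exact_mod_cast hN
  have := h.dh_ge_e hN j hj
  have h2 : 0 < ((N:ℝ) - 1) * e := mul_pos (by linarith) he
  linarith

lemma f_pos (h : Reg N n α b κ e s v) (j : ℕ) (hj : j < n) : 0 < b - (dh N n s j) ^ α := by
  have h1 := h.hpos j hj
  rw [h.hV j hj, dV] at h1
  exact (mul_pos_iff_of_pos_right (wf_pos _)).1 h1

lemma dh_lt (hN : 1 < N) (he : 0 < e) (hα : 0 < α) (h : Reg N n α b κ e s v) (j : ℕ) (hj : j < n) :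
    dh N n s j < b ^ (1 / α) := by
  have h1 := h.f_pos j hj
  have h0 := h.dh_pos hN he j hj
  have h2 : (dh N n s j ^ α) ^ (1 / α) < b ^ (1/α) :=
    Real.rpow_lt_rpow (Real.rpow_nonneg h0.le _) (by linarith) (by positivity)
  rwa [← Real.rpow_mul h0.le, mul_one_div_cancel hα.ne', Real.rpow_one] at h2

lemma touchA (hN : 1 < N) (hα : 0 < α) (he : 0 < e) (hκ : 0 < κ) (h : Reg N n α b κ e s v) (j : ℕ)
    (hj : j + 1 < n) (ht : sg (s (j + 1)) = e * (((j + 1 : ℕ) : ℝ) / n)) :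
    - b * e ^ 2 * (((j + 1 : ℕ) : ℝ) / n) ≤
      1 / wf (s (j + 1)) ^ 3 * (n * (v j - v (j + 1))) := by
  have hN' : (1:ℝ) < N := by exact_mod_cast hN
  have hn : (0:ℝ) < n := by exact_mod_cast (by omega : 0 < n)
  have a0 := h.hA' j (by omega)
  have a2 := h.hA' (j + 2) (by omega)
  have hh1 : dh N n s j ≤ N * e := by
    have : dh N n s j ≤ n * (e * (((j + 1 : ℕ) : ℝ) / n) - e * (j / n))
        + (N - 1) * (n / (j + 1)) * (e * (((j + 1 : ℕ) : ℝ) / n)) := by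
      unfold dh; rw [ht]; gcongr
    refine this.trans (le_of_eq ?_)
    push_cast; field_simp; ring
  have hh2 : N * e ≤ dh N n s (j + 1) := by
    have : n * (e * (((j + 2 : ℕ) : ℝ) / n) - e * (((j + 1 : ℕ) : ℝ) / n))
        + (N - 1) * (n / (((j + 1 : ℕ) : ℝ) + 1)) * (e * (((j + 2 : ℕ) : ℝ) / n)) ≤
        dh N n s (j + 1) := by
      unfold dh; rw [ht]
      have : (0:ℝ) ≤ (N:ℝ) - 1 := by linarith
      gcongr
    refine le_trans (le_of_eq ?_) this
    push_cast; field_simp; ring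
  have hp1 := h.dh_pos hN he j (by omega)
  have hf1 := h.f_pos j (by omega)
  have hf2 := h.f_pos (j+1) (by omega)
  have hp2 := h.dh_pos hN he (j+1) (by omega)
  have hpow : (dh N n s j) ^ α ≤ (dh N n s (j + 1)) ^ α :=
    Real.rpow_le_rpow hp1.le (hh1.trans hh2) hα.le
  have hpow0 : 0 ≤ (dh N n s (j + 1)) ^ α := Real.rpow_nonneg hp2.le _
  have hw := wf_sub_le (s j) (s (j + 1))
  have hs := sub_le_sg_sub (h.s_nonneg j (by omega)) (h.hB j (by omega)) (le_refl (s (j + 1)))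
  have hw0 := wf_pos (s j)
  have hw1 := wf_pos (s (j + 1))
  have hww : wf (s j) ≤ wf (s (j+1)) := wf_le_of_nonneg (h.s_nonneg j (by omega)) (h.hB j (by omega))
  have hσ : 0 ≤ sg (s (j + 1)) := sg_nonneg (h.s_nonneg _ (by omega))
  have hdiff : sg (s (j+1)) - sg (s j) ≤ e / n := by
    rw [ht]
    have : e * (((j + 1 : ℕ) : ℝ) / n) - e * (j / n) = e / n := by push_cast; field_simp; ring
    linarith
  have hbpos : 0 < b := by linarith
  have key : - b * (wf (s (j + 1)) ^ 3 * (e / n) * sg (s (j + 1))) ≤ v j - v (j + 1) := by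
    rw [h.hV j (by omega), h.hV (j+1) (by omega), dV, dV]
    have k1 : wf (s (j + 1)) - wf (s j) ≤ wf (s (j + 1)) ^ 3 * (e / n) * sg (s (j + 1)) := by
      refine hw.trans (mul_le_mul_of_nonneg_right ?_ hσ)
      refine hs.trans (mul_le_mul_of_nonneg_left hdiff (by positivity))
    have k2 : b * (wf (s (j + 1)) - wf (s j)) ≤ b * (wf (s (j + 1)) ^ 3 * (e / n) * sg (s (j + 1))) :=
      mul_le_mul_of_nonneg_left k1 hbpos.le
    nlinarith [mul_nonneg (sub_nonneg.2 hpow) hw0.le, mul_nonneg hpow0 (sub_nonneg.2 hww)]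
  have : 1 / wf (s (j + 1)) ^ 3 * (n * (- b * (wf (s (j + 1)) ^ 3 * (e / n) * sg (s (j + 1))))) =
      - b * e ^ 2 * (((j + 1 : ℕ) : ℝ) / n) := by
    rw [ht]; field_simp
  rw [← this]
  gcongr

lemma touchB_last (hN : 1 < N) (hα : 0 < α) (he : 0 < e) (hκ : 0 < κ)
    (h : Reg N n α b κ e s v) (j : ℕ)
    (hj : j + 2 = n) (ht : s (j + 1) = s (j + 2)) : v j < v (j + 1) := by
  have hN' : (1:ℝ) < N := by exact_mod_cast hN
  have hn : (0:ℝ) < n := by exact_mod_cast (by omega : 0 < n)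
  have hP : 0 < sg (s (j+1)) := by
    rw [ht, hj, h.hsn]; exact sg_pos hκ
  have h1 := h.dh_ge hN j (by omega) le_rfl
  have h2 : dh N n s (j + 1) = (N - 1) * (n / (j + 2)) * sg (s (j+1)) := by
    unfold dh; rw [show j + 1 + 1 = j + 2 from rfl, ← ht]; push_cast; ring
  have h3 : dh N n s (j + 1) < dh N n s j := by
    refine lt_of_lt_of_le ?_ h1
    rw [h2]
    apply mul_lt_mul_of_pos_right _ hP
    apply mul_lt_mul_of_pos_left _ (by linarith)
    apply div_lt_div_of_pos_left hn (by positivity) (by linarith)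
  have hp2 := h.dh_pos hN he (j+1) (by omega)
  have hpow : (dh N n s (j+1)) ^ α < (dh N n s j) ^ α := Real.rpow_lt_rpow hp2.le h3 hα
  have hf1 := h.f_pos j (by omega)
  have hww : wf (s j) ≤ wf (s (j+1)) := wf_le_of_nonneg (h.s_nonneg j (by omega)) (h.hB j (by omega))
  have hw1 := wf_pos (s (j + 1))
  rw [h.hV j (by omega), h.hV (j+1) (by omega), dV, dV]
  calc (b - dh N n s j ^ α) * wf (s j) ≤ (b - dh N n s j ^ α) * wf (s (j+1)) := by gcongr
    _ < _ := by
      apply mul_lt_mul_of_pos_right _ hw1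
      linarith

lemma touchB (hN : 1 < N) (hα : 0 < α) (he : 0 < e)
    (h : Reg N n α b κ e s v) (j : ℕ)
    (hj : j + 2 < n) (ht : s (j + 1) = s (j + 2)) : v j + v (j + 2) < 2 * v (j + 1) := by
  have hN' : (1:ℝ) < N := by exact_mod_cast hN
  have hn : (0:ℝ) < n := by exact_mod_cast (by omega : 0 < n)
  have hP : 0 < sg (s (j+1)) := by
    refine lt_of_lt_of_le ?_ (h.hA (j+1) (by omega) (by omega))
    positivity
  set A : ℝ := (N - 1) * n * sg (s (j + 1)) with hAdef
  have hA : 0 < A := by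
    have : (0:ℝ) < N - 1 := by linarith
    positivity
  have h1 : A / (j + 1) ≤ dh N n s j := by
    refine le_trans (le_of_eq ?_) (h.dh_ge hN j (by omega) le_rfl)
    rw [hAdef]; ring
  have h2 : dh N n s (j + 1) = A / (j + 2) := by
    unfold dh; rw [show j + 1 + 1 = j + 2 from rfl, ← ht, hAdef]; push_cast; ring
  have h3 : A / (j + 3) ≤ dh N n s (j + 2) := by
    refine le_trans (le_of_eq ?_) (h.dh_ge hN (j + 2) (by omega) (x := sg (s (j+1))) ?_)
    · rw [hAdef]; push_cast; ring
    · exact sg_mono (h.mono _ _ (by omega) (by omega))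
  have p1 : (A / (j + 1)) ^ α ≤ (dh N n s j) ^ α := Real.rpow_le_rpow (by positivity) h1 hα.le
  have p3 : (A / (j + 3)) ^ α ≤ (dh N n s (j+2)) ^ α := Real.rpow_le_rpow (by positivity) h3 hα.le
  have pc : 2 * (A / (j + 2)) ^ α < (A / (j + 1)) ^ α + (A / (j + 3)) ^ α := by
    have q1 : 0 < (A / (j + 1)) ^ α := Real.rpow_pos_of_pos (by positivity) _
    have q2 : 0 < (A / (j + 2)) ^ α := Real.rpow_pos_of_pos (by positivity) _
    have q3 : 0 < (A / (j + 3)) ^ α := Real.rpow_pos_of_pos (by positivity) _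
    have q : (A / (j + 2)) ^ α * (A / (j + 2)) ^ α < (A / (j + 1)) ^ α * (A / (j + 3)) ^ α := by
      rw [← Real.mul_rpow (by positivity) (by positivity),
        ← Real.mul_rpow (by positivity) (by positivity)]
      apply Real.rpow_lt_rpow (by positivity) _ hα
      rw [div_mul_div_comm, div_mul_div_comm]
      apply div_lt_div_of_pos_left (by positivity) (by positivity)
      nlinarith
    nlinarith [sq_nonneg ((A / (j + 1)) ^ α - (A / (j + 3)) ^ α)]
  have hf1 := h.f_pos j (by omega)
  have hww : wf (s j) ≤ wf (s (j+1)) := wf_le_of_nonneg (h.s_nonneg j (by omega)) (h.hB j (by omega))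
  have hw1 := wf_pos (s (j + 1))
  rw [h.hV j (by omega), h.hV (j+1) (by omega), h.hV (j+2) (by omega), dV, dV, dV, h2, ← ht]
  have c1 : (b - dh N n s j ^ α) * wf (s j) ≤ (b - (A / (j + 1)) ^ α) * wf (s (j + 1)) := by
    calc _ ≤ (b - dh N n s j ^ α) * wf (s (j + 1)) := by gcongr
      _ ≤ _ := by gcongr
  have c3 : (b - dh N n s (j + 2) ^ α) * wf (s (j + 1)) ≤ (b - (A / (j + 3)) ^ α) * wf (s (j + 1)) := by
    gcongr
  nlinarith

end Reg

/-- derivative of the velocity -/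
lemma vel_deriv {x y : ℝ → ℝ} {x' y' t n c α b : ℝ} {I : Set ℝ}
    (hx : HasDerivWithinAt x x' I t) (hy : HasDerivWithinAt y y' I t)
    (hh : 0 < n * (sg (y t) - sg (x t)) + c * sg (y t)) :
    HasDerivWithinAt (fun τ => (b - (n * (sg (y τ) - sg (x τ)) + c * sg (y τ)) ^ α) * wf (x τ))
      (-(α * (n * (sg (y t) - sg (x t)) + c * sg (y t)) ^ (α - 1) * wf (x t) * (n + c) / wf (y t) ^ 3) * y'
        + (n * (α * (n * (sg (y t) - sg (x t)) + c * sg (y t)) ^ (α - 1) * wf (x t) / wf (x t) ^ 3)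
          + (b - (n * (sg (y t) - sg (x t)) + c * sg (y t)) ^ α) * sg (x t)) * x') I t := by
  have hsx := (hasDerivAt_sg (x t)).comp_hasDerivWithinAt t hx
  have hsy := (hasDerivAt_sg (y t)).comp_hasDerivWithinAt t hy
  have hwx := (hasDerivAt_wf (x t)).comp_hasDerivWithinAt t hx
  have hH := ((hsy.sub hsx).const_mul n).add (hsy.const_mul c)
  have hp := hH.rpow_const (p := α) (Or.inl (by simpa using hh.ne'))
  have hf := (hp.const_sub b).mul hwx
  refine HasDerivWithinAt.congr_deriv (f := (fun τ => (b - (n * (sg (y τ) - sg (x τ)) + c * sg (y τ)) ^ α) * wf (x τ))) hf ?_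
  simp only [Function.comp, Pi.add_apply, Pi.sub_apply]
  ring

open Set Filter Topology

noncomputable def eta (η0 b t : ℝ) : ℝ := η0 / (1 + (b + 1) * η0 * t)

lemma eta_pos {η0 b t : ℝ} (h : 0 < η0) (hb : 0 < b) (ht : 0 ≤ t) : 0 < eta η0 b t := by
  unfold eta; positivity

lemma eta_zero (η0 b : ℝ) : eta η0 b 0 = η0 := by simp [eta]

lemma eta_anti {η0 b t t' : ℝ} (h : 0 < η0) (hb : 0 < b) (ht : 0 ≤ t) (htt : t ≤ t') :
    eta η0 b t' ≤ eta η0 b t := by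
  unfold eta
  apply div_le_div_of_nonneg_left h.le (by positivity)
  gcongr

lemma eta_deriv {η0 b t : ℝ} (h : 0 < η0) (hb : 0 < b) (ht : 0 ≤ t) :
    HasDerivAt (eta η0 b) (-(b + 1) * eta η0 b t ^ 2) t := by
  have hp : 0 < 1 + (b + 1) * η0 * t := by positivity
  have h1 : HasDerivAt (fun t : ℝ => 1 + (b + 1) * η0 * t) ((b + 1) * η0) t := by
    have := ((hasDerivAt_id t).const_mul ((b + 1) * η0)).const_add 1
    simpa using this
  have h2 := (hasDerivAt_const t η0).div h1 hp.ne'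
  refine HasDerivAt.congr_deriv (f := eta η0 b) h2 ?_
  unfold eta
  field_simp
  ring

noncomputable def dS (n : ℕ) (v : ℕ → ℝ) (j : ℕ) : ℝ :=
  if j = 0 then 0 else if j < n then n * (v (j - 1) - v j) else 0

lemma Sf_deriv {n : ℕ} {κ t : ℝ} {U : ℕ → ℝ → ℝ} {v : ℕ → ℝ} {I : Set ℝ}
    (h : ∀ j < n, HasDerivWithinAt (U j) (v j) I t) (j : ℕ) :
    HasDerivWithinAt (fun τ => Sf n κ (fun i => U i τ) j) (dS n v j) I t := by
  unfold Sf dS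
  by_cases h0 : j = 0
  · simp only [h0, if_true]; exact hasDerivWithinAt_const _ _ _
  · by_cases hj : j < n
    · simp only [h0, hj, if_true, if_false]
      exact ((h (j-1) (by omega)).sub (h j hj)).const_mul _
    · simp only [h0, hj, if_false]; exact hasDerivWithinAt_const _ _ _

lemma Sf_congr {n : ℕ} {κ : ℝ} {y z : ℕ → ℝ} (h : ∀ i < n, y i = z i) : Sf n κ y = Sf n κ z := by
  funext j
  unfold Sf
  by_cases h0 : j = 0
  · simp [h0]
  · by_cases hj : j < n
    · simp only [h0, hj, if_true, if_false]; rw [h j hj, h (j-1) (by omega)]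
    · simp [h0, hj]

lemma Sf_zero (n : ℕ) (κ : ℝ) (y : ℕ → ℝ) : Sf n κ y 0 = 0 := by simp [Sf]

lemma Sf_n {n : ℕ} (hn : n ≠ 0) (κ : ℝ) (y : ℕ → ℝ) : Sf n κ y n = κ := by simp [Sf, hn]

noncomputable def pc (N n : ℕ) (α : ℝ) (s : ℕ → ℝ) (j : ℕ) : ℝ :=
  α * (dh N n s j) ^ (α - 1) * wf (s j) * (n + (N - 1) * (n / (j + 1))) / wf (s (j + 1)) ^ 3

noncomputable def qc (N n : ℕ) (α b : ℝ) (s : ℕ → ℝ) (j : ℕ) : ℝ :=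
  n * (α * (dh N n s j) ^ (α - 1) * wf (s j) / wf (s j) ^ 3) + (b - (dh N n s j) ^ α) * sg (s j)

lemma dV_deriv {N n : ℕ} {α b κ t : ℝ} {U : ℕ → ℝ → ℝ} {v : ℕ → ℝ} {I : Set ℝ}
    (h : ∀ j < n, HasDerivWithinAt (U j) (v j) I t) (j : ℕ)
    (hp : 0 < dh N n (Sf n κ (fun i => U i t)) j) :
    HasDerivWithinAt (fun τ => dV N n α b (Sf n κ (fun i => U i τ)) j)
      (- pc N n α (Sf n κ (fun i => U i t)) j * dS n v (j + 1)
        + qc N n α b (Sf n κ (fun i => U i t)) j * dS n v j) I t := by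
  have := vel_deriv (α := α) (b := b) (c := ((N:ℝ) - 1) * (n / (j + 1))) (n := n)
    (Sf_deriv (κ := κ) h j) (Sf_deriv (κ := κ) h (j + 1)) hp
  exact this

lemma pc_nonneg {N n : ℕ} {α b κ e : ℝ} {s v : ℕ → ℝ} (hN : 1 < N) (hα : 0 < α) (he : 0 < e)
    (h : Reg N n α b κ e s v) (j : ℕ) (hj : j < n) : 0 ≤ pc N n α s j := by
  have h1 := h.dh_pos hN he j hj
  have h2 := Real.rpow_pos_of_pos h1 (α - 1)
  have hN' : (0:ℝ) < (N:ℝ) - 1 := by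
    have : (1:ℝ) < N := by exact_mod_cast hN
    linarith
  have := wf_pos (s j)
  have := wf_pos (s (j + 1))
  unfold pc
  positivity

lemma qc_nonneg {N n : ℕ} {α b κ e : ℝ} {s v : ℕ → ℝ} (hN : 1 < N) (hα : 0 < α) (he : 0 < e)
    (h : Reg N n α b κ e s v) (j : ℕ) (hj : j < n) : 0 ≤ qc N n α b s j := by
  have h1 := h.dh_pos hN he j hj
  have h2 := Real.rpow_pos_of_pos h1 (α - 1)
  have h3 := h.f_pos j hj
  have h4 := sg_nonneg (h.s_nonneg j hj.le)
  have := wf_pos (s j)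
  unfold qc
  positivity

/-- maximum principle sign -/
lemma lin_nonneg {n : ℕ} {v : ℕ → ℝ} {P Q : ℝ} (hP : 0 ≤ P) (hQ : 0 ≤ Q) (j : ℕ)
    (hj : j < n) (hmin : ∀ i < n, v j ≤ v i) : 0 ≤ - P * dS n v (j + 1) + Q * dS n v j := by
  have h1 : dS n v (j + 1) ≤ 0 := by
    unfold dS
    by_cases h : j + 1 < n
    · simp only [h, if_true, Nat.add_eq_zero_iff, one_ne_zero, and_false, if_false, Nat.add_sub_cancel]
      exact mul_nonpos_of_nonneg_of_nonpos (Nat.cast_nonneg _) (by linarith [hmin (j+1) h])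
    · simp [h]
  have h2 : 0 ≤ dS n v j := by
    unfold dS
    by_cases h0 : j = 0
    · simp [h0]
    · simp only [h0, hj, if_true, if_false]
      exact mul_nonneg (Nat.cast_nonneg _) (by linarith [hmin (j-1) (by omega)])
  nlinarith [mul_nonneg hP (neg_nonneg.2 h1), mul_nonneg hQ h2]

lemma lin_nonpos {n : ℕ} {v : ℕ → ℝ} {P Q : ℝ} (hP : 0 ≤ P) (hQ : 0 ≤ Q) (j : ℕ)
    (hj : j < n) (hmax : ∀ i < n, v i ≤ v j) : - P * dS n v (j + 1) + Q * dS n v j ≤ 0 := by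
  have h1 : 0 ≤ dS n v (j + 1) := by
    unfold dS
    by_cases h : j + 1 < n
    · simp only [h, if_true, Nat.add_eq_zero_iff, one_ne_zero, and_false, if_false, Nat.add_sub_cancel]
      exact mul_nonneg (Nat.cast_nonneg _) (by linarith [hmax (j+1) h])
    · simp [h]
  have h2 : dS n v j ≤ 0 := by
    unfold dS
    by_cases h0 : j = 0
    · simp [h0]
    · simp only [h0, hj, if_true, if_false]
      exact mul_nonpos_of_nonneg_of_nonpos (Nat.cast_nonneg _) (by linarith [hmax (j-1) (by omega)])
  nlinarith [mul_nonneg hP h1, mul_nonneg hQ (neg_nonneg.2 h2)]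

lemma reg_of_clamped {N n : ℕ} {α b κ e lo hi : ℝ} {s : ℕ → ℝ} (hN : 1 < N) (hα : 0 < α)
    (hκ : 0 < κ) (hb : 0 < b)
    (hlo0 : 0 < lo) (hlo : lo < (N - 1) * e) (hhi : b ^ (1 / α) < hi) (hlohi : lo ≤ hi)
    (hs0 : s 0 = 0) (hsn : s n = κ) (hA : ∀ j, 1 ≤ j → j ≤ n → e * (j / n) ≤ sg (s j))
    (hB : ∀ j < n, s j ≤ s (j + 1)) (hpos : ∀ j < n, 0 < dVc N n α b κ lo hi s j) :
    Reg N n α b κ e s (dVc N n α b κ lo hi s) ∧ ∀ j < n, dh N n s j ∈ Ioo lo hi := by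
  have hN' : (1:ℝ) < N := by exact_mod_cast hN
  have hmono : ∀ i j, i ≤ j → j ≤ n → s i ≤ s j := by
    intro i j hij
    induction j, hij using Nat.le_induction with
    | base => intro _; exact le_rfl
    | succ j hj ih => intro hn; exact (ih (by omega)).trans (hB j (by omega))
  have hdhlo : ∀ j < n, lo < dh N n s j := by
    intro j hj
    refine lt_of_lt_of_le hlo ?_
    have hn : (0:ℝ) < n := by exact_mod_cast (by omega : 0 < n)
    have h1 : 0 ≤ (n:ℝ) * (sg (s (j + 1)) - sg (s j)) :=
      mul_nonneg (Nat.cast_nonneg _) (sub_nonneg.2 (sg_mono (hB j hj)))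
    have h2 : ((N:ℝ) - 1) * (n / (j + 1)) * (e * (((j + 1 : ℕ) : ℝ) / n)) ≤
        (N - 1) * (n / (j + 1)) * sg (s (j+1)) := by
      apply mul_le_mul_of_nonneg_left (hA (j+1) (by omega) (by omega))
      have : (0:ℝ) < N - 1 := by linarith
      positivity
    have e1 : ((N:ℝ) - 1) * (n / (j + 1)) * (e * (((j + 1 : ℕ) : ℝ) / n)) = (N - 1) * e := by
      push_cast; field_simp
    unfold dh; linarith
  have hdhhi : ∀ j < n, dh N n s j < hi := by
    intro j hj
    by_contra hc
    push Not at hc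
    have h1 := (mul_pos_iff_of_pos_right (wf_pos _)).1 (hpos j hj)
    have h2 : cl lo hi (dh N n s j) = hi := by
      unfold cl; rw [min_eq_right hc, max_eq_right hlohi]
    rw [h2] at h1
    have hhi0 : 0 < b ^ (1/α) := Real.rpow_pos_of_pos hb _
    have h3 : (b ^ (1/α)) ^ α < hi ^ α := Real.rpow_lt_rpow hhi0.le hhi hα
    rw [← Real.rpow_mul hb.le, one_div_mul_cancel hα.ne', Real.rpow_one] at h3
    linarith
  refine ⟨⟨hs0, hsn, hA, hB, ?_, hpos⟩, fun j hj => ⟨hdhlo j hj, hdhhi j hj⟩⟩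
  intro j hj
  have a1 := hmono 0 j (by omega) hj.le
  have a2 := hmono j n hj.le le_rfl
  rw [hs0] at a1; rw [hsn] at a2
  unfold dVc dV
  rw [cl_eq ⟨(hdhlo j hj).le, (hdhhi j hj).le⟩, cl_eq ⟨by linarith, by linarith⟩]

set_option maxHeartbeats 1000000 in
lemma scheme_inv (N n : ℕ) (hN : 1 < N) (hn : 2 ≤ n) (α b κ T η0 m M : ℝ) (hα : 0 < α) (hb : 0 < b)
    (hκ : 0 < κ) (hT : 0 ≤ T) (hη0 : 0 < η0) (hηκ : η0 < sg κ) (hm : 0 < m) (U0 : ℕ → ℝ)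
    (hA0 : ∀ j, 1 ≤ j → j ≤ n → η0 * (j / n) < sg (Sf n κ U0 j))
    (hB0 : ∀ j < n, Sf n κ U0 j < Sf n κ U0 (j + 1))
    (hV0 : ∀ j < n, m ≤ dV N n α b (Sf n κ U0) j ∧ dV N n α b (Sf n κ U0) j ≤ M) :
    ∃ U : ℕ → ℝ → ℝ, (∀ j < n, U j 0 = U0 j) ∧
      (∀ t ∈ Icc 0 T, Reg N n α b κ (eta η0 b t) (Sf n κ (fun i => U i t))
        (dV N n α b (Sf n κ (fun i => U i t)))) ∧
      (∀ t ∈ Icc 0 T, ∀ j < n, m / 2 ≤ dV N n α b (Sf n κ (fun i => U i t)) j ∧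
        dV N n α b (Sf n κ (fun i => U i t)) j ≤ M + m / 2) ∧
      (∀ t ∈ Icc 0 T, ∀ j < n,
        HasDerivWithinAt (U j) (dV N n α b (Sf n κ (fun i => U i t)) j) (Icc 0 T) t) := by
  have hN' : (1:ℝ) ≤ (N:ℝ) - 1 := by
    have : (2:ℝ) ≤ N := by exact_mod_cast hN
    linarith
  have hnr : (0:ℝ) < n := by exact_mod_cast (by omega : 0 < n)
  have hηT := eta_pos hη0 hb hT
  set lo := eta η0 b T / 4 with hlo
  have hlo0 : 0 < lo := by positivity
  have hbα : 0 < b ^ (1 / α) := Real.rpow_pos_of_pos hb _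
  set hi := b ^ (1 / α) + 1 + lo with hhi
  have hlohi : lo ≤ hi := by linarith
  have hloe : ∀ t ∈ Icc 0 T, lo < (N - 1) * eta η0 b t := by
    intro t ht
    have h1 := eta_anti hη0 hb ht.1 ht.2
    nlinarith [eta_pos hη0 hb ht.1]
  obtain ⟨U, hU0, hU⟩ := scheme_exists N n α b κ lo hi hκ hlo0 hlohi U0 T hT
  set S : ℕ → ℝ → ℝ := fun j t => Sf n κ (fun i => U i t) j with hS
  set V : ℕ → ℝ → ℝ := fun j t => dVc N n α b κ lo hi (Sf n κ (fun i => U i t)) j with hV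
  have hSd : ∀ t ∈ Icc 0 T, ∀ j, HasDerivWithinAt (S j) (dS n (fun i => V i t) j) (Icc 0 T) t :=
    fun t ht j => Sf_deriv (fun i hi => hU t ht i hi) j
  have hSc : ∀ j, ContinuousOn (S j) (Icc 0 T) := fun j t ht => (hSd t ht j).continuousWithinAt
  have hdhc : ∀ j, ContinuousOn (fun t => dh N n (Sf n κ (fun i => U i t)) j) (Icc 0 T) := by
    intro j
    unfold dh
    have h1 := continuous_sg.comp_continuousOn (hSc j)
    have h2 := continuous_sg.comp_continuousOn (hSc (j + 1))
    exact (continuousOn_const.mul (h2.sub h1)).add (continuousOn_const.mul h2)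
  have hVc : ∀ j, ContinuousOn (V j) (Icc 0 T) := by
    intro j
    have hclc : ∀ a c : ℝ, Continuous (cl a c) := by intro a c; unfold cl; fun_prop
    simp only [hV, dVc]
    apply ContinuousOn.mul
    · apply continuousOn_const.sub
      apply ContinuousOn.rpow_const ((hclc lo hi).comp_continuousOn (hdhc j))
      intro t _; left; exact (hlo0.trans_le (cl_mem hlohi _).1).ne'
    · exact (continuous_wf.comp (hclc _ _)).comp_continuousOn (hSc j)
  have hSinit : (fun j => S j 0) = Sf n κ U0 := Sf_congr hU0
  have hSinit' : ∀ j, S j 0 = Sf n κ U0 j := fun j => congrFun hSinit j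
  have hVinit : ∀ j < n, V j 0 = dV N n α b (Sf n κ U0) j := by
    have hs : Sf n κ (fun i => U i 0) = Sf n κ U0 := hSinit
    intro j hj
    simp only [hV, hs]
    have hpos : ∀ j < n, 0 < dV N n α b (Sf n κ U0) j := fun j hj => hm.trans_le (hV0 j hj).1
    have R : Reg N n α b κ η0 (Sf n κ U0) (dV N n α b (Sf n κ U0)) :=
      ⟨Sf_zero _ _ _, Sf_n (by omega) _ _, fun j h1 h2 => (hA0 j h1 h2).le,
        fun j hj => (hB0 j hj).le, fun j hj => rfl, hpos⟩
    have h1 := R.dh_ge_e hN j hj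
    have h2 := R.dh_lt hN hη0 hα j hj
    have h3 := R.s_nonneg j hj.le
    have h4 := R.s_le j hj.le
    have h5 := hloe 0 ⟨le_rfl, hT⟩
    rw [eta_zero] at h5
    unfold dVc dV
    rw [cl_eq ⟨by linarith, by linarith⟩, cl_eq ⟨by linarith, by linarith⟩]
  set ε := m / (2 * (1 + T)) with hε
  have hε0 : 0 < ε := by positivity
  have hεT : ∀ t ∈ Icc 0 T, ε * (1 + t) ≤ m / 2 := by
    intro t ht
    have : ε * (1 + T) = m / 2 := by rw [hε]; field_simp
    have h2 := ht.2
    nlinarith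
  -- the touching family
  set g : ((Fin n ⊕ Fin n) ⊕ (Fin n ⊕ Fin n)) → ℝ → ℝ :=
    Sum.elim (Sum.elim (fun i t => sg (S (i + 1) t) - eta η0 b t * (((i + 1 : ℕ) : ℝ) / n))
        (fun i t => S (i + 1) t - S i t))
      (Sum.elim (fun i t => V i t - (m - ε * (1 + t))) (fun i t => M + ε * (1 + t) - V i t)) with hg
  have hηc : ContinuousOn (eta η0 b) (Icc 0 T) := fun t ht =>
    (eta_deriv hη0 hb ht.1).continuousAt.continuousWithinAt
  -- from nonnegativity to region
  have hreg : ∀ t ∈ Icc 0 T, (∀ j, 0 ≤ g j t) →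
      Reg N n α b κ (eta η0 b t) (fun j => S j t) (fun j => V j t) ∧
      (∀ j < n, dh N n (fun j => S j t) j ∈ Ioo lo hi) ∧
      (∀ j < n, m - ε * (1 + t) ≤ V j t ∧ V j t ≤ M + ε * (1 + t)) := by
    intro t ht hge
    have hC : ∀ j < n, m - ε * (1 + t) ≤ V j t := by
      intro j hj
      have := hge (Sum.inr (Sum.inl ⟨j, hj⟩))
      simp only [hg, Sum.elim_inr, Sum.elim_inl] at this
      linarith
    have hD : ∀ j < n, V j t ≤ M + ε * (1 + t) := by
      intro j hj
      have := hge (Sum.inr (Sum.inr ⟨j, hj⟩))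
      simp only [hg, Sum.elim_inr] at this
      linarith
    have := reg_of_clamped (N := N) (n := n) (α := α) (b := b) (κ := κ) (e := eta η0 b t)
      (s := fun j => S j t) hN hα hκ hb hlo0 (hloe t ht) (by linarith) hlohi
      (Sf_zero _ _ _) (Sf_n (by omega) _ _)
      (by
        intro j h1 h2
        have := hge (Sum.inl (Sum.inl ⟨j - 1, by omega⟩))
        simp only [hg, Sum.elim_inl, Nat.sub_add_cancel h1] at this
        linarith)
      (by
        intro j hj
        have := hge (Sum.inl (Sum.inr ⟨j, hj⟩))
        simp only [hg, Sum.elim_inl, Sum.elim_inr] at this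
        linarith)
      (by
        intro j hj
        have h1 := hC j hj
        have h2 := hεT t ht
        have h3 : V j t = dVc N n α b κ lo hi (fun j => S j t) j := rfl
        rw [← h3]; linarith)
    exact ⟨this.1, this.2, fun j hj => ⟨hC j hj, hD j hj⟩⟩
  -- derivative of clamped velocity in the region
  have hVd : ∀ t ∈ Icc 0 T, (∀ j, 0 ≤ g j t) → ∀ j < n,
      HasDerivWithinAt (V j) (- pc N n α (fun j => S j t) j * dS n (fun i => V i t) (j + 1)
        + qc N n α b (fun j => S j t) j * dS n (fun i => V i t) j) (Icc 0 T) t := by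
    intro t ht hge j hj
    obtain ⟨R, hdh, -⟩ := hreg t ht hge
    have h1 := dV_deriv (N := N) (α := α) (b := b) (κ := κ) (fun i hi => hU t ht i hi) j
      (hlo0.trans (hdh j hj).1)
    have hs1 := R.s_nonneg j hj.le
    have hs2 := R.s_le j hj.le
    refine h1.congr_of_eventuallyEq ?_ ?_
    · have e1 := (hdhc j t ht).eventually (Ioo_mem_nhds (hdh j hj).1 (hdh j hj).2)
      have e2 := (hSc j t ht).eventually (Ioo_mem_nhds (a := -1) (b := κ + 1) (by linarith) (by linarith))
      filter_upwards [e1, e2] with τ h1 h2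
      simp only [hV, dVc, dV]
      rw [cl_eq ⟨h1.1.le, h1.2.le⟩, cl_eq ⟨h2.1.le, h2.2.le⟩]
    · exact R.hV j hj
  have main := first_touch g 0 T ?_ ?_ ?_
  · refine ⟨U, hU0, ?_, ?_, ?_⟩
    · intro t ht
      obtain ⟨R, -, -⟩ := hreg t ht (fun j => (main t ht j).le)
      exact ⟨R.hs0, R.hsn, R.hA, R.hB, fun j hj => rfl, fun j hj => by
        have := R.hpos j hj; rw [R.hV j hj] at this; exact this⟩
    · intro t ht j hj
      obtain ⟨R, -, h3⟩ := hreg t ht (fun j => (main t ht j).le)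
      have e1 : dV N n α b (Sf n κ (fun i => U i t)) j = V j t := (R.hV j hj).symm
      rw [e1]
      have := h3 j hj
      have h4 := hεT t ht
      constructor <;> linarith
    · intro t ht j hj
      obtain ⟨R, -, -⟩ := hreg t ht (fun j => (main t ht j).le)
      have e1 : dV N n α b (Sf n κ (fun i => U i t)) j = V j t := (R.hV j hj).symm
      rw [e1]; exact hU t ht j hj
  · -- continuity
    rintro ((i | i) | (i | i))
    · exact (continuous_sg.comp_continuousOn (hSc _)).sub (hηc.mul continuousOn_const)
    · exact (hSc _).sub (hSc _)
    · exact (hVc _).sub (by fun_prop)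
    · exact ContinuousOn.sub (by fun_prop) (hVc _)
  · -- initial
    rintro ((i | i) | (i | i))
    · simp only [hg, Sum.elim_inl, eta_zero, hSinit']
      have := hA0 (i + 1) (by omega) (by omega)
      linarith
    · simp only [hg, Sum.elim_inl, Sum.elim_inr, hSinit']
      linarith [hB0 i i.2]
    · simp only [hg, Sum.elim_inl, Sum.elim_inr]
      rw [hVinit i i.2]; linarith [(hV0 i i.2).1]
    · simp only [hg, Sum.elim_inr]
      rw [hVinit i i.2]; linarith [(hV0 i i.2).2]
  · -- touching
    intro t ht hge
    have htI : t ∈ Icc 0 T := ⟨ht.1.le, ht.2⟩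
    obtain ⟨R, hdh, hCD⟩ := hreg t htI hge
    have he := eta_pos hη0 hb htI.1
    rintro ((i | i) | (i | i)) hi0
    · -- A
      simp only [hg, Sum.elim_inl] at hi0
      have hi := i.2
      rcases Nat.lt_or_ge ((i:ℕ) + 1) n with h | h
      · have hd := ((hasDerivAt_sg (S (i+1) t)).comp_hasDerivWithinAt t (hSd t htI (i + 1))).sub
          (((eta_deriv hη0 hb htI.1).hasDerivWithinAt (s := Icc 0 T)).mul_const (((i + 1 : ℕ) : ℝ) / n))
        refine ⟨_, hd, ?_⟩
        have ht' := R.touchA hN hα he hκ i h (by linarith)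
        have e1 : dS n (fun i => V i t) (i + 1) = n * (V i t - V (i + 1) t) := by
          unfold dS
          simp [h]
        rw [e1]
        have hx : (0:ℝ) < ((i + 1 : ℕ) : ℝ) / n := by positivity
        have : 0 < eta η0 b t ^ 2 * (((i + 1 : ℕ) : ℝ) / n) := by positivity
        linarith
      · exfalso
        have e1 : (i:ℕ) + 1 = n := by omega
        rw [e1] at hi0
        have e2 : S n t = κ := R.hsn
        rw [e2, div_self hnr.ne'] at hi0
        have := eta_anti hη0 hb le_rfl htI.1
        rw [eta_zero] at this
        linarith
    · -- B
      obtain ⟨i, hi⟩ := i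
      simp only [hg, Sum.elim_inl, Sum.elim_inr] at hi0
      have hd := (hSd t htI (i + 1)).sub (hSd t htI i)
      rcases i with _ | j
      · exfalso
        have h1 := R.hA 1 le_rfl (by omega)
        have h2 : S 0 t = 0 := R.hs0
        have h3 : S 1 t = 0 := by simpa [h2] using hi0
        rw [h3, sg_zero] at h1
        have : 0 < eta η0 b t * (((1:ℕ):ℝ) / n) := by positivity
        linarith
      · refine ⟨_, hd, ?_⟩
        have e0 : dS n (fun i => V i t) (j + 1) = n * (V j t - V (j + 1) t) := by
          unfold dS
          simp [hi]
        rcases Nat.lt_or_ge (j + 2) n with h | h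
        · have e1 : dS n (fun i => V i t) (j + 1 + 1) = n * (V (j + 1) t - V (j + 2) t) := by
            unfold dS
            simp [h]
          have := R.touchB hN hα he j h (by linarith)
          rw [e0, e1]
          nlinarith
        · have e1 : dS n (fun i => V i t) (j + 1 + 1) = 0 := by
            unfold dS
            simp [h]
          have := R.touchB_last hN hα he hκ j (by omega) (by linarith)
          rw [e0, e1]
          nlinarith
    · -- C
      simp only [hg, Sum.elim_inl, Sum.elim_inr] at hi0
      have hd := (hVd t htI hge i i.2).sub
        ((((hasDerivAt_id t).const_add 1).const_mul ε).const_sub m).hasDerivWithinAt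
      refine ⟨_, hd, ?_⟩
      have := lin_nonneg (pc_nonneg hN hα he R i i.2) (qc_nonneg hN hα he R i i.2) i i.2
        (v := fun i => V i t) (by intro l hl; have := (hCD l hl).1; linarith)
      linarith
    · -- D
      simp only [hg, Sum.elim_inr] at hi0
      have hd := ((((hasDerivAt_id t).const_add 1).const_mul ε).const_add M).hasDerivWithinAt.sub
        (hVd t htI hge i i.2)
      refine ⟨_, hd, ?_⟩
      have := lin_nonpos (pc_nonneg hN hα he R i i.2) (qc_nonneg hN hα he R i i.2) i i.2
        (v := fun i => V i t) (by intro l hl; have := (hCD l hl).2; linarith)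
      linarith

open Set Filter Topology

/-! ### The doubling barrier -/

noncomputable def Ff (β E c x : ℝ) : ℝ := x ^ β * (E - Real.exp (c / x))
noncomputable def Ff' (β E c x : ℝ) : ℝ :=
  x ^ β / x * (β * (E - Real.exp (c / x)) + (c / x) * Real.exp (c / x))

lemma hasDerivAt_exp_div (c : ℝ) {x : ℝ} (hx : 0 < x) :
    HasDerivAt (fun y => Real.exp (c / y)) (Real.exp (c / x) * (-c / x ^ 2)) x := by
  have h1 : HasDerivAt (fun y : ℝ => c / y) (-c / x ^ 2) x := by
    have := (hasDerivAt_const x c).div (hasDerivAt_id x) hx.ne'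
    exact HasDerivAt.congr_deriv (f := fun y : ℝ => c / y) this (by simp)
  exact h1.exp

lemma hasDerivAt_Ff (β E c : ℝ) {x : ℝ} (hx : 0 < x) :
    HasDerivAt (Ff β E c) (Ff' β E c x) x := by
  have h1 := Real.hasDerivAt_rpow_const (x := x) (p := β) (Or.inl hx.ne')
  have h2 := (hasDerivAt_exp_div c hx).const_sub E
  have h3 := h1.mul h2
  refine HasDerivAt.congr_deriv (f := Ff β E c) h3 ?_
  unfold Ff'
  rw [Real.rpow_sub_one hx.ne']
  field_simp

lemma hasDerivAt_Ff' (β E c : ℝ) {x : ℝ} (hx : 0 < x) :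
    HasDerivAt (Ff' β E c) (x ^ β / x ^ 2 * (-(β * (1 - β) * (E - Real.exp (c / x)))
      - 2 * (1 - β) * Real.exp (c / x) * (c / x) - Real.exp (c / x) * (c / x) ^ 2)) x := by
  have h1 := Real.hasDerivAt_rpow_const (x := x) (p := β) (Or.inl hx.ne')
  have h1' := h1.div (hasDerivAt_id x) hx.ne'
  have h2 := ((hasDerivAt_exp_div c hx).const_sub E).const_mul β
  have h3 : HasDerivAt (fun y : ℝ => c / y) (-c / x ^ 2) x := by
    have := (hasDerivAt_const x c).div (hasDerivAt_id x) hx.ne'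
    exact HasDerivAt.congr_deriv (f := fun y : ℝ => c / y) this (by simp)
  have h4 := h1'.mul (h2.add (h3.mul (hasDerivAt_exp_div c hx)))
  refine HasDerivAt.congr_deriv (f := Ff' β E c) h4 ?_
  simp only [Pi.add_apply, Pi.mul_apply, Pi.div_apply, id]
  rw [Real.rpow_sub_one hx.ne']
  field_simp
  ring

lemma Ff_facts {β K j x : ℝ} (hβ : 0 < β) (hβ1 : β < 1) (hK : 0 < K) (hj : 0 < j) (hx : j + 1 ≤ x) :
    Ff β (Real.exp K) (K * j) (x + 1) - Ff β (Real.exp K) (K * j) x ≤ Ff' β (Real.exp K) (K * j) x ∧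
    Ff' β (Real.exp K) (K * j) x ≤ Ff β (Real.exp K) (K * j) x - Ff β (Real.exp K) (K * j) (x - 1) ∧
    0 ≤ Ff' β (Real.exp K) (K * j) x := by
  set E := Real.exp K with hE
  set c := K * j with hc
  have hφ : ∀ y, j ≤ y → Real.exp (c / y) ≤ E := by
    intro y hy
    rw [hE, Real.exp_le_exp, hc, div_le_iff₀ (by linarith)]
    nlinarith
  have hc0 : 0 < c := by positivity
  have hanti : AntitoneOn (Ff' β E c) (Ici j) := by
    apply antitoneOn_of_deriv_nonpos (convex_Ici j)
    · intro y hy; exact (hasDerivAt_Ff' β E c (hj.trans_le hy)).continuousAt.continuousWithinAt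
    · intro y hy; rw [interior_Ici] at hy
      exact (hasDerivAt_Ff' β E c (hj.trans hy)).differentiableAt.differentiableWithinAt
    · intro y hy; rw [interior_Ici] at hy
      have hy0 : 0 < y := hj.trans hy
      rw [(hasDerivAt_Ff' β E c hy0).deriv]
      apply mul_nonpos_of_nonneg_of_nonpos
      · have := Real.rpow_pos_of_pos hy0 β; positivity
      · have h1 := hφ y (le_of_lt hy)
        have h2 := Real.exp_pos (c / y)
        have a1 : 0 ≤ β * (1 - β) * (E - Real.exp (c / y)) :=
          mul_nonneg (mul_nonneg hβ.le (by linarith)) (by linarith)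
        have a2 : 0 ≤ 2 * (1 - β) * Real.exp (c / y) * (c / y) := by
          have : 0 < 1 - β := by linarith
          positivity
        have a3 : 0 ≤ Real.exp (c / y) * (c / y) ^ 2 := by positivity
        linarith
  have hmv : ∀ y, j ≤ y → ∃ z ∈ Ioo y (y + 1), Ff' β E c z = Ff β E c (y + 1) - Ff β E c y := by
    intro y hy
    obtain ⟨z, hz, hz'⟩ := exists_hasDerivAt_eq_slope (Ff β E c) (Ff' β E c) (by linarith : y < y + 1)
      (fun w hw => (hasDerivAt_Ff β E c (by linarith [hw.1])).continuousAt.continuousWithinAt)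
      (fun w hw => hasDerivAt_Ff β E c (by linarith [hw.1]))
    refine ⟨z, hz, ?_⟩
    rw [hz']; simp
  refine ⟨?_, ?_, ?_⟩
  · obtain ⟨z, hz, hz'⟩ := hmv x (by linarith)
    rw [← hz']
    exact hanti (by simp only [mem_Ici]; linarith) (by simp only [mem_Ici]; linarith [hz.1]) hz.1.le
  · obtain ⟨z, hz, hz'⟩ := hmv (x - 1) (by linarith)
    rw [sub_add_cancel] at hz hz'
    rw [← hz']
    exact hanti (by simp only [mem_Ici]; linarith [hz.1]) (by simp only [mem_Ici]; linarith) hz.2.le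
  · have hx0 : 0 < x := by linarith
    have h1 := hφ x (by linarith)
    unfold Ff'
    have := Real.rpow_pos_of_pos hx0 β
    have h3 : 0 ≤ E - Real.exp (c / x) := by linarith
    positivity

/-- the barrier, with physical indices `i ≥ j ≥ 1` -/
noncomputable def Bf (K : ℝ) (n : ℕ) (i j : ℝ) : ℝ :=
  (i / n) ^ (Real.exp (-K)) * (Real.exp K - Real.exp (K * j / i))

lemma two_cosh (x : ℝ) (hx : 0 ≤ x) : x ^ 2 ≤ Real.exp x + Real.exp (-x) - 2 := by
  have h := Real.self_le_sinh_iff.2 (by linarith : 0 ≤ x / 2)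
  have h2 : Real.exp x + Real.exp (-x) - 2 = (2 * Real.sinh (x / 2)) ^ 2 := by
    rw [Real.sinh_eq]
    have e1 : Real.exp x = Real.exp (x/2) ^ 2 := by rw [← Real.exp_nat_mul]; congr 1; push_cast; ring
    have e2 : Real.exp (-x) = Real.exp (-(x/2)) ^ 2 := by
      rw [← Real.exp_nat_mul]; congr 1; push_cast; ring
    have e3 : Real.exp (x/2) * Real.exp (-(x/2)) = 1 := by rw [← Real.exp_add]; simp
    rw [e1, e2]
    linear_combination 2 * e3
  rw [h2]
  nlinarith

set_option maxHeartbeats 1000000 in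
/-- the strict supersolution property -/
lemma barrier_strict {N : ℝ} {n : ℕ} {K lam Lam L : ℝ} (hN : 2 ≤ N) (hlam : 0 < lam)
    (hL : 0 ≤ L) (hK1 : 1 ≤ K) (hK : Lam * (N - 1) * 2 + L < lam * K)
    {i j : ℝ} (hj : 1 ≤ j) (hij : j + 1 ≤ i) (hin : i ≤ n)
    {ai qi aj qj : ℝ} (hai : lam ≤ ai) (hai' : ai ≤ Lam) (hqi : ai ≤ qi)
    (haj : lam ≤ aj) (hqj' : qj ≤ aj + L / n) (ui uj : ℝ)
    (hui : ui = ai * (1 + (N - 1) / i) * (Bf K n (i + 1) j - Bf K n i j) ∨ ui = 0)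
    (huj : uj = qj * (Bf K n i (j - 1) - Bf K n i j) ∨ (uj = 0 ∧ j = 1)) :
    ui + qi * (Bf K n (i - 1) j - Bf K n i j) +
      aj * (1 + (N - 1) / j) * (Bf K n i (j + 1) - Bf K n i j) + uj < 0 := by
  have hi0 : 0 < i := by linarith
  have hn0 : (0:ℝ) < n := by linarith
  have hK0 : 0 < K := by linarith
  set β := Real.exp (-K) with hβ
  have hβ0 : 0 < β := Real.exp_pos _
  have hβ1 : β < 1 := by rw [hβ, Real.exp_lt_one_iff]; linarith
  obtain ⟨f1, f2, f3⟩ := Ff_facts hβ0 hβ1 hK0 (by linarith : 0 < j) hij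
  set G : ℝ := (1 / (n:ℝ)) ^ β with hG
  have hG0 : 0 < G := Real.rpow_pos_of_pos (by positivity) _
  have hBF : ∀ x, 0 < x → Bf K n x j = G * Ff β (Real.exp K) (K * j) x := by
    intro x hx
    unfold Bf Ff
    rw [← hβ, div_eq_mul_one_div x, Real.mul_rpow hx.le (by positivity)]
    ring
  set R := (i / n) ^ β with hR
  have hR0 : 0 < R := Real.rpow_pos_of_pos (by positivity) _
  have hRG : R = i ^ β * G := by
    rw [hR, div_eq_mul_one_div i, Real.mul_rpow hi0.le (by positivity)]
  set φ := Real.exp (K * j / i) with hφ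
  have hφ1 : 1 ≤ φ := by rw [hφ]; apply Real.one_le_exp; positivity
  have hφE : φ ≤ Real.exp K := by
    rw [hφ, Real.exp_le_exp, div_le_iff₀ hi0]; nlinarith
  set k := K / i with hk
  have hk0 : 0 < k := by positivity
  -- r-part
  have hD : G * Ff' β (Real.exp K) (K * j) i ≤ R * φ / i * (1 + K) := by
    unfold Ff'
    rw [← hφ]
    have e : G * (i ^ β / i * (β * (Real.exp K - φ) + K * j / i * φ)) =
      R / i * (β * (Real.exp K - φ) + K * j / i * φ) := by rw [hRG]; ring
    rw [e]
    have b1 : β * (Real.exp K - φ) ≤ φ := by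
      have : β * Real.exp K = 1 := by rw [hβ, ← Real.exp_add]; simp
      nlinarith [mul_pos hβ0 (by linarith : 0 < φ)]
    have b2 : K * j / i * φ ≤ K * φ := by
      apply mul_le_mul_of_nonneg_right _ (by linarith)
      rw [div_le_iff₀ hi0]; nlinarith
    calc R / i * (β * (Real.exp K - φ) + K * j / i * φ) ≤ R / i * (φ + K * φ) := by
          apply mul_le_mul_of_nonneg_left (by linarith) (by positivity)
      _ = _ := by ring
  have hrpart : ui + qi * (Bf K n (i - 1) j - Bf K n i j) ≤
      Lam * (N - 1) / i * (R * φ / i * (1 + K)) := by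
    rw [hBF (i - 1) (by linarith), hBF i hi0]
    have g2 : G * Ff β (Real.exp K) (K * j) (i - 1) - G * Ff β (Real.exp K) (K * j) i ≤
      - (G * Ff' β (Real.exp K) (K * j) i) := by
      have := mul_le_mul_of_nonneg_left f2 hG0.le
      rw [mul_sub] at this
      linarith
    set D := G * Ff' β (Real.exp K) (K * j) i with hDdef
    have hD0 : 0 ≤ D := mul_nonneg hG0.le f3
    have hqi0 : 0 ≤ qi := by linarith
    have s1 : qi * (G * Ff β (Real.exp K) (K * j) (i - 1) - G * Ff β (Real.exp K) (K * j) i) ≤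
        - (ai * D) := by
      have z1 := mul_le_mul_of_nonneg_left g2 hqi0
      have z2 := mul_le_mul_of_nonneg_right hqi hD0
      linarith
    have hLN : 0 ≤ Lam * (N - 1) / i := by
      have : 0 ≤ Lam := by linarith
      have : 0 ≤ N - 1 := by linarith
      positivity
    rcases hui with h | h
    · rw [h, hBF (i + 1) (by linarith), hBF i hi0]
      have hp : 0 ≤ ai * (1 + (N - 1) / i) := by
        have : 0 ≤ N - 1 := by linarith
        have : 0 ≤ ai := by linarith
        positivity
      have g1 : G * Ff β (Real.exp K) (K * j) (i + 1) - G * Ff β (Real.exp K) (K * j) i ≤ D := by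
        have := mul_le_mul_of_nonneg_left f1 hG0.le
        rw [mul_sub] at this
        linarith
      have s2 := mul_le_mul_of_nonneg_left g1 hp
      have s3 : ai * (N - 1) / i * D ≤ Lam * (N - 1) / i * D := by
        apply mul_le_mul_of_nonneg_right _ hD0
        have : 0 ≤ N - 1 := by linarith
        gcongr
      have s4 := mul_le_mul_of_nonneg_left hD hLN
      have s5 : ai * (1 + (N - 1) / i) * D = ai * D + ai * (N - 1) / i * D := by ring
      linarith
    · rw [h]
      have : 0 ≤ ai * D := mul_nonneg (by linarith) hD0
      have : 0 ≤ Lam * (N - 1) / i * (R * φ / i * (1 + K)) := by positivity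
      linarith
  -- s-part
  have d1 : Bf K n i (j + 1) - Bf K n i j = - (R * φ * (Real.exp k - 1)) := by
    unfold Bf
    rw [← hβ, ← hR, ← hφ]
    have : Real.exp (K * (j + 1) / i) = φ * Real.exp k := by
      rw [hφ, hk, ← Real.exp_add]; congr 1; ring
    rw [this]; ring
  have d2 : Bf K n i (j - 1) - Bf K n i j = R * φ * (1 - Real.exp (-k)) := by
    unfold Bf
    rw [← hβ, ← hR, ← hφ]
    have : Real.exp (K * (j - 1) / i) = φ * Real.exp (-k) := by
      rw [hφ, hk, ← Real.exp_add]; congr 1; ring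
    rw [this]; ring
  have hek : 0 ≤ Real.exp k - 1 := by linarith [Real.add_one_le_exp k]
  have hem : 1 - Real.exp (-k) ≤ k := by linarith [Real.add_one_le_exp (-k)]
  have hem0 : 0 ≤ 1 - Real.exp (-k) := by
    have : Real.exp (-k) ≤ 1 := by rw [Real.exp_le_one_iff]; linarith
    linarith
  have hcosh := two_cosh k hk0.le
  have hRφ : 0 < R * φ := mul_pos hR0 (by linarith)
  have hLn : L / n * (1 - Real.exp (-k)) ≤ L / K * k ^ 2 := by
    have h1 : L / n ≤ L / i := by
      apply div_le_div_of_nonneg_left hL hi0 hin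
    have h2 : L / i = L / K * k := by rw [hk]; field_simp
    calc L / n * (1 - Real.exp (-k)) ≤ L / i * k := by
          apply mul_le_mul h1 hem hem0 (by positivity)
      _ = L / K * k ^ 2 := by rw [h2]; ring
  have hLK : 0 ≤ L / K * k ^ 2 := by positivity
  have hspart : aj * (1 + (N - 1) / j) * (Bf K n i (j + 1) - Bf K n i j) + uj ≤
      - (R * φ * (k ^ 2 * (lam - L / K))) := by
    rw [d1]
    have haj0 : 0 ≤ aj := by linarith
    rcases huj with h | ⟨h, hj1⟩
    · rw [h, d2]
      have s1 : aj * (1 + (N - 1) / j) * -(R * φ * (Real.exp k - 1)) ≤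
          - (R * φ * (aj * (Real.exp k - 1))) := by
        have : aj ≤ aj * (1 + (N - 1) / j) := by
          have : 0 ≤ N - 1 := by linarith
          have : 0 ≤ aj * ((N - 1) / j) := by positivity
          linarith
        have h2 : 0 ≤ R * φ * (Real.exp k - 1) := mul_nonneg hRφ.le hek
        nlinarith [mul_le_mul_of_nonneg_right this h2]
      have s2 : qj * (R * φ * (1 - Real.exp (-k))) ≤
          R * φ * (aj * (1 - Real.exp (-k)) + L / K * k ^ 2) := by
        have a := mul_le_mul_of_nonneg_right hqj' hem0
        have b : qj * (1 - Real.exp (-k)) ≤ aj * (1 - Real.exp (-k)) + L / K * k ^ 2 := by linarith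
        have := mul_le_mul_of_nonneg_left b hRφ.le
        linarith
      have s3 : lam * k ^ 2 ≤ aj * (Real.exp k + Real.exp (-k) - 2) := by
        apply mul_le_mul haj hcosh (by positivity) haj0
      have s4 := mul_le_mul_of_nonneg_left s3 hRφ.le
      linarith
    · rw [h, hj1]
      have hq := Real.quadratic_le_exp_of_nonneg hk0.le
      have s1 : lam * k ^ 2 ≤ aj * N * (Real.exp k - 1) := by
        have h1 : k ^ 2 ≤ 2 * (Real.exp k - 1) := by linarith
        calc lam * k ^ 2 ≤ aj * (2 * (Real.exp k - 1)) := by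
              apply mul_le_mul haj h1 (by positivity) haj0
          _ ≤ aj * (N * (Real.exp k - 1)) := by gcongr
          _ = _ := by ring
      have s2 := mul_le_mul_of_nonneg_left s1 hRφ.le
      have s3 := mul_nonneg hRφ.le hLK
      have e : aj * (1 + (N - 1) / 1) * -(R * φ * (Real.exp k - 1)) =
        - (R * φ * (aj * N * (Real.exp k - 1))) := by ring
      rw [e]
      nlinarith
  have hfin : Lam * (N - 1) / i * (R * φ / i * (1 + K)) < R * φ * (k ^ 2 * (lam - L / K)) := by
    have e1 : Lam * (N - 1) / i * (R * φ / i * (1 + K)) = R * φ / i ^ 2 * (Lam * (N - 1) * (1 + K)) := by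
      field_simp
    have e2 : R * φ * (k ^ 2 * (lam - L / K)) = R * φ / i ^ 2 * (lam * K ^ 2 - L * K) := by
      rw [hk]; field_simp
    rw [e1, e2]
    apply mul_lt_mul_of_pos_left _ (by positivity)
    have hLN : 0 ≤ Lam * (N - 1) := mul_nonneg (by linarith) (by linarith)
    nlinarith
  linarith

open Set Filter Topology

/-! ### Linear systems and moduli of continuity -/

def LinSys (N : ℝ) (n : ℕ) (T lam Lam L : ℝ) (V : ℕ → ℝ → ℝ) : Prop :=
  ∀ t ∈ Icc (0:ℝ) T, ∀ j, j < n → ∃ a q : ℝ, lam ≤ a ∧ a ≤ Lam ∧ a ≤ q ∧ q ≤ a + L / n ∧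
    HasDerivWithinAt (V j)
      ((n:ℝ) ^ 2 * ((if j + 1 < n then a * (1 + (N - 1) / ((j:ℝ) + 1)) * (V (j + 1) t - V j t) else 0)
        + (if 0 < j then q * (V (j - 1) t - V j t) else 0))) (Icc 0 T) t

lemma LinSys.neg {N : ℝ} {n : ℕ} {T lam Lam L : ℝ} {V : ℕ → ℝ → ℝ}
    (h : LinSys N n T lam Lam L V) : LinSys N n T lam Lam L (fun j t => - V j t) := by
  intro t ht j hj
  obtain ⟨a, q, h1, h2, h3, h4, h5⟩ := h t ht j hj
  refine ⟨a, q, h1, h2, h3, h4, ?_⟩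
  refine HasDerivWithinAt.congr_deriv (f := fun t => - V j t) h5.neg ?_
  split_ifs <;> ring

lemma Bf_lower {K : ℝ} (hK : 1 ≤ K) {n : ℕ} {i j : ℝ} (hj : 0 < j) (hij : j ≤ i) (hin : i ≤ n) :
    K * (i / n - j / n) ≤ Bf K n i j := by
  have hi : 0 < i := by linarith
  have hn : (0:ℝ) < n := by linarith
  unfold Bf
  set x := i / n with hx
  have hx0 : 0 < x := by positivity
  have hx1 : x ≤ 1 := by rw [hx, div_le_one hn]; exact hin
  have hβ1 : Real.exp (-K) ≤ 1 := by rw [Real.exp_le_one_iff]; linarith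
  have h1 : x ≤ x ^ Real.exp (-K) := by
    calc x = x ^ (1:ℝ) := (Real.rpow_one x).symm
      _ ≤ _ := Real.rpow_le_rpow_of_exponent_ge hx0 hx1 hβ1
  set z := K * j / i with hz
  have hz0 : 0 ≤ z := by positivity
  have hzK : z ≤ K := by rw [hz, div_le_iff₀ hi]; nlinarith
  have h2 : K - z ≤ Real.exp K - Real.exp z := by
    have e : Real.exp K = Real.exp z * Real.exp (K - z) := by rw [← Real.exp_add]; congr 1; ring
    have e1 := Real.one_le_exp hz0
    have e2 := Real.add_one_le_exp (K - z)
    rw [e]; nlinarith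
  calc K * (x - j / n) = x * (K - z) := by rw [hx, hz]; field_simp
    _ ≤ x ^ Real.exp (-K) * (Real.exp K - Real.exp z) := by
        apply mul_le_mul h1 h2 (by linarith) (by positivity)

lemma Bf_upper {K : ℝ} (hK : 1 ≤ K) {ε : ℝ} (hε : 0 < ε) : ∃ C : ℝ, 0 ≤ C ∧ ∀ (n : ℕ) (i j : ℝ),
    0 < j → j ≤ i → i ≤ n → Bf K n i j ≤ ε + C * (i / n - j / n) ^ 2 := by
  set β := Real.exp (-K) with hβ
  have hβ0 : 0 < β := Real.exp_pos _
  set E1 := Real.exp K * K with hE1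
  have hE10 : 0 < E1 := by positivity
  set x0 := (ε / E1) ^ (1 / β) with hx0
  have hx00 : 0 < x0 := Real.rpow_pos_of_pos (by positivity) _
  refine ⟨(E1 / x0) ^ 2 / ε, by positivity, ?_⟩
  intro n i j hj hij hin
  have hi : 0 < i := by linarith
  have hn : (0:ℝ) < n := by linarith
  unfold Bf
  rw [← hβ]
  set x := i / n with hx
  have hxp : 0 < x := by positivity
  have hx1 : x ≤ 1 := by rw [hx, div_le_one hn]; exact hin
  set z := K * j / i with hz
  have hz0 : 0 ≤ z := by positivity
  have hzK : z ≤ K := by rw [hz, div_le_iff₀ hi]; nlinarith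
  have hK0 : 0 < K := by linarith
  have h2 : Real.exp K - Real.exp z ≤ Real.exp K * (K - z) := by
    have e : Real.exp z = Real.exp K * Real.exp (z - K) := by rw [← Real.exp_add]; congr 1; ring
    have e2 := Real.add_one_le_exp (z - K)
    have := Real.exp_pos K
    rw [e]; nlinarith
  have hxβ : 0 < x ^ β := Real.rpow_pos_of_pos hxp _
  have hsq : 0 ≤ (E1 / x0) ^ 2 / ε * (x - j / n) ^ 2 := by positivity
  by_cases hc : x ≤ x0
  · have h3 : x ^ β ≤ ε / E1 := by
      calc x ^ β ≤ x0 ^ β := Real.rpow_le_rpow hxp.le hc hβ0.le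
        _ = ε / E1 := by
          rw [hx0, ← Real.rpow_mul (by positivity), one_div_mul_cancel hβ0.ne', Real.rpow_one]
    have h4 : Real.exp K - Real.exp z ≤ E1 := by
      refine h2.trans ?_
      rw [hE1]; gcongr; linarith
    have h5 : 0 ≤ Real.exp K - Real.exp z := by
      have := Real.exp_le_exp.2 hzK; linarith
    have : x ^ β * (Real.exp K - Real.exp z) ≤ ε / E1 * E1 := mul_le_mul h3 h4 h5 (by positivity)
    rw [div_mul_cancel₀ _ hE10.ne'] at this
    linarith
  · push Not at hc
    have h3 : x ^ β ≤ 1 := Real.rpow_le_one hxp.le hx1 hβ0.le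
    have hxj : 0 ≤ x - j / n := by
      rw [hx, ← sub_div]; exact div_nonneg (by linarith) hn.le
    have h4 : Real.exp K * (K - z) ≤ E1 / x0 * (x - j / n) := by
      have e : Real.exp K * (K - z) = E1 / x * (x - j / n) := by
        rw [hE1, hx, hz]; field_simp
      rw [e]
      gcongr
    have h5 : 0 ≤ Real.exp K * (K - z) := mul_nonneg (Real.exp_pos K).le (by linarith)
    have h6 : x ^ β * (Real.exp K - Real.exp z) ≤ E1 / x0 * (x - j / n) := by
      calc x ^ β * (Real.exp K - Real.exp z) ≤ x ^ β * (Real.exp K * (K - z)) := by gcongr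
        _ ≤ 1 * (Real.exp K * (K - z)) := by gcongr
        _ ≤ _ := by linarith
    have h7 : ∀ A : ℝ, A ≤ ε + A ^ 2 / ε := by
      intro A
      have : A ^ 2 / ε + ε - A = ((A - ε / 2) ^ 2 + 3 / 4 * ε ^ 2) / ε := by field_simp; ring
      have h : 0 ≤ ((A - ε / 2) ^ 2 + 3 / 4 * ε ^ 2) / ε := by positivity
      linarith
    have h8 := h7 (E1 / x0 * (x - j / n))
    have h9 : (E1 / x0 * (x - j / n)) ^ 2 / ε = (E1 / x0) ^ 2 / ε * (x - j / n) ^ 2 := by ring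
    linarith

lemma doubling {N : ℝ} {n : ℕ} {T lam Lam L K C ε : ℝ} {V : ℕ → ℝ → ℝ} (hN : 2 ≤ N) (hlam : 0 < lam)
    (hL : 0 ≤ L) (hK1 : 1 ≤ K) (hK : Lam * (N - 1) * 2 + L < lam * K)
    (h : LinSys N n T lam Lam L V) (hC : 0 < C) (hε : 0 < ε)
    (h0 : ∀ i j, j ≤ i → i < n → V i 0 - V j 0 < ε + C * Bf K n (i + 1) (j + 1)) :
    ∀ t ∈ Icc (0:ℝ) T, ∀ i j, j ≤ i → i < n → V i t - V j t ≤ ε + C * Bf K n (i + 1) (j + 1) := by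
  have key := first_touch (ι := Fin n × Fin n)
    (fun p t => if (p.2 : ℕ) ≤ p.1 then ε + C * Bf K n ((p.1:ℕ) + 1) ((p.2:ℕ) + 1) - (V p.1 t - V p.2 t) else 1)
    0 T ?_ ?_ ?_
  · intro t ht i j hji hi
    have := key t ht (⟨i, hi⟩, ⟨j, by omega⟩)
    simp only [hji, if_true] at this
    linarith
  · rintro ⟨i, j⟩
    by_cases hji : (j:ℕ) ≤ i
    · simp only [hji, if_true]
      intro t ht
      obtain ⟨_, _, _, _, _, _, h5⟩ := h t ht i i.2
      obtain ⟨_, _, _, _, _, _, h6⟩ := h t ht j j.2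
      exact ((h5.sub h6).const_sub _).continuousWithinAt
    · simp only [hji, if_false]; exact continuousOn_const
  · rintro ⟨i, j⟩
    by_cases hji : (j:ℕ) ≤ i
    · simp only [hji, if_true]
      have := h0 i j hji i.2
      linarith
    · simp only [hji, if_false]; norm_num
  · rintro t ht hall ⟨⟨i, hi⟩, ⟨j, hj⟩⟩ hz
    have hall' : ∀ i j, j ≤ i → i < n → V i t - V j t ≤ ε + C * Bf K n (i + 1) (j + 1) := by
      intro i j hji hi
      have := hall (⟨i, hi⟩, ⟨j, by omega⟩)
      simp only [hji, if_true] at this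
      linarith
    by_cases hji : j ≤ i
    swap
    · simp [hji] at hz
    simp only [hji, if_true] at hz ⊢
    have htt : t ∈ Icc (0:ℝ) T := ⟨ht.1.le, ht.2⟩
    rcases eq_or_lt_of_le hji with e | hlt
    · exfalso
      subst e
      have hB : Bf K n ((j:ℝ) + 1) ((j:ℝ) + 1) = 0 := by
        unfold Bf
        rw [mul_div_assoc, div_self (by positivity), mul_one]; simp
      rw [hB] at hz
      linarith
    obtain ⟨ai, qi, hai, hai', hqi, hqi', hdi⟩ := h t htt i hi
    obtain ⟨aj, qj, haj, haj', hqj, hqj', hdj⟩ := h t htt j hj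
    refine ⟨_, (hdi.sub hdj).const_sub _, ?_⟩
    have hj1 : j + 1 < n := by omega
    have hi0 : 0 < i := by omega
    rw [if_pos hj1, if_pos hi0]
    have hn0 : (0:ℝ) < n := by exact_mod_cast (by omega : 0 < n)
    have hai0 : 0 ≤ ai := by linarith
    have haj0 : 0 ≤ aj := by linarith
    have hN1 : 0 ≤ N - 1 := by linarith
    have i1 : ((i - 1 : ℕ) : ℝ) + 1 = (i + 1) - 1 := by
      rw [Nat.cast_sub (by omega)]; push_cast; ring
    -- the four comparisons
    have c2 := hall' (i - 1) j (by omega) (by omega)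
    rw [i1] at c2
    have c3 := hall' i (j + 1) (by omega) hi
    push_cast at c3
    have hb := barrier_strict (n := n) hN hlam hL hK1 hK (i := (i:ℝ) + 1) (j := (j:ℝ) + 1)
      (by simp) (by have : (j:ℝ) + 1 ≤ i := by exact_mod_cast hlt
                    linarith) (by exact_mod_cast hi)
      hai hai' hqi haj hqj'
      (if i + 1 < n then ai * (1 + (N - 1) / ((i:ℝ) + 1)) * (Bf K n ((i:ℝ) + 1 + 1) (j + 1) - Bf K n (i + 1) (j + 1)) else 0)
      (if 0 < j then qj * (Bf K n (i + 1) ((j:ℝ) + 1 - 1) - Bf K n (i + 1) (j + 1)) else 0)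
      (by split_ifs; exact Or.inl rfl; exact Or.inr rfl)
      (by split_ifs with h
          · exact Or.inl rfl
          · refine Or.inr ⟨rfl, ?_⟩
            have : j = 0 := by omega
            rw [this]; simp)
    have m1 : (if i + 1 < n then ai * (1 + (N - 1) / ((i:ℝ) + 1)) * (V (i + 1) t - V i t) else 0) ≤
      C * (if i + 1 < n then ai * (1 + (N - 1) / ((i:ℝ) + 1)) * (Bf K n ((i:ℝ) + 1 + 1) (j + 1) - Bf K n (i + 1) (j + 1)) else 0) := by
      split_ifs with h
      · have c1 := hall' (i + 1) j (by omega) h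
        push_cast at c1
        have hp : 0 ≤ ai * (1 + (N - 1) / ((i:ℝ) + 1)) := by positivity
        have := mul_le_mul_of_nonneg_left (show V (i + 1) t - V i t ≤ C * (Bf K n ((i:ℝ) + 1 + 1) (j + 1) - Bf K n (i + 1) (j + 1)) by linarith) hp
        linarith
      · simp
    have m2 : qi * (V (i - 1) t - V i t) ≤ C * (qi * (Bf K n ((i:ℝ) + 1 - 1) (j + 1) - Bf K n (i + 1) (j + 1))) := by
      have := mul_le_mul_of_nonneg_left (show V (i - 1) t - V i t ≤ C * (Bf K n ((i:ℝ) + 1 - 1) (j + 1) - Bf K n (i + 1) (j + 1)) by linarith) (by linarith : 0 ≤ qi)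
      linarith
    have m3 : - (aj * (1 + (N - 1) / ((j:ℝ) + 1)) * (V (j + 1) t - V j t)) ≤ C * (aj * (1 + (N - 1) / ((j:ℝ) + 1)) * (Bf K n ((i:ℝ) + 1) (j + 1 + 1) - Bf K n (i + 1) (j + 1))) := by
      have hp : 0 ≤ aj * (1 + (N - 1) / ((j:ℝ) + 1)) := by positivity
      have := mul_le_mul_of_nonneg_left (show - (V (j + 1) t - V j t) ≤ C * (Bf K n ((i:ℝ) + 1) (j + 1 + 1) - Bf K n (i + 1) (j + 1)) by linarith) hp
      linarith
    have m4 : - (if 0 < j then qj * (V (j - 1) t - V j t) else 0) ≤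
      C * (if 0 < j then qj * (Bf K n (i + 1) ((j:ℝ) + 1 - 1) - Bf K n (i + 1) (j + 1)) else 0) := by
      split_ifs with h
      · have c4 := hall' i (j - 1) (by omega) hi
        have j1 : ((j - 1 : ℕ) : ℝ) + 1 = (j + 1) - 1 := by
          rw [Nat.cast_sub (by omega)]; push_cast; ring
        rw [j1] at c4
        have := mul_le_mul_of_nonneg_left (show - (V (j - 1) t - V j t) ≤ C * (Bf K n ((i:ℝ) + 1) (j + 1 - 1) - Bf K n (i + 1) (j + 1)) by linarith) (by linarith : 0 ≤ qj)
        linarith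
      · simp
    have hb' := mul_neg_of_pos_of_neg hC hb
    have hn2 : (0:ℝ) < (n:ℝ) ^ 2 := by positivity
    have hfin : ∀ x1 x2 x3 x4 y1 y2 y3 y4 : ℝ, x1 ≤ C * y1 → x2 ≤ C * y2 → - x3 ≤ C * y3 → - x4 ≤ C * y4 →
        C * (y1 + y2 + y3 + y4) < 0 → 0 < - ((n:ℝ) ^ 2 * (x1 + x2) - (n:ℝ) ^ 2 * (x3 + x4)) := by
      intro x1 x2 x3 x4 y1 y2 y3 y4 a1 a2 a3 a4 a5
      have : (n:ℝ) ^ 2 * ((x1 + x2) - (x3 + x4)) < 0 := mul_neg_of_pos_of_neg hn2 (by linarith)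
      linarith
    exact hfin _ _ _ _ _ _ _ _ m1 m2 m3 m4 hb'

lemma doubling_mod {K : ℝ} (hK1 : 1 ≤ K) {ε C : ℝ} (hε : 0 < ε) (hC : 0 ≤ C) :
    ∃ C' : ℝ, 0 ≤ C' ∧ ∀ (N : ℝ) (n : ℕ) (T lam Lam L : ℝ) (V : ℕ → ℝ → ℝ), 2 ≤ N → 0 < lam → 0 ≤ L →
      Lam * (N - 1) * 2 + L < lam * K → LinSys N n T lam Lam L V →
      (∀ i j, i < n → j < n → |V i 0 - V j 0| ≤ ε / 4 + C * ((i:ℝ) / n - j / n) ^ 2) →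
      ∀ t ∈ Icc (0:ℝ) T, ∀ i j, i < n → j < n → |V i t - V j t| ≤ ε + C' * ((i:ℝ) / n - j / n) ^ 2 := by
  set C1 := C / K + 1 with hC1
  have hK0 : 0 < K := by linarith
  have hC10 : 0 < C1 := by positivity
  obtain ⟨C2, hC2, hB⟩ := Bf_upper hK1 (show 0 < ε / (2 * C1) by positivity)
  refine ⟨C1 * C2, by positivity, ?_⟩
  intro N n T lam Lam L V hN hlam hL hK hV h0 t ht
  have base : ∀ W : ℕ → ℝ → ℝ, LinSys N n T lam Lam L W →
      (∀ i j, i < n → j < n → |W i 0 - W j 0| ≤ ε / 4 + C * ((i:ℝ) / n - j / n) ^ 2) →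
      ∀ i j, j ≤ i → i < n → W i t - W j t ≤ ε + C1 * C2 * ((i:ℝ) / n - j / n) ^ 2 := by
    intro W hW hW0 i j hji hi
    have hd : ∀ i j : ℕ, ((i:ℝ) + 1) / n - ((j:ℝ) + 1) / n = (i:ℝ) / n - j / n := by intro i j; ring
    have key := doubling (K := K) (C := C1) (ε := ε / 2) hN hlam hL hK1 hK hW hC10 (by positivity) (by
      intro i j hji hi
      have hn0 : (0:ℝ) < n := by exact_mod_cast (by omega : 0 < n)
      have hij : (j:ℝ) ≤ i := by exact_mod_cast hji
      have hin : (i:ℝ) + 1 ≤ n := by exact_mod_cast hi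
      have l := Bf_lower (n := n) hK1 (by positivity : (0:ℝ) < (j:ℝ) + 1) (by linarith : (j:ℝ) + 1 ≤ i + 1) hin
      rw [hd] at l
      set x := (i:ℝ) / n - j / n with hx
      have hx0 : 0 ≤ x := by rw [hx, ← sub_div]; exact div_nonneg (by linarith) hn0.le
      have hx1 : x ≤ 1 := by
        rw [hx, ← sub_div, div_le_one hn0]
        have : (0:ℝ) ≤ j := Nat.cast_nonneg j
        linarith
      have h1 := hW0 i j hi (by omega)
      have h2 := (abs_le.1 h1).2
      rw [← hx] at h2
      have h3 : C * x ^ 2 ≤ C1 * Bf K n (i + 1) (j + 1) := by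
        calc C * x ^ 2 ≤ C * x := by
              apply mul_le_mul_of_nonneg_left _ hC; nlinarith
          _ = C / K * (K * x) := by field_simp
          _ ≤ C1 * (K * x) := by
              apply mul_le_mul_of_nonneg_right _ (by positivity)
              rw [hC1]; linarith
          _ ≤ _ := by gcongr
      linarith) t ht i j hji hi
    have hij : (j:ℝ) ≤ i := by exact_mod_cast hji
    have hin : (i:ℝ) + 1 ≤ n := by exact_mod_cast hi
    have u := hB n (i + 1) (j + 1) (by positivity) (by linarith) hin
    rw [hd] at u
    have u2 := mul_le_mul_of_nonneg_left u hC10.le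
    have e : C1 * (ε / (2 * C1) + C2 * ((i:ℝ) / n - j / n) ^ 2) = ε / 2 + C1 * C2 * ((i:ℝ) / n - j / n) ^ 2 := by
      field_simp
    linarith
  have both : ∀ i j, j ≤ i → i < n → |V i t - V j t| ≤ ε + C1 * C2 * ((i:ℝ) / n - j / n) ^ 2 := by
    intro i j hji hi
    rw [abs_le]
    have b1 := base V hV h0 i j hji hi
    have b2 := base _ hV.neg (by
      intro i j hi hj
      have := h0 i j hi hj
      rwa [show - V i 0 - - V j 0 = - (V i 0 - V j 0) by ring, abs_neg]) i j hji hi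
    constructor <;> linarith
  intro i j hi hj
  rcases le_total j i with hji | hji
  · exact both i j hji hi
  · have := both j i hji hj
    rw [abs_sub_comm]
    rwa [show ((i:ℝ) / n - j / n) ^ 2 = ((j:ℝ) / n - i / n) ^ 2 by ring]

lemma time_mod_one {N : ℝ} {n : ℕ} {T lam Lam L A ε C1 : ℝ} {V : ℕ → ℝ → ℝ} (hN : 2 ≤ N) (hlam : 0 < lam)
    (hL : 0 ≤ L) (hLL : lam ≤ Lam) (h : LinSys N n T lam Lam L V) (hA : 0 < A) {t0 : ℝ} (ht0 : 0 ≤ t0) {i : ℕ} (hi : i < n)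
    (h0 : ∀ j, j < n → V j t0 - V i t0 < ε + A * ((j:ℝ) / n - i / n) ^ 2)
    (hC1 : 3 * L + 2 * Lam * (N - 1) + Lam * N + Lam < C1) :
    ∀ t ∈ Icc t0 T, V i t - V i t0 ≤ ε + A * C1 * (t - t0) := by
  have key := first_touch (ι := Fin n)
    (fun j t => ε + A * (((j:ℕ):ℝ) / n - i / n) ^ 2 + A * C1 * (t - t0) - (V j t - V i t0)) t0 T ?_ ?_ ?_
  · intro t ht
    have := key t ht ⟨i, hi⟩
    simp at this
    linarith
  · intro j t ht
    have htt : t ∈ Icc (0:ℝ) T := ⟨ht0.trans ht.1, ht.2⟩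
    obtain ⟨_, _, _, _, _, _, h5⟩ := h t htt j j.2
    have h6 := (h5.continuousWithinAt.mono (Icc_subset_Icc_left ht0)).sub (continuousWithinAt_const (b := V i t0))
    have h7 : ContinuousWithinAt (fun t => ε + A * (((j:ℕ):ℝ) / n - i / n) ^ 2 + A * C1 * (t - t0)) (Icc t0 T) t := by
      fun_prop
    exact h7.sub h6
  · intro j
    have := h0 j j.2
    simp; linarith
  · rintro t ht hall ⟨j, hj⟩ hz
    simp only at hz ⊢
    have htt : t ∈ Icc (0:ℝ) T := ⟨ht0.trans ht.1.le, ht.2⟩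
    obtain ⟨a, q, ha, ha', hq, hq', hd⟩ := h t htt j hj
    have hd' := hd.mono (Icc_subset_Icc_left ht0)
    have hl : HasDerivWithinAt (fun t => ε + A * (((j:ℕ):ℝ) / n - i / n) ^ 2 + A * C1 * (t - t0)) (A * C1) (Icc t0 T) t := by
      have := (((hasDerivWithinAt_id t (Icc t0 T)).sub_const t0).const_mul (A * C1)).const_add (ε + A * (((j:ℕ):ℝ) / n - i / n) ^ 2)
      exact HasDerivWithinAt.congr_deriv (f := fun t => ε + A * (((j:ℕ):ℝ) / n - i / n) ^ 2 + A * C1 * (t - t0)) this (by simp)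
    refine ⟨_, hl.sub (hd'.sub_const (V i t0)), ?_⟩
    have hn0 : (0:ℝ) < n := by exact_mod_cast (by omega : 0 < n)
    have hN1 : 0 ≤ N - 1 := by linarith
    have ha0 : 0 < a := by linarith
    set x : ℝ := (j:ℝ) - i with hx
    set y : ℝ := (j:ℝ) + 1 with hy
    have hy1 : 1 ≤ y := by simp [hy]
    have hiR : (i:ℝ) + 1 ≤ n := by exact_mod_cast hi
    have hjR : (j:ℝ) + 1 ≤ n := by exact_mod_cast hj
    have hi0 : (0:ℝ) ≤ i := Nat.cast_nonneg i
    have hj0 : (0:ℝ) ≤ j := Nat.cast_nonneg j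
    have hxy : x ≤ y := by rw [hx, hy]; linarith
    have hxn : |x| ≤ n := by rw [abs_le]; constructor <;> (rw [hx]; linarith)
    have sq : ((j:ℝ) / n - i / n) ^ 2 * (n:ℝ) ^ 2 = x ^ 2 := by rw [hx]; field_simp
    have P1 : 0 ≤ a * (1 + (N - 1) / y) := by positivity
    have hp : a * (1 + (N - 1) / y) ≤ Lam * N := by
      have : (N - 1) / y ≤ N - 1 := div_le_self hN1 hy1
      apply mul_le_mul ha' (by linarith) (by positivity) (by linarith)
    have hLn : L / n ≤ L := div_le_self hL (by linarith)
    have hqL : q ≤ Lam + L := by linarith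
    -- up and down bounds
    have up : j + 1 < n → (n:ℝ) ^ 2 * (V (j + 1) t - V j t) ≤ A * (2 * x + 1) := by
      intro h
      have := hall ⟨j + 1, h⟩
      simp only at this
      have e : V (j + 1) t - V j t ≤ A * (((j + 1 : ℕ) : ℝ) / n - i / n) ^ 2 - A * ((j:ℝ) / n - i / n) ^ 2 := by linarith
      calc (n:ℝ) ^ 2 * (V (j + 1) t - V j t) ≤ (n:ℝ) ^ 2 * (A * (((j + 1 : ℕ) : ℝ) / n - i / n) ^ 2 - A * ((j:ℝ) / n - i / n) ^ 2) := by gcongr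
        _ = _ := by push_cast; rw [hx]; field_simp; ring
    have dn : 0 < j → (n:ℝ) ^ 2 * (V (j - 1) t - V j t) ≤ A * (-2 * x + 1) := by
      intro h
      have := hall ⟨j - 1, by omega⟩
      simp only at this
      have e : V (j - 1) t - V j t ≤ A * (((j - 1 : ℕ) : ℝ) / n - i / n) ^ 2 - A * ((j:ℝ) / n - i / n) ^ 2 := by linarith
      calc (n:ℝ) ^ 2 * (V (j - 1) t - V j t) ≤ (n:ℝ) ^ 2 * (A * (((j - 1 : ℕ) : ℝ) / n - i / n) ^ 2 - A * ((j:ℝ) / n - i / n) ^ 2) := by gcongr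
        _ = _ := by rw [Nat.cast_sub (by omega)]; push_cast; rw [hx]; field_simp; ring
    have hLam0 : 0 < Lam := by linarith
    have hLN : 0 ≤ Lam * (N - 1) := by positivity
    have hLN2 : 0 ≤ Lam * N := by nlinarith
    have goal : (n:ℝ) ^ 2 * ((if j + 1 < n then a * (1 + (N - 1) / y) * (V (j + 1) t - V j t) else 0)
        + (if 0 < j then q * (V (j - 1) t - V j t) else 0)) ≤ A * (3 * L + 2 * Lam * (N - 1) + Lam * N + Lam) := by
      rw [mul_add]
      have U : j + 1 < n → (n:ℝ) ^ 2 * (a * (1 + (N - 1) / y) * (V (j + 1) t - V j t)) ≤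
          A * (a * (1 + (N - 1) / y) * (2 * x + 1)) := by
        intro h
        have := mul_le_mul_of_nonneg_left (up h) P1
        linarith
      have D : 0 < j → (n:ℝ) ^ 2 * (q * (V (j - 1) t - V j t)) ≤ A * (q * (-2 * x + 1)) := by
        intro h
        have := mul_le_mul_of_nonneg_left (dn h) (by linarith : 0 ≤ q)
        linarith
      by_cases hu : j + 1 < n <;> by_cases hdj : 0 < j
      · rw [if_pos hu, if_pos hdj]
        have z1 : (a - q) * (2 * x) ≤ 2 * L := by
          have : |a - q| * |2 * x| ≤ L / n * (2 * n) := by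
            apply mul_le_mul _ _ (abs_nonneg _) (by positivity)
            · rw [abs_le]; constructor <;> linarith [div_nonneg hL hn0.le]
            · rw [abs_mul]; simp; linarith
          rw [← abs_mul] at this
          have e : L / n * (2 * n) = 2 * L := by field_simp
          rw [e] at this
          exact (le_abs_self _).trans this
        have z2 : a * ((N - 1) / y) * (2 * x) ≤ 2 * Lam * (N - 1) := by
          have e : a * ((N - 1) / y) * (2 * x) = 2 * a * (N - 1) * (x / y) := by ring
          rw [e]
          have hxy1 : x / y ≤ 1 := by rw [div_le_one (by linarith)]; exact hxy
          calc 2 * a * (N - 1) * (x / y) ≤ 2 * a * (N - 1) * 1 := by gcongr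
            _ ≤ _ := by rw [mul_one]; gcongr
        have z3 : a * (1 + (N - 1) / y) * (2 * x + 1) + q * (-2 * x + 1) ≤
            3 * L + 2 * Lam * (N - 1) + Lam * N + Lam := by
          have e : a * (1 + (N - 1) / y) * (2 * x + 1) + q * (-2 * x + 1) =
            (a - q) * (2 * x) + a * ((N - 1) / y) * (2 * x) + a * (1 + (N - 1) / y) + q := by ring
          rw [e]; linarith
        have := mul_le_mul_of_nonneg_left z3 hA.le
        linarith [U hu, D hdj]
      · rw [if_pos hu, if_neg hdj]
        have hj' : (j:ℝ) = 0 := by exact_mod_cast (by omega : j = 0)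
        have z : a * (1 + (N - 1) / y) * (2 * x + 1) ≤ 3 * L + 2 * Lam * (N - 1) + Lam * N + Lam := by
          have : a * (1 + (N - 1) / y) * (2 * x + 1) ≤ a * (1 + (N - 1) / y) * 1 := by
            apply mul_le_mul_of_nonneg_left _ P1
            rw [hx]; linarith
          linarith
        have := mul_le_mul_of_nonneg_left z hA.le
        linarith [U hu]
      · rw [if_neg hu, if_pos hdj]
        have hj' : (j:ℝ) + 1 = n := by exact_mod_cast (by omega : j + 1 = n)
        have z : q * (-2 * x + 1) ≤ 3 * L + 2 * Lam * (N - 1) + Lam * N + Lam := by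
          have : q * (-2 * x + 1) ≤ q * 1 := by
            apply mul_le_mul_of_nonneg_left _ (by linarith)
            rw [hx]; linarith
          linarith
        have := mul_le_mul_of_nonneg_left z hA.le
        linarith [D hdj]
      · rw [if_neg hu, if_neg hdj]
        have : 0 ≤ A * (3 * L + 2 * Lam * (N - 1) + Lam * N + Lam) := by
          apply mul_nonneg hA.le; linarith
        linarith
    have := mul_lt_mul_of_pos_left hC1 hA
    linarith

lemma time_mod {N : ℝ} {n : ℕ} {T lam Lam L C ε : ℝ} {V : ℕ → ℝ → ℝ} (hN : 2 ≤ N) (hlam : 0 < lam)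
    (hL : 0 ≤ L) (hLL : lam ≤ Lam) (h : LinSys N n T lam Lam L V) (hC : 0 ≤ C) (hε : 0 < ε)
    (hmod : ∀ t ∈ Icc (0:ℝ) T, ∀ i j, i < n → j < n → |V i t - V j t| ≤ ε / 2 + C * ((i:ℝ) / n - j / n) ^ 2)
    {i : ℕ} (hi : i < n) {t t' : ℝ} (ht : t ∈ Icc 0 T) (ht' : t' ∈ Icc 0 T) :
    |V i t' - V i t| ≤ ε + (C + 1) * (3 * L + 2 * Lam * (N - 1) + Lam * N + Lam + 1) * |t' - t| := by
  have main : ∀ t t', t ∈ Icc 0 T → t' ∈ Icc 0 T → t ≤ t' →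
    |V i t' - V i t| ≤ ε + (C + 1) * (3 * L + 2 * Lam * (N - 1) + Lam * N + Lam + 1) * |t' - t| := by
    intro t t' ht ht' hle
    rw [abs_of_nonneg (by linarith : 0 ≤ t' - t), abs_le]
    have hin : ∀ j, j < n → |V j t - V i t| < ε + (C + 1) * ((j:ℝ) / n - i / n) ^ 2 := by
      intro j hj
      have := hmod t ht j i hj hi
      have := sq_nonneg ((j:ℝ) / n - i / n)
      linarith
    have a1 := time_mod_one hN hlam hL hLL h (A := C + 1) (ε := ε) (by linarith) ht.1 hi
      (fun j hj => (le_abs_self _).trans_lt (hin j hj)) (lt_add_one _) t' ⟨hle, ht'.2⟩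
    have a2 := time_mod_one hN hlam hL hLL h.neg (A := C + 1) (ε := ε) (by linarith) ht.1 hi
      (fun j hj => by
        have := (neg_abs_le (V j t - V i t)); have := hin j hj; linarith) (lt_add_one _) t' ⟨hle, ht'.2⟩
    constructor <;> linarith
  rcases le_total t t' with hle | hle
  · exact main t t' ht ht' hle
  · have := main t' t ht' ht hle
    rwa [abs_sub_comm, abs_sub_comm t'] 

open Set Filter Topology

lemma rpow_bounds {lo hi a : ℝ} (hlo : 0 < lo) (hhi : 0 < hi) :
    ∃ g1 g2 : ℝ, 0 < g1 ∧ ∀ x, lo ≤ x → x ≤ hi → g1 ≤ x ^ a ∧ x ^ a ≤ g2 := by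
  refine ⟨min (lo ^ a) (hi ^ a), max (lo ^ a) (hi ^ a), lt_min (Real.rpow_pos_of_pos hlo a) (Real.rpow_pos_of_pos hhi a), ?_⟩
  intro x h1 h2
  have hx : 0 < x := by linarith
  rcases le_total 0 a with ha | ha
  · exact ⟨(min_le_left _ _).trans (Real.rpow_le_rpow hlo.le h1 ha), (Real.rpow_le_rpow hx.le h2 ha).trans (le_max_right _ _)⟩
  · exact ⟨(min_le_right _ _).trans (Real.rpow_le_rpow_of_nonpos hx h2 ha), (Real.rpow_le_rpow_of_nonpos hlo h1 ha).trans (le_max_left _ _)⟩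

lemma linsys_of_scheme (N : ℕ) (hN : 1 < N) (α b κ T η0 : ℝ) (hα : 0 < α) (hb : 0 < b) (hκ : 0 < κ)
    (hT : 0 ≤ T) (hη0 : 0 < η0) :
    ∃ lam Lam L : ℝ, 0 < lam ∧ lam ≤ Lam ∧ 0 ≤ L ∧ ∀ (n : ℕ) (U : ℕ → ℝ → ℝ), 2 ≤ n →
      (∀ t ∈ Icc 0 T, Reg N n α b κ (eta η0 b t) (Sf n κ (fun i => U i t))
        (dV N n α b (Sf n κ (fun i => U i t)))) →
      (∀ t ∈ Icc 0 T, ∀ j < n,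
        HasDerivWithinAt (U j) (dV N n α b (Sf n κ (fun i => U i t)) j) (Icc 0 T) t) →
      LinSys N n T lam Lam L (fun j t => dV N n α b (Sf n κ (fun i => U i t)) j) := by
  have hN' : (1:ℝ) ≤ (N:ℝ) - 1 := by
    have : (2:ℝ) ≤ N := by exact_mod_cast hN
    linarith
  set H := b ^ (1 / α) with hH
  have hH0 : 0 < H := Real.rpow_pos_of_pos hb _
  have he := eta_pos hη0 hb hT
  obtain ⟨g1, g2, hg1, hg⟩ := rpow_bounds (a := α - 1) he hH0
  set W := wf κ with hW
  have hW1 : 1 ≤ W := one_le_wf κ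
  set g3 := max g1 g2 with hg3
  have hg30 : 0 < g3 := lt_of_lt_of_le hg1 (le_max_left _ _)
  refine ⟨α * g1 / W ^ 3, α * g3 * W, 3 * (α * g3) * W * (W ^ 3 * H) + b, by positivity, ?_, by positivity, ?_⟩
  · calc α * g1 / W ^ 3 ≤ α * g1 := div_le_self (by positivity) (one_le_pow₀ hW1)
      _ ≤ α * g3 := by gcongr; exact le_max_left _ _
      _ ≤ α * g3 * W := le_mul_of_one_le_right (by positivity) hW1
  intro n U hn hreg hder t ht j hj
  have R := hreg t ht
  set s := Sf n κ (fun i => U i t) with hs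
  have het := eta_pos hη0 hb ht.1
  have hdpos := R.dh_pos hN het j hj
  have hd := dV_deriv (α := α) (b := b) (κ := κ) (hder t ht) j (by rw [← hs]; exact hdpos)
  rw [← hs] at hd
  have hdlo : eta η0 b T ≤ dh N n s j := by
    have := R.dh_ge_e hN j hj
    have h2 := eta_anti hη0 hb ht.1 ht.2
    nlinarith
  have hdhi : dh N n s j ≤ H := (R.dh_lt hN het hα j hj).le
  obtain ⟨b1, b2⟩ := hg _ hdlo hdhi
  have b2' : dh N n s j ^ (α - 1) ≤ g3 := b2.trans (le_max_right _ _)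
  set h := dh N n s j with hh
  set g := h ^ (α - 1) with hgd
  have hg0 : 0 < g := by linarith
  have hn0 : (0:ℝ) < n := by exact_mod_cast (by omega : 0 < n)
  have s0 := R.s_nonneg j hj.le
  have s1 := R.s_nonneg (j + 1) hj
  have s0κ := R.s_le j hj.le
  have s1κ := R.s_le (j + 1) hj
  have w0 := one_le_wf (s j)
  have w1 := one_le_wf (s (j + 1))
  have w0W : wf (s j) ≤ W := wf_le_of_nonneg s0 s0κ
  have w1W : wf (s (j + 1)) ≤ W := wf_le_of_nonneg s1 s1κ
  have w01 : wf (s j) ≤ wf (s (j + 1)) := wf_le_of_nonneg s0 (R.hB j hj)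
  have hf := R.f_pos j hj
  have hfb : b - h ^ α ≤ b := by linarith [Real.rpow_nonneg hdpos.le α]
  have hsg0 := sg_nonneg s0
  have hsg1 := sg_lt_one (s j)
  have hds : s (j + 1) - s j ≤ W ^ 3 * H / n := by
    have h1 := sub_le_sg_sub s0 (R.hB j hj) s1κ
    have h2 : (n:ℝ) * (sg (s (j + 1)) - sg (s j)) ≤ H := by
      have h3 : 0 ≤ ((N:ℝ) - 1) * (n / (j + 1)) * sg (s (j + 1)) := by
        have := sg_nonneg s1
        have : (0:ℝ) ≤ (N:ℝ) - 1 := by linarith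
        positivity
      have h4 : h = n * (sg (s (j + 1)) - sg (s j)) + (N - 1) * (n / (j + 1)) * sg (s (j + 1)) := rfl
      linarith
    calc s (j + 1) - s j ≤ W ^ 3 * (sg (s (j + 1)) - sg (s j)) := h1
      _ ≤ W ^ 3 * (H / n) := by
          gcongr
          rw [le_div_iff₀ hn0]; linarith
      _ = _ := by ring
  refine ⟨α * g * wf (s j) / wf (s (j + 1)) ^ 3, α * g * wf (s j) / wf (s j) ^ 3 + (b - h ^ α) * sg (s j) / n, ?_, ?_, ?_, ?_, ?_⟩
  · have : α * g1 * 1 / W ^ 3 ≤ α * g * wf (s j) / wf (s (j + 1)) ^ 3 := by gcongr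
    rwa [mul_one] at this
  · calc α * g * wf (s j) / wf (s (j + 1)) ^ 3 ≤ α * g * wf (s j) := div_le_self (by positivity) (one_le_pow₀ w1)
      _ ≤ α * g3 * W := by gcongr
  · have h1 : α * g * wf (s j) / wf (s (j + 1)) ^ 3 ≤ α * g * wf (s j) / wf (s j) ^ 3 := by gcongr
    have h2 : 0 ≤ (b - h ^ α) * sg (s j) / n := by positivity
    linarith
  · have h1 := inv_cube_sub_le s0 (R.hB j hj)
    have h2 : α * g * wf (s j) / wf (s j) ^ 3 - α * g * wf (s j) / wf (s (j + 1)) ^ 3 =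
      α * g * wf (s j) * (1 / wf (s j) ^ 3 - 1 / wf (s (j + 1)) ^ 3) := by ring
    have h3 : α * g * wf (s j) * (1 / wf (s j) ^ 3 - 1 / wf (s (j + 1)) ^ 3) ≤
        α * g3 * W * (3 * (W ^ 3 * H / n)) := by
      calc α * g * wf (s j) * (1 / wf (s j) ^ 3 - 1 / wf (s (j + 1)) ^ 3) ≤
          α * g * wf (s j) * (3 * (W ^ 3 * H / n)) := by
            apply mul_le_mul_of_nonneg_left _ (by positivity)
            linarith
        _ ≤ _ := by gcongr
    have h4 : (b - h ^ α) * sg (s j) / n ≤ b / n := by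
      gcongr
      calc (b - h ^ α) * sg (s j) ≤ b * 1 := mul_le_mul hfb hsg1.le hsg0 hb.le
        _ = b := mul_one b
    have h5 : (3 * (α * g3) * W * (W ^ 3 * H) + b) / n = α * g3 * W * (3 * (W ^ 3 * H / n)) + b / n := by
      ring
    rw [h5]; linarith
  · refine hd.congr_deriv ?_
    set v := dV N n α b s with hv
    have hpc : pc N n α s j * n = (n:ℝ) ^ 2 * (α * g * wf (s j) / wf (s (j + 1)) ^ 3 * (1 + ((N:ℝ) - 1) / ((j:ℝ) + 1))) := by
      unfold pc; rw [← hh, ← hgd]; ring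
    have hqc : qc N n α b s j * n = (n:ℝ) ^ 2 * (α * g * wf (s j) / wf (s j) ^ 3 + (b - h ^ α) * sg (s j) / n) := by
      unfold qc; rw [← hh, ← hgd]; field_simp
    rw [mul_add]
    congr 1
    · unfold dS
      rw [if_neg (Nat.succ_ne_zero j)]
      split_ifs with h1
      · rw [Nat.add_sub_cancel]
        calc -pc N n α s j * (n * (v j - v (j + 1))) = pc N n α s j * n * (v (j + 1) - v j) := by ring
          _ = _ := by rw [hpc]; ring
      · simp
    · unfold dS
      by_cases h0 : j = 0
      · simp [h0]
      · rw [if_neg h0, if_pos hj, if_pos (Nat.pos_of_ne_zero h0)]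
        calc qc N n α b s j * (n * (v (j - 1) - v j)) = qc N n α b s j * n * (v (j - 1) - v j) := by ring
          _ = _ := by rw [hqc]; ring

open Set Filter Topology

/-! ### Initial data of the scheme -/

noncomputable def U0f (u00 : ℝ) (s0 : ℝ → ℝ) (n : ℕ) (j : ℕ) : ℝ :=
  u00 - (1 / (n:ℝ)) * ∑ i ∈ Finset.range j, s0 (((i:ℝ) + 1) / n)

lemma Sf_U0f {u00 κ : ℝ} {s0 : ℝ → ℝ} {n : ℕ} (hn : 2 ≤ n) (h0 : s0 0 = 0) (h1 : s0 1 = κ) {j : ℕ} (hj : j ≤ n) :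
    Sf n κ (U0f u00 s0 n) j = s0 ((j:ℝ) / n) := by
  have hn0 : (0:ℝ) < n := by exact_mod_cast (by omega : 0 < n)
  unfold Sf
  rcases Nat.eq_zero_or_pos j with hz | hz
  · simp [hz, h0]
  · rw [if_neg (by omega)]
    rcases lt_or_eq_of_le hj with hlt | he
    · rw [if_pos hlt]
      obtain ⟨i, rfl⟩ : ∃ i, j = i + 1 := ⟨j - 1, by omega⟩
      unfold U0f
      rw [Nat.add_sub_cancel, Finset.sum_range_succ]
      push_cast
      field_simp
      ring
    · subst he
      rw [if_neg (by omega), div_self hn0.ne', h1]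

lemma init_data (N : ℕ) (hN : 1 < N) {α b κ : ℝ} (hα : 0 < α) (s0 s1 : ℝ → ℝ)
    (hd : ∀ r ∈ Icc (0:ℝ) 1, HasDerivWithinAt s0 (s1 r) (Icc 0 1) r) (hc : ContinuousOn s1 (Icc 0 1))
    (h0 : s0 0 = 0) (h1 : s0 1 = κ) (hs1 : ∀ r ∈ Icc (0:ℝ) 1, 0 < s1 r)
    (hpos : ∀ r ∈ Icc (0:ℝ) 1, 0 < b - (if r = 0 then (N:ℝ) * s1 0 else s1 r / wf (s0 r) ^ 3 + ((N:ℝ) - 1) * (sg (s0 r) / r)) ^ α) :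
    ∃ η0 m M : ℝ, ∃ n0 : ℕ, 0 < η0 ∧ η0 < sg κ ∧ 0 < m ∧ 2 ≤ n0 ∧
      (∀ n, n0 ≤ n → ∀ u00,
        (∀ j, 1 ≤ j → j ≤ n → η0 * (j / n) < sg (Sf n κ (U0f u00 s0 n) j)) ∧
        (∀ j < n, Sf n κ (U0f u00 s0 n) j < Sf n κ (U0f u00 s0 n) (j + 1)) ∧
        (∀ j < n, m ≤ dV N n α b (Sf n κ (U0f u00 s0 n)) j ∧ dV N n α b (Sf n κ (U0f u00 s0 n)) j ≤ M)) ∧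
      (∀ ε > 0, ∃ C : ℝ, 0 ≤ C ∧ ∀ n, 2 ≤ n → ∀ u00, ∀ i j, i < n → j < n →
        |dV N n α b (Sf n κ (U0f u00 s0 n)) i - dV N n α b (Sf n κ (U0f u00 s0 n)) j| ≤ ε + C * ((i:ℝ) / n - j / n) ^ 2) := by
  have hN' : (1:ℝ) ≤ (N:ℝ) - 1 := by
    have : (2:ℝ) ≤ N := by exact_mod_cast hN
    linarith
  have hs0c : ContinuousOn s0 (Icc 0 1) := fun r hr => (hd r hr).continuousWithinAt
  set σ : ℝ → ℝ := fun r => sg (s0 r) with hσ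
  set k1 : ℝ → ℝ := fun r => s1 r / wf (s0 r) ^ 3 with hk1
  have hσd : ∀ r ∈ Icc (0:ℝ) 1, HasDerivWithinAt σ (k1 r) (Icc 0 1) r := by
    intro r hr
    have := (hasDerivAt_sg (s0 r)).comp_hasDerivWithinAt r (hd r hr)
    exact HasDerivWithinAt.congr_deriv (f := σ) this (by simp only [hk1]; ring)
  have hk1c : ContinuousOn k1 (Icc 0 1) := by
    apply hc.div ((continuous_wf.comp_continuousOn hs0c).pow 3)
    intro r _; exact (pow_pos (wf_pos _) 3).ne'
  have hk1p : ∀ r ∈ Icc (0:ℝ) 1, 0 < k1 r := fun r hr => div_pos (hs1 r hr) (pow_pos (wf_pos _) 3)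
  have hσ0 : σ 0 = 0 := by simp only [hσ, h0, sg_zero]
  have mv : ∀ x ∈ Icc (0:ℝ) 1, ∀ y ∈ Icc (0:ℝ) 1, x < y → ∃ ξ ∈ Ioo x y, σ y - σ x = k1 ξ * (y - x) := by
    intro x hx y hy hxy
    have hsub : Icc x y ⊆ Icc 0 1 := Icc_subset_Icc hx.1 hy.2
    obtain ⟨ξ, hξ, h⟩ := exists_hasDerivAt_eq_slope σ k1 hxy
      (fun z hz => ((hσd z (hsub hz)).continuousWithinAt).mono hsub)
      (fun z hz => (hσd z (hsub (Ioo_subset_Icc_self hz))).hasDerivAt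
        (Icc_mem_nhds (by linarith [hz.1, hx.1]) (by linarith [hz.2, hy.2])))
    refine ⟨ξ, hξ, ?_⟩
    rw [h, div_mul_cancel₀ _ (by linarith)]
  have smv : ∀ x ∈ Icc (0:ℝ) 1, ∀ y ∈ Icc (0:ℝ) 1, x < y → s0 x < s0 y := by
    intro x hx y hy hxy
    have hsub : Icc x y ⊆ Icc 0 1 := Icc_subset_Icc hx.1 hy.2
    obtain ⟨ξ, hξ, h⟩ := exists_hasDerivAt_eq_slope s0 s1 hxy
      (fun z hz => ((hd z (hsub hz)).continuousWithinAt).mono hsub)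
      (fun z hz => (hd z (hsub (Ioo_subset_Icc_self hz))).hasDerivAt
        (Icc_mem_nhds (by linarith [hz.1, hx.1]) (by linarith [hz.2, hy.2])))
    have h2 := hs1 ξ (hsub (Ioo_subset_Icc_self hξ))
    rw [h] at h2
    have h3 := (div_pos_iff_of_pos_right (by linarith : 0 < y - x)).1 h2
    linarith
  set K2 : ℝ → ℝ := fun r => if r = 0 then k1 0 else σ r / r with hK2
  have hK2c : ContinuousOn K2 (Icc 0 1) := by
    intro r hr
    rcases eq_or_lt_of_le hr.1 with he | hlt
    · subst he
      rw [Metric.continuousWithinAt_iff]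
      intro ε hε
      obtain ⟨δ, hδ, h⟩ := Metric.continuousWithinAt_iff.1 (hk1c 0 (by simp)) ε hε
      refine ⟨δ, hδ, fun {x} hx hxd => ?_⟩
      simp only [hK2, if_true]
      split_ifs with hx0
      · simpa using hε
      · have hxp : 0 < x := lt_of_le_of_ne hx.1 (Ne.symm hx0)
        obtain ⟨ξ, hξ, h2⟩ := mv 0 (by simp) x hx hxp
        rw [hσ0, sub_zero, sub_zero] at h2
        rw [h2, mul_div_cancel_right₀ _ hx0]
        apply h ⟨hξ.1.le, hξ.2.le.trans hx.2⟩
        rw [Real.dist_eq, sub_zero, abs_of_pos hξ.1]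
        rw [Real.dist_eq, sub_zero, abs_of_pos hxp] at hxd
        exact hξ.2.trans hxd
    · have h1 : ContinuousWithinAt (fun r => σ r / r) (Icc 0 1) r :=
        (hσd r hr).continuousWithinAt.div continuousWithinAt_id hlt.ne'
      apply h1.congr_of_eventuallyEq _ (by simp only [hK2]; rw [if_neg hlt.ne'])
      filter_upwards [nhdsWithin_le_nhds (Ioi_mem_nhds hlt)] with y hy
      simp only [hK2]; rw [if_neg (ne_of_gt hy)]
  have hK2p : ∀ r ∈ Icc (0:ℝ) 1, 0 < K2 r := by
    intro r hr
    simp only [hK2]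
    split_ifs with h
    · exact hk1p 0 (by simp)
    · have hr0 : 0 < r := lt_of_le_of_ne hr.1 (Ne.symm h)
      obtain ⟨ξ, hξ, h2⟩ := mv 0 (by simp) r hr hr0
      rw [hσ0, sub_zero, sub_zero] at h2
      rw [h2, mul_div_cancel_right₀ _ h]
      exact hk1p ξ ⟨hξ.1.le, hξ.2.le.trans hr.2⟩
  -- the three-variable function
  set G : ℝ × ℝ × ℝ → ℝ := fun x => (b - (k1 x.1 + ((N:ℝ) - 1) * K2 x.2.1) ^ α) * wf (s0 x.2.2) with hG
  set Q : Set (ℝ × ℝ × ℝ) := Icc 0 1 ×ˢ (Icc 0 1 ×ˢ Icc 0 1) with hQ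
  have hQc : IsCompact Q := isCompact_Icc.prod (isCompact_Icc.prod isCompact_Icc)
  have hGc : ContinuousOn G Q := by
    have c1 : ContinuousOn (fun x : ℝ × ℝ × ℝ => k1 x.1) Q := hk1c.comp continuousOn_fst (fun x hx => hx.1)
    have c2 : ContinuousOn (fun x : ℝ × ℝ × ℝ => K2 x.2.1) Q :=
      hK2c.comp (by fun_prop) (fun x hx => hx.2.1)
    have c3 : ContinuousOn (fun x : ℝ × ℝ × ℝ => s0 x.2.2) Q :=
      hs0c.comp (by fun_prop) (fun x hx => hx.2.2)
    apply ContinuousOn.mul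
    · apply continuousOn_const.sub
      apply ContinuousOn.rpow_const _ (fun x _ => Or.inr hα.le)
      exact c1.add (continuousOn_const.mul c2)
    · exact continuous_wf.comp_continuousOn c3
  have hGu := hQc.uniformContinuousOn_of_continuous hGc
  rw [Metric.uniformContinuousOn_iff] at hGu
  have hQne : Q.Nonempty := ⟨(0, 0, 0), by simp [hQ]⟩
  obtain ⟨B, hB⟩ := hQc.exists_bound_of_continuousOn hGc
  have hB0 : 0 ≤ B := by
    obtain ⟨x, hx⟩ := hQne
    exact (norm_nonneg _).trans (hB x hx)
  -- diagonal positive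
  have hdiag : ∃ m > 0, ∀ r ∈ Icc (0:ℝ) 1, m ≤ G (r, r, r) := by
    have hcd : ContinuousOn (fun r : ℝ => G (r, r, r)) (Icc 0 1) :=
      hGc.comp (by fun_prop) (fun r hr => ⟨hr, hr, hr⟩)
    obtain ⟨x, hx, hmin⟩ := isCompact_Icc.exists_isMinOn ⟨0, by simp⟩ hcd
    refine ⟨G (x, x, x), ?_, fun r hr => hmin hr⟩
    have := hpos x hx
    apply mul_pos _ (wf_pos _)
    simp only
    have e : k1 x + ((N:ℝ) - 1) * K2 x = (if x = 0 then (N:ℝ) * s1 0 else s1 x / wf (s0 x) ^ 3 + ((N:ℝ) - 1) * (sg (s0 x) / x)) := by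
      simp only [hK2]
      split_ifs with hx0
      · subst hx0
        simp only [hk1, h0, wf_zero]; ring
      · rfl
    rw [e]; exact this
  obtain ⟨m, hm, hmd⟩ := hdiag
  obtain ⟨xm, hxm, hmin⟩ := isCompact_Icc.exists_isMinOn ⟨0, by simp⟩ hk1c
  set η0 := k1 xm / 2 with hη0
  have hη0p : 0 < η0 := half_pos (hk1p xm hxm)
  have hση : ∀ r ∈ Ioc (0:ℝ) 1, η0 * r < σ r := by
    intro r hr
    obtain ⟨ξ, hξ, h2⟩ := mv 0 (by simp) r ⟨hr.1.le, hr.2⟩ hr.1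
    rw [hσ0, sub_zero, sub_zero] at h2
    rw [h2]
    have h3 : k1 xm ≤ k1 ξ := hmin ⟨hξ.1.le, hξ.2.le.trans hr.2⟩
    apply mul_lt_mul_of_pos_right _ hr.1
    have := hk1p xm hxm
    linarith
  -- representation
  have rep : ∀ n : ℕ, 2 ≤ n → ∀ u00, ∀ j : ℕ, j < n → ∃ ξ ∈ Icc ((j:ℝ) / n) (((j:ℝ) + 1) / n),
      dV N n α b (Sf n κ (U0f u00 s0 n)) j = G (ξ, ((j:ℝ) + 1) / n, (j:ℝ) / n) := by
    intro n hn u00 j hj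
    have hn0 : (0:ℝ) < n := by exact_mod_cast (by omega : 0 < n)
    have hjn : (j:ℝ) + 1 ≤ n := by exact_mod_cast hj
    have m1 : (j:ℝ) / n ∈ Icc (0:ℝ) 1 := ⟨by positivity, by rw [div_le_one hn0]; linarith⟩
    have m2 : ((j:ℝ) + 1) / n ∈ Icc (0:ℝ) 1 := ⟨by positivity, by rw [div_le_one hn0]; linarith⟩
    obtain ⟨ξ, hξ, h2⟩ := mv _ m1 _ m2 (by gcongr; linarith)
    refine ⟨ξ, Ioo_subset_Icc_self hξ, ?_⟩
    unfold dV dh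
    rw [Sf_U0f hn h0 h1 hj.le, Sf_U0f hn h0 h1 (by omega : j + 1 ≤ n)]
    push_cast
    simp only [hG, hK2]
    rw [if_neg (by positivity)]
    have e : (n:ℝ) * (sg (s0 (((j:ℝ) + 1) / n)) - sg (s0 ((j:ℝ) / n))) = k1 ξ := by
      have : σ (((j:ℝ) + 1) / n) - σ ((j:ℝ) / n) = k1 ξ / n := by rw [h2]; ring
      simp only [hσ] at this
      rw [this]; field_simp
    rw [e]
    have e2 : ((N:ℝ) - 1) * ((n:ℝ) / ((j:ℝ) + 1)) * sg (s0 (((j:ℝ) + 1) / n)) = ((N:ℝ) - 1) * (σ (((j:ℝ) + 1) / n) / (((j:ℝ) + 1) / n)) := by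
      simp only [hσ]; field_simp
    rw [e2]
  have memQ : ∀ n : ℕ, 2 ≤ n → ∀ j : ℕ, j < n → ∀ ξ ∈ Icc ((j:ℝ) / n) (((j:ℝ) + 1) / n), (ξ, ((j:ℝ) + 1) / n, (j:ℝ) / n) ∈ Q := by
    intro n hn j hj ξ hξ
    have hn0 : (0:ℝ) < n := by exact_mod_cast (by omega : 0 < n)
    have hjn : (j:ℝ) + 1 ≤ n := by exact_mod_cast hj
    have m1 : (j:ℝ) / n ∈ Icc (0:ℝ) 1 := ⟨by positivity, by rw [div_le_one hn0]; linarith⟩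
    have m2 : ((j:ℝ) + 1) / n ∈ Icc (0:ℝ) 1 := ⟨by positivity, by rw [div_le_one hn0]; linarith⟩
    exact ⟨⟨m1.1.trans hξ.1, hξ.2.trans m2.2⟩, m2, m1⟩
  obtain ⟨δ0, hδ0, hδ⟩ := hGu (m / 2) (by positivity)
  obtain ⟨n1, hn1⟩ := exists_nat_gt (1 / δ0)
  refine ⟨η0, m / 2, B, max n1 2, hη0p, ?_, by positivity, le_max_right _ _, ?_, ?_⟩
  · have := hση 1 (by simp)
    simpa [hσ, h1] using this
  · intro n hn u00
    have hn2 : 2 ≤ n := (le_max_right _ _).trans hn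
    have hn0 : (0:ℝ) < n := by exact_mod_cast (by omega : 0 < n)
    refine ⟨?_, ?_, ?_⟩
    · intro j hj1 hjn
      rw [Sf_U0f hn2 h0 h1 hjn]
      apply hση
      have : (0:ℝ) < j := by exact_mod_cast hj1
      exact ⟨by positivity, by rw [div_le_one hn0]; exact_mod_cast hjn⟩
    · intro j hj
      rw [Sf_U0f hn2 h0 h1 hj.le, Sf_U0f hn2 h0 h1 (by omega : j + 1 ≤ n)]
      have hjn : (j:ℝ) + 1 ≤ n := by exact_mod_cast hj
      push_cast
      apply smv
      · exact ⟨by positivity, by rw [div_le_one hn0]; linarith⟩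
      · exact ⟨by positivity, by rw [div_le_one hn0]; linarith⟩
      · gcongr; linarith
    · intro j hj
      obtain ⟨ξ, hξ, e⟩ := rep n hn2 u00 j hj
      have hq := memQ n hn2 j hj ξ hξ
      rw [e]
      have hd1 : 1 / (n:ℝ) < δ0 := by
        have : (n1:ℝ) ≤ n := by exact_mod_cast (le_max_left _ _).trans hn
        rw [div_lt_iff₀ hn0]
        rw [div_lt_iff₀ hδ0] at hn1
        nlinarith
      constructor
      · have hr : (j:ℝ) / n ∈ Icc (0:ℝ) 1 := hq.2.2
        have hq2 : ((j:ℝ) / n, (j:ℝ) / n, (j:ℝ) / n) ∈ Q := ⟨hr, hr, hr⟩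
        have e3 : ((j:ℝ) + 1) / n = (j:ℝ) / n + 1 / n := by ring
        have h4 := hδ _ hq _ hq2 (by
          rw [Prod.dist_eq, Prod.dist_eq]
          apply max_lt
          · simp only [Real.dist_eq]
            rw [abs_of_nonneg (by linarith [hξ.1])]
            have := hξ.2
            rw [e3] at this
            linarith
          · apply max_lt
            · simp only [Real.dist_eq]
              rw [e3, add_sub_cancel_left, abs_of_pos (by positivity)]; exact hd1
            · simpa using hδ0)
        have h5 := hmd _ hr
        rw [Real.dist_eq, abs_lt] at h4
        linarith [h4.1]
      · exact (le_abs_self _).trans (hB _ hq)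
  · intro ε hε
    obtain ⟨δ, hδp, hδ⟩ := hGu ε hε
    refine ⟨2 * B / (δ / 2) ^ 2, by positivity, ?_⟩
    intro n hn2 u00 i j hi hj
    have hn0 : (0:ℝ) < n := by exact_mod_cast (by omega : 0 < n)
    obtain ⟨ξ, hξ, e⟩ := rep n hn2 u00 i hi
    obtain ⟨ζ, hζ, e'⟩ := rep n hn2 u00 j hj
    have hq := memQ n hn2 i hi ξ hξ
    have hq' := memQ n hn2 j hj ζ hζ
    set x := (i:ℝ) / n - j / n with hx
    by_cases hbig : δ / 2 ≤ |x|
    · have b1 := hB _ hq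
      have b2 := hB _ hq'
      rw [← e] at b1
      rw [← e'] at b2
      have b3 := abs_sub (dV N n α b (Sf n κ (U0f u00 s0 n)) i) (dV N n α b (Sf n κ (U0f u00 s0 n)) j)
      rw [Real.norm_eq_abs] at b1 b2
      have b4 : 2 * B ≤ 2 * B / (δ / 2) ^ 2 * x ^ 2 := by
        rw [div_mul_eq_mul_div, le_div_iff₀ (by positivity)]
        have : (δ / 2) ^ 2 ≤ x ^ 2 := by rw [← sq_abs x]; gcongr
        exact mul_le_mul_of_nonneg_left this (by positivity)
      linarith
    · push Not at hbig
      have hC : 0 ≤ 2 * B / (δ / 2) ^ 2 * x ^ 2 := by positivity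
      by_cases hij : i = j
      · subst hij; simp; positivity
      · have hd1 : 1 / (n:ℝ) ≤ |x| := by
          rw [hx, ← sub_div, abs_div, abs_of_pos hn0]
          gcongr
          rcases Nat.lt_or_gt_of_ne hij with h | h
          · have : (i:ℝ) + 1 ≤ j := by exact_mod_cast h
            rw [abs_sub_comm]; exact le_trans (by linarith) (le_abs_self _)
          · have : (j:ℝ) + 1 ≤ i := by exact_mod_cast h
            exact le_trans (by linarith) (le_abs_self _)
        have h4 := hδ _ hq _ hq' (by
          have e3 : ∀ j : ℕ, ((j:ℝ) + 1) / n = (j:ℝ) / n + 1 / n := by intro j; ring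
          rw [e3] at hξ hζ
          have hx1 := neg_abs_le x
          have hx2 := le_abs_self x
          rw [Prod.dist_eq, Prod.dist_eq]
          apply max_lt
          · simp only [Real.dist_eq]
            rw [abs_lt]
            constructor <;> linarith [hξ.1, hξ.2, hζ.1, hζ.2]
          · apply max_lt
            · simp only [Real.dist_eq]
              rw [e3, e3, abs_lt]
              constructor <;> linarith
            · simp only [Real.dist_eq]
              rw [← hx]; linarith)
        rw [← e, ← e', Real.dist_eq] at h4
        linarith

open Set Filter Topology

/-! ### The family of discrete solutions -/

structure Fam (N : ℕ) (α b κ η0 m M Cs u00 : ℝ) (s0 : ℝ → ℝ) (n0 : ℕ)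
    (U V s h : ℕ → ℕ → ℝ → ℝ) : Prop where
  n0_ge : 2 ≤ n0
  s_zero : ∀ n, n0 ≤ n → ∀ t ∈ Icc (0:ℝ) n, s n 0 t = 0
  s_last : ∀ n, n0 ≤ n → ∀ t ∈ Icc (0:ℝ) n, s n n t = κ
  s_mono : ∀ n, n0 ≤ n → ∀ t ∈ Icc (0:ℝ) n, ∀ i l, i ≤ l → l ≤ n → s n i t ≤ s n l t
  s_lip : ∀ n, n0 ≤ n → ∀ t ∈ Icc (0:ℝ) n, ∀ i l, i ≤ l → l ≤ n →
    s n l t - s n i t ≤ Cs * ((l:ℝ) / n - (i:ℝ) / n)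
  U_step : ∀ n, n0 ≤ n → ∀ t ∈ Icc (0:ℝ) n, ∀ j, j + 1 < n → U n (j + 1) t = U n j t - s n (j + 1) t / n
  sg_step : ∀ n, n0 ≤ n → ∀ t ∈ Icc (0:ℝ) n, ∀ j, j < n →
    sg (s n (j + 1) t) - sg (s n j t) =
      (1 / (n:ℝ)) * (h n j t - ((N:ℝ) - 1) * (sg (s n (j + 1) t) / (((j + 1 : ℕ) : ℝ) / n)))
  h_eq : ∀ n, n0 ≤ n → ∀ t ∈ Icc (0:ℝ) n, ∀ j, j < n → h n j t = (b - V n j t / wf (s n j t)) ^ (1 / α)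
  V_bd : ∀ n, n0 ≤ n → ∀ t ∈ Icc (0:ℝ) n, ∀ j, j < n → m ≤ V n j t ∧ V n j t ≤ M
  h_bd : ∀ n, n0 ≤ n → ∀ t ∈ Icc (0:ℝ) n, ∀ j, j < n →
    ((N:ℝ) - 1) * eta η0 b t ≤ h n j t ∧ h n j t ≤ b ^ (1 / α)
  V_eq : ∀ n, n0 ≤ n → ∀ t ∈ Icc (0:ℝ) n, ∀ j, j < n → V n j t = (b - h n j t ^ α) * wf (s n j t)
  U_der : ∀ n, n0 ≤ n → ∀ t ∈ Icc (0:ℝ) n, ∀ j, j < n → HasDerivWithinAt (U n j) (V n j t) (Icc 0 n) t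
  sg_lo : ∀ n, n0 ≤ n → ∀ t ∈ Icc (0:ℝ) n, ∀ j, j ≤ n → eta η0 b t * ((j:ℝ) / n) ≤ sg (s n j t)
  s_init : ∀ n, n0 ≤ n → ∀ j, j ≤ n → s n j 0 = s0 ((j:ℝ) / n)
  U_init : ∀ n, n0 ≤ n → U n 0 0 = u00
  modx : ∀ T, 0 ≤ T → ∀ ε > 0, ∃ C : ℝ, 0 ≤ C ∧ ∀ n, n0 ≤ n → T ≤ (n:ℝ) → ∀ t ∈ Icc (0:ℝ) T,
    ∀ i j, i < n → j < n → |V n i t - V n j t| ≤ ε + C * |(i:ℝ) / n - (j:ℝ) / n|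
  modt : ∀ T, 0 ≤ T → ∀ ε > 0, ∃ C : ℝ, 0 ≤ C ∧ ∀ n, n0 ≤ n → T ≤ (n:ℝ) → ∀ t ∈ Icc (0:ℝ) T,
    ∀ t' ∈ Icc (0:ℝ) T, ∀ i, i < n → |V n i t' - V n i t| ≤ ε + C * |t' - t|

lemma frac_mem {n j : ℕ} (hj : j ≤ n) (hn : 0 < n) : (j:ℝ) / n ∈ Icc (0:ℝ) 1 := by
  have hn0 : (0:ℝ) < n := by exact_mod_cast hn
  exact ⟨by positivity, by rw [div_le_one hn0]; exact_mod_cast hj⟩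

lemma fam_exists (N : ℕ) (hN : 1 < N) {α b κ : ℝ} (hα : 0 < α) (hb : 0 < b) (hκ : 0 < κ) (s0 s1 : ℝ → ℝ) (u00 : ℝ)
    (hd : ∀ r ∈ Icc (0:ℝ) 1, HasDerivWithinAt s0 (s1 r) (Icc 0 1) r) (hc : ContinuousOn s1 (Icc 0 1))
    (h0 : s0 0 = 0) (h1 : s0 1 = κ) (hs1 : ∀ r ∈ Icc (0:ℝ) 1, 0 < s1 r)
    (hpos : ∀ r ∈ Icc (0:ℝ) 1, 0 < b - (if r = 0 then (N:ℝ) * s1 0 else s1 r / wf (s0 r) ^ 3 + ((N:ℝ) - 1) * (sg (s0 r) / r)) ^ α) :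
    ∃ (η0 m M Cs : ℝ) (n0 : ℕ) (U V s h : ℕ → ℕ → ℝ → ℝ), 0 < η0 ∧ η0 < sg κ ∧ 0 < m ∧ 0 < Cs ∧
      Fam N α b κ η0 m M Cs u00 s0 n0 U V s h := by
  have hN2 : (2:ℝ) ≤ N := by exact_mod_cast hN
  have hN' : (0:ℝ) < (N:ℝ) - 1 := by linarith
  obtain ⟨η0, m, M, n0, hη0, hηκ, hm, hn0, hinit, hmod⟩ := init_data N hN hα s0 s1 hd hc h0 h1 hs1 hpos
  have hex : ∀ n : ℕ, ∃ U : ℕ → ℝ → ℝ, n0 ≤ n → ((∀ j < n, U j 0 = U0f u00 s0 n j) ∧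
      (∀ t ∈ Icc (0:ℝ) n, Reg N n α b κ (eta η0 b t) (Sf n κ (fun i => U i t))
        (dV N n α b (Sf n κ (fun i => U i t)))) ∧
      (∀ t ∈ Icc (0:ℝ) n, ∀ j < n, m / 2 ≤ dV N n α b (Sf n κ (fun i => U i t)) j ∧
        dV N n α b (Sf n κ (fun i => U i t)) j ≤ M + m / 2) ∧
      (∀ t ∈ Icc (0:ℝ) n, ∀ j < n,
        HasDerivWithinAt (U j) (dV N n α b (Sf n κ (fun i => U i t)) j) (Icc 0 n) t)) := by
    intro n
    by_cases hn : n0 ≤ n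
    · obtain ⟨a1, a2, a3⟩ := hinit n hn u00
      obtain ⟨U, hU⟩ := scheme_inv N n hN (hn0.trans hn) α b κ n η0 m M hα hb hκ (Nat.cast_nonneg n) hη0 hηκ hm _ a1 a2 a3
      exact ⟨U, fun _ => hU⟩
    · exact ⟨fun _ _ => 0, fun h => absurd h hn⟩
  choose U hU using hex
  have hreg : ∀ n, n0 ≤ n → ∀ t ∈ Icc (0:ℝ) n, _ := fun n hn => (hU n hn).2.1
  have hbd : ∀ n, n0 ≤ n → ∀ t ∈ Icc (0:ℝ) n, _ := fun n hn => (hU n hn).2.2.1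
  have hder : ∀ n, n0 ≤ n → ∀ t ∈ Icc (0:ℝ) n, _ := fun n hn => (hU n hn).2.2.2
  have hnpos : ∀ n : ℕ, n0 ≤ n → (0:ℝ) < n := fun n hn => by exact_mod_cast (by omega : 0 < n)
  have hH0 : 0 < b ^ (1 / α) := Real.rpow_pos_of_pos hb _
  have hW := wf_pos κ
  -- moduli
  have hx2 : ∀ T, 0 ≤ T → ∀ ε > 0, ∃ C : ℝ, 0 ≤ C ∧ ∀ n, n0 ≤ n → T ≤ (n:ℝ) → ∀ t ∈ Icc (0:ℝ) T,
      ∀ i j, i < n → j < n → |dV N n α b (Sf n κ (fun i => U n i t)) i - dV N n α b (Sf n κ (fun i => U n i t)) j| ≤ ε + C * ((i:ℝ) / n - (j:ℝ) / n) ^ 2 := by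
    intro T hT ε hε
    obtain ⟨lam, Lam, L, hlam, hLL, hL, hsys⟩ := linsys_of_scheme N hN α b κ T η0 hα hb hκ hT hη0
    obtain ⟨C0, hC0, hmod0⟩ := hmod (ε / 4) (by positivity)
    set K := (Lam * ((N:ℝ) - 1) * 2 + L) / lam + 1 with hK
    have hLam : 0 < Lam := by linarith
    have hK1 : 1 ≤ K := by
      have : 0 ≤ (Lam * ((N:ℝ) - 1) * 2 + L) / lam := by positivity
      linarith
    have hKl : Lam * ((N:ℝ) - 1) * 2 + L < lam * K := by
      rw [hK]; field_simp; linarith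
    obtain ⟨C', hC', hdb⟩ := doubling_mod hK1 hε hC0
    refine ⟨C', hC', ?_⟩
    intro n hn hTn
    have hsub : Icc (0:ℝ) T ⊆ Icc (0:ℝ) n := Icc_subset_Icc_right hTn
    have hs := hsys n (U n) (hn0.trans hn) (fun t ht => hreg n hn t (hsub ht))
      (fun t ht j hj => (hder n hn t (hsub ht) j hj).mono hsub)
    apply hdb N n T lam Lam L _ hN2 hlam hL hKl hs
    intro i j hi hj
    have e : Sf n κ (fun i => U n i 0) = Sf n κ (U0f u00 s0 n) := Sf_congr (fun i hi => (hU n hn).1 i hi)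
    simp only [e]
    exact hmod0 n (hn0.trans hn) u00 i j hi hj
  have ht2 : ∀ T, 0 ≤ T → ∀ ε > 0, ∃ C : ℝ, 0 ≤ C ∧ ∀ n, n0 ≤ n → T ≤ (n:ℝ) → ∀ t ∈ Icc (0:ℝ) T,
      ∀ t' ∈ Icc (0:ℝ) T, ∀ i, i < n → |dV N n α b (Sf n κ (fun i => U n i t')) i - dV N n α b (Sf n κ (fun i => U n i t)) i| ≤ ε + C * |t' - t| := by
    intro T hT ε hε
    obtain ⟨lam, Lam, L, hlam, hLL, hL, hsys⟩ := linsys_of_scheme N hN α b κ T η0 hα hb hκ hT hη0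
    obtain ⟨C0, hC0, hmod0⟩ := hx2 T hT (ε / 2) (by positivity)
    have hLam : 0 < Lam := by linarith
    refine ⟨(C0 + 1) * (3 * L + 2 * Lam * ((N:ℝ) - 1) + Lam * N + Lam + 1), by positivity, ?_⟩
    intro n hn hTn t ht t' ht' i hi
    have hsub : Icc (0:ℝ) T ⊆ Icc (0:ℝ) n := Icc_subset_Icc_right hTn
    have hs := hsys n (U n) (hn0.trans hn) (fun t ht => hreg n hn t (hsub ht))
      (fun t ht j hj => (hder n hn t (hsub ht) j hj).mono hsub)
    exact time_mod hN2 hlam hL hLL hs hC0 hε (hmod0 n hn hTn) hi ht ht'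
  refine ⟨η0, m / 2, M + m / 2, wf κ ^ 3 * b ^ (1 / α), n0, U, fun n j t => dV N n α b (Sf n κ (fun i => U n i t)) j,
    fun n j t => Sf n κ (fun i => U n i t) j, fun n j t => dh N n (Sf n κ (fun i => U n i t)) j, hη0, hηκ, by positivity, by positivity, ?_⟩
  have hstep : ∀ n, n0 ≤ n → ∀ t ∈ Icc (0:ℝ) n, ∀ j, j < n →
      Sf n κ (fun i => U n i t) (j + 1) - Sf n κ (fun i => U n i t) j ≤ wf κ ^ 3 * b ^ (1 / α) * (1 / n) := by
    intro n hn t ht j hj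
    have R := hreg n hn t ht
    have het := eta_pos hη0 hb ht.1
    have hn' := hnpos n hn
    set s := Sf n κ (fun i => U n i t)
    have s1 := R.s_nonneg (j + 1) hj
    have h1 := sub_le_sg_sub (R.s_nonneg j hj.le) (R.hB j hj) (R.s_le (j + 1) hj)
    have h2 : (n:ℝ) * (sg (s (j + 1)) - sg (s j)) ≤ b ^ (1 / α) := by
      have h3 : 0 ≤ ((N:ℝ) - 1) * (n / (j + 1)) * sg (s (j + 1)) := by
        have := sg_nonneg s1
        positivity
      have h4 : dh N n s j = n * (sg (s (j + 1)) - sg (s j)) + (N - 1) * (n / (j + 1)) * sg (s (j + 1)) := rfl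
      linarith [R.dh_lt hN het hα j hj]
    calc s (j + 1) - s j ≤ wf κ ^ 3 * (sg (s (j + 1)) - sg (s j)) := h1
      _ ≤ wf κ ^ 3 * (b ^ (1 / α) / n) := by
          gcongr
          rw [le_div_iff₀ hn']; linarith
      _ = _ := by ring
  refine ⟨hn0, ?_, ?_, ?_, ?_, ?_, ?_, ?_, ?_, ?_, ?_, ?_, ?_, ?_, ?_, ?_, ?_⟩
  · intro n hn t ht; exact (hreg n hn t ht).hs0
  · intro n hn t ht; exact (hreg n hn t ht).hsn
  · intro n hn t ht i l hil hl; exact (hreg n hn t ht).mono i l hil hl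
  · intro n hn t ht i l hil
    induction l, hil using Nat.le_induction with
    | base => intro _; simp
    | succ l hl ih =>
      intro hln
      have a := ih (by omega)
      have c := hstep n hn t ht l (by omega)
      have e : wf κ ^ 3 * b ^ (1 / α) * (((l + 1 : ℕ) : ℝ) / n - (i:ℝ) / n) =
        wf κ ^ 3 * b ^ (1 / α) * ((l : ℝ) / n - (i:ℝ) / n) + wf κ ^ 3 * b ^ (1 / α) * (1 / n) := by
        push_cast; ring
      rw [e]; linarith
  · intro n hn t ht j hj
    have hn' := hnpos n hn
    simp only [Sf]
    rw [if_neg (by omega), if_pos hj, Nat.add_sub_cancel]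
    field_simp; ring
  · intro n hn t ht j hj
    have hn' := hnpos n hn
    simp only [dh]
    push_cast
    field_simp; ring
  · intro n hn t ht j hj
    have R := hreg n hn t ht
    have het := eta_pos hη0 hb ht.1
    have hp := R.dh_pos hN het j hj
    simp only [dV]
    rw [mul_div_cancel_right₀ _ (wf_pos _).ne', sub_sub_cancel, ← Real.rpow_mul hp.le, mul_one_div_cancel hα.ne', Real.rpow_one]
  · intro n hn t ht j hj; exact hbd n hn t ht j hj
  · intro n hn t ht j hj
    have R := hreg n hn t ht
    have het := eta_pos hη0 hb ht.1
    exact ⟨R.dh_ge_e hN j hj, (R.dh_lt hN het hα j hj).le⟩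
  · intro n hn t ht j hj; rfl
  · intro n hn t ht j hj; exact hder n hn t ht j hj
  · intro n hn t ht j hj; exact (hreg n hn t ht).hA' j hj
  · intro n hn j hj
    have e : Sf n κ (fun i => U n i 0) = Sf n κ (U0f u00 s0 n) := Sf_congr (fun i hi => (hU n hn).1 i hi)
    simp only [e]
    exact Sf_U0f (hn0.trans hn) h0 h1 hj
  · intro n hn
    rw [(hU n hn).1 0 (by omega)]; simp [U0f]
  · intro T hT ε hε
    obtain ⟨C, hC, h⟩ := hx2 T hT ε hε
    refine ⟨C, hC, fun n hn hTn t ht i j hi hj => (h n hn hTn t ht i j hi hj).trans ?_⟩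
    have m1 := frac_mem hi.le (by omega : 0 < n)
    have m2 := frac_mem hj.le (by omega : 0 < n)
    have : |(i:ℝ) / n - (j:ℝ) / n| ≤ 1 := by
      rw [abs_le]; constructor <;> linarith [m1.1, m1.2, m2.1, m2.2]
    have h2 : ((i:ℝ) / n - (j:ℝ) / n) ^ 2 ≤ |(i:ℝ) / n - (j:ℝ) / n| := by
      rw [← sq_abs]; nlinarith [abs_nonneg ((i:ℝ) / n - (j:ℝ) / n)]
    gcongr
  · exact ht2

open Set Filter Topology

/-- Grid index of the radius `r`. -/
noncomputable def Jx (r : ℝ) (n : ℕ) : ℕ := min ⌊r * n⌋₊ (n - 1)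

lemma Jx_lt (r : ℝ) {n : ℕ} (hn : 0 < n) : Jx r n < n :=
  lt_of_le_of_lt (min_le_right _ _) (by omega)

lemma Jx_zero (n : ℕ) : Jx 0 n = 0 := by simp [Jx]

lemma Jx_mono {r r' : ℝ} (h : r ≤ r') (n : ℕ) : Jx r n ≤ Jx r' n :=
  min_le_min (Nat.floor_mono (mul_le_mul_of_nonneg_right h (Nat.cast_nonneg n))) le_rfl

lemma Jx_bounds {r : ℝ} (hr : r ∈ Icc (0:ℝ) 1) {n : ℕ} (hn : 0 < n) :
    r - 1 / n ≤ (Jx r n : ℝ) / n ∧ (Jx r n : ℝ) / n ≤ r := by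
  have hn0 : (0:ℝ) < n := by exact_mod_cast hn
  constructor
  · rw [sub_le_iff_le_add, ← add_div, le_div_iff₀ hn0]
    rcases min_choice ⌊r * n⌋₊ (n - 1) with h | h
    · rw [Jx, h]; exact (Nat.lt_floor_add_one _).le
    · rw [Jx, h]
      have : ((n - 1 : ℕ) : ℝ) = n - 1 := by rw [Nat.cast_sub (by omega)]; simp
      rw [this]
      have := mul_le_mul_of_nonneg_right hr.2 hn0.le
      linarith
  · rw [div_le_iff₀ hn0]
    have h1 : (Jx r n : ℝ) ≤ (⌊r * n⌋₊ : ℝ) := by exact_mod_cast min_le_left _ _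
    exact h1.trans (Nat.floor_le (mul_nonneg hr.1 hn0.le))

lemma Jx_tendsto {r : ℝ} (hr : r ∈ Icc (0:ℝ) 1) :
    Tendsto (fun n : ℕ => (Jx r n : ℝ) / n) atTop (𝓝 r) := by
  have h1 : Tendsto (fun n : ℕ => r - 1 / (n:ℝ)) atTop (𝓝 r) := by
    simpa using (tendsto_const_nhds (x := r)).sub (tendsto_one_div_atTop_nhds_zero_nat (𝕜 := ℝ))
  refine tendsto_of_tendsto_of_tendsto_of_le_of_le' h1 tendsto_const_nhds ?_ ?_
  · filter_upwards [eventually_gt_atTop 0] with n hn using (Jx_bounds hr hn).1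
  · filter_upwards [eventually_gt_atTop 0] with n hn using (Jx_bounds hr hn).2

lemma hyp_le : (hyperfilter ℕ : Filter ℕ) ≤ atTop := Nat.hyperfilter_le_atTop

lemma ulim_exists (x : ℕ → ℝ) (B : ℝ) (h : ∀ᶠ n in atTop, |x n| ≤ B) :
    ∃ L, Tendsto x (hyperfilter ℕ : Filter ℕ) (𝓝 L) := by
  have h1 : ∀ᶠ n in (hyperfilter ℕ : Filter ℕ), x n ∈ Icc (-B) B :=
    (h.filter_mono hyp_le).mono fun n hn => abs_le.1 hn
  obtain ⟨L, _, hL⟩ := (isCompact_Icc (a := -B) (b := B)).ultrafilter_le_nhds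
    ((hyperfilter ℕ).map x) (by rw [Ultrafilter.coe_map, le_principal_iff]; exact h1)
  exact ⟨L, by rw [Ultrafilter.coe_map] at hL; exact hL⟩

lemma disc_deriv (x : ℕ → ℝ) {n i j : ℕ} (hn : 0 < n) (hij : i ≤ j) (A E : ℝ)
    (h : ∀ l, i ≤ l → l < j → |n * (x (l + 1) - x l) - A| ≤ E) :
    |x j - x i - ((j:ℝ) / n - (i:ℝ) / n) * A| ≤ ((j:ℝ) / n - (i:ℝ) / n) * E := by
  have hn0 : (0:ℝ) < n := by exact_mod_cast hn
  induction j, hij using Nat.le_induction with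
  | base => simp
  | succ j hij ih =>
    have ih' := ih (fun l h1 h2 => h l h1 (by omega))
    have hj := h j hij (by omega)
    have e1 : x (j + 1) - x i - (((j + 1 : ℕ):ℝ) / n - (i:ℝ) / n) * A
        = (x j - x i - ((j:ℝ) / n - (i:ℝ) / n) * A) + (1 / n) * (n * (x (j + 1) - x j) - A) := by
      push_cast; field_simp; ring
    have e2 : (((j + 1 : ℕ):ℝ) / n - (i:ℝ) / n) * E = ((j:ℝ) / n - (i:ℝ) / n) * E + (1 / n) * E := by
      push_cast; field_simp; ring
    rw [e1, e2]
    refine (abs_add_le _ _).trans (add_le_add ih' ?_)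
    rw [abs_mul, abs_of_pos (by positivity : (0:ℝ) < 1 / n)]
    exact mul_le_mul_of_nonneg_left hj (by positivity)

/-- Facts about the limit of the numerical scheme. -/
structure Lim (N : ℕ) (α b κ η0 m M Cs u00 : ℝ) (s0 : ℝ → ℝ) (u v s h : ℝ → ℝ → ℝ) : Prop where
  s_zero : ∀ t, 0 ≤ t → s 0 t = 0
  s_one : ∀ t, 0 ≤ t → s 1 t = κ
  s_mono : ∀ t, 0 ≤ t → ∀ r r', 0 ≤ r → r ≤ r' → r' ≤ 1 → s r t ≤ s r' t
  s_lip : ∀ t, 0 ≤ t → ∀ r r', 0 ≤ r → r ≤ r' → r' ≤ 1 → s r' t - s r t ≤ Cs * (r' - r)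
  u_x : ∀ t, 0 ≤ t → ∀ r r', 0 ≤ r → r ≤ r' → r' ≤ 1 →
    |u r' t - u r t + (r' - r) * s r t| ≤ (r' - r) * (Cs * (r' - r))
  u_t : ∀ T, 0 ≤ T → ∀ ε > 0, ∃ C : ℝ, 0 ≤ C ∧ ∀ t ∈ Icc (0:ℝ) T, ∀ t' ∈ Icc (0:ℝ) T,
    ∀ r ∈ Icc (0:ℝ) 1, |u r t' - u r t - (t' - t) * v r t| ≤ |t' - t| * (ε + C * |t' - t|)
  v_mod : ∀ T, 0 ≤ T → ∀ ε > 0, ∃ C : ℝ, 0 ≤ C ∧ ∀ t ∈ Icc (0:ℝ) T, ∀ t' ∈ Icc (0:ℝ) T,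
    ∀ r ∈ Icc (0:ℝ) 1, ∀ r' ∈ Icc (0:ℝ) 1, |v r' t' - v r t| ≤ ε + C * (|r' - r| + |t' - t|)
  h_eq : ∀ t, 0 ≤ t → ∀ r ∈ Icc (0:ℝ) 1, h r t = (b - v r t / wf (s r t)) ^ (1 / α)
  v_eq : ∀ t, 0 ≤ t → ∀ r ∈ Icc (0:ℝ) 1, v r t = (b - h r t ^ α) * wf (s r t)
  v_bd : ∀ t, 0 ≤ t → ∀ r ∈ Icc (0:ℝ) 1, m ≤ v r t ∧ v r t ≤ M
  h_bd : ∀ t, 0 ≤ t → ∀ r ∈ Icc (0:ℝ) 1, ((N:ℝ) - 1) * eta η0 b t ≤ h r t ∧ h r t ≤ b ^ (1 / α)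
  sg_x : ∀ t, 0 ≤ t → ∀ ε > 0, ∃ C : ℝ, 0 ≤ C ∧ ∀ r r', 0 < r → r ≤ r' → r' ≤ 1 →
    |sg (s r' t) - sg (s r t) - (r' - r) * (h r t - ((N:ℝ) - 1) * (sg (s r t) / r))|
      ≤ (r' - r) * (ε + (C + C / r) * (r' - r))
  sg_lo : ∀ t, 0 ≤ t → ∀ r ∈ Icc (0:ℝ) 1, eta η0 b t * r ≤ sg (s r t)
  s_init : ∀ r ∈ Icc (0:ℝ) 1, s r 0 = s0 r
  u_init : u 0 0 = u00

open Set Filter Topology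

section
variable {N : ℕ} {α b κ η0 m M Cs u00 : ℝ} {s0 : ℝ → ℝ} {n0 : ℕ} {U V s h : ℕ → ℕ → ℝ → ℝ}

lemma Fam.s_bd (F : Fam N α b κ η0 m M Cs u00 s0 n0 U V s h) {n : ℕ} (hn : n0 ≤ n) {t : ℝ}
    (ht : t ∈ Icc (0:ℝ) n) {j : ℕ} (hj : j ≤ n) : 0 ≤ s n j t ∧ s n j t ≤ κ := by
  constructor
  · rw [← F.s_zero n hn t ht]; exact F.s_mono n hn t ht 0 j (Nat.zero_le _) hj
  · rw [← F.s_last n hn t ht]; exact F.s_mono n hn t ht j n hj le_rfl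

lemma Fam.npos (F : Fam N α b κ η0 m M Cs u00 s0 n0 U V s h) {n : ℕ} (hn : n0 ≤ n) : 0 < n := by
  have := F.n0_ge; omega

lemma Fam.U_x (F : Fam N α b κ η0 m M Cs u00 s0 n0 U V s h) (hCs : 0 < Cs) {n : ℕ} (hn : n0 ≤ n) {t : ℝ}
    (ht : t ∈ Icc (0:ℝ) n) {i j : ℕ} (hij : i ≤ j) (hj : j < n) :
    |U n j t - U n i t + ((j:ℝ) / n - (i:ℝ) / n) * s n i t|
      ≤ ((j:ℝ) / n - (i:ℝ) / n) * (Cs * ((j:ℝ) / n - (i:ℝ) / n)) := by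
  have hn0 : (0:ℝ) < n := by exact_mod_cast F.npos hn
  have := disc_deriv (fun l => U n l t) (F.npos hn) hij (- s n i t) (Cs * ((j:ℝ) / n - (i:ℝ) / n)) ?_
  · rw [mul_neg, sub_neg_eq_add] at this; exact this
  · intro l h1 h2
    have e := F.U_step n hn t ht l (by omega)
    rw [e, show (n:ℝ) * (U n l t - s n (l + 1) t / n - U n l t) - -s n i t = -(s n (l + 1) t - s n i t) by
      field_simp; ring, abs_neg, abs_of_nonneg (by linarith [F.s_mono n hn t ht i (l+1) (by omega) (by omega)])]
    refine (F.s_lip n hn t ht i (l+1) (by omega) (by omega)).trans ?_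
    have : ((l + 1 : ℕ) : ℝ) / n ≤ (j:ℝ) / n := by
      apply div_le_div_of_nonneg_right _ hn0.le; exact_mod_cast h2
    exact mul_le_mul_of_nonneg_left (by linarith) hCs.le

lemma Fam.U_t (F : Fam N α b κ η0 m M Cs u00 s0 n0 U V s h) {n : ℕ} (hn : n0 ≤ n) {t t' : ℝ}
    (ht : t ∈ Icc (0:ℝ) n) (ht' : t' ∈ Icc (0:ℝ) n) {j : ℕ} (hj : j < n) {A E : ℝ}
    (hE : ∀ τ ∈ uIcc t t', |V n j τ - A| ≤ E) :
    |U n j t' - U n j t - (t' - t) * A| ≤ |t' - t| * E := by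
  have hsub : uIcc t t' ⊆ Icc (0:ℝ) n := (convex_Icc (0:ℝ) (n:ℝ)).ordConnected.uIcc_subset ht ht'
  have := (convex_uIcc t t').norm_image_sub_le_of_norm_hasDerivWithin_le
    (f := fun τ => U n j τ - τ * A) (f' := fun τ => V n j τ - A) (C := E) (x := t) (y := t')
    (fun τ hτ => by
      have h1 := (F.U_der n hn τ (hsub hτ) j hj).mono hsub
      have h2 : HasDerivWithinAt (fun τ : ℝ => τ * A) (1 * A) (uIcc t t') τ := (hasDerivWithinAt_id τ _).mul_const A
      rw [one_mul] at h2
      exact h1.sub h2)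
    (fun τ hτ => by rw [Real.norm_eq_abs]; exact hE τ hτ) left_mem_uIcc right_mem_uIcc
  rw [Real.norm_eq_abs, Real.norm_eq_abs] at this
  rw [mul_comm _ E]
  convert this using 2
  ring

/-- discrete modulus of `h` in space -/
lemma Fam.h_mod (F : Fam N α b κ η0 m M Cs u00 s0 n0 U V s h) (hN : 1 < N) (hα : 0 < α) (hb : 0 < b)
    (hη0 : 0 < η0) (hm : 0 < m) (hM : 0 ≤ M) (hCs : 0 < Cs) {t : ℝ} (ht0 : 0 ≤ t) {ε : ℝ} (hε : 0 < ε) :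
    ∃ C : ℝ, 0 ≤ C ∧ ∀ n, n0 ≤ n → t ≤ (n:ℝ) → ∀ i j, i ≤ j → j < n →
      |h n j t - h n i t| ≤ ε + C * ((j:ℝ) / n - (i:ℝ) / n) := by
  have hN2 : (2:ℝ) ≤ N := by exact_mod_cast hN
  have he := eta_pos hη0 hb ht0
  have hlo : 0 < (((N:ℝ) - 1) * eta η0 b t) ^ α := Real.rpow_pos_of_pos (mul_pos (by linarith) he) _
  obtain ⟨K, hK, hKl⟩ := rpow_lipschitz (a := 1 / α) (hi := b) hlo
  obtain ⟨C, hC, hCm⟩ := F.modx t ht0 (ε / (K + 1)) (by positivity)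
  refine ⟨K * (C + M * Cs), by positivity, ?_⟩
  intro n hn htn i j hij hj
  have ht : t ∈ Icc (0:ℝ) n := ⟨ht0, htn⟩
  have hn0 : (0:ℝ) < n := by exact_mod_cast F.npos hn
  have hd : 0 ≤ (j:ℝ) / n - (i:ℝ) / n := by
    have : (i:ℝ) / n ≤ (j:ℝ) / n := div_le_div_of_nonneg_right (by exact_mod_cast hij) hn0.le
    linarith
  have hmem : ∀ l, l < n → b - V n l t / wf (s n l t) ∈ Icc ((((N:ℝ) - 1) * eta η0 b t) ^ α) b := by
    intro l hl
    have e := F.V_eq n hn t ht l hl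
    have hb' := F.h_bd n hn t ht l hl
    have : b - V n l t / wf (s n l t) = h n l t ^ α := by
      rw [e]; field_simp [(wf_pos (s n l t)).ne']; ring
    have h0 : 0 ≤ ((N:ℝ) - 1) * eta η0 b t := by have : 0 ≤ (N:ℝ) - 1 := by linarith
                                                 positivity
    constructor
    · rw [this]; exact Real.rpow_le_rpow h0 hb'.1 hα.le
    · have := div_nonneg (hm.le.trans (F.V_bd n hn t ht l hl).1) (wf_pos (s n l t)).le
      linarith
  have hi : i < n := by omega
  rw [F.h_eq n hn t ht j hj, F.h_eq n hn t ht i hi]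
  refine (hKl _ (hmem j hj) _ (hmem i hi)).trans ?_
  have hV := hCm n hn htn t ⟨ht0, le_rfl⟩ j i hj hi
  rw [abs_of_nonneg hd] at hV
  have hw := abs_wf_sub_le (s n i t) (s n j t)
  rw [abs_sub_comm (s n i t), abs_of_nonneg (by linarith [F.s_mono n hn t ht i j hij hj.le] : 0 ≤ s n j t - s n i t)] at hw
  have hs := F.s_lip n hn t ht i j hij hj.le
  have key : |b - V n j t / wf (s n j t) - (b - V n i t / wf (s n i t))|
      ≤ |V n j t - V n i t| + M * |wf (s n i t) - wf (s n j t)| := by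
    have w1 := one_le_wf (s n i t)
    have w2 := one_le_wf (s n j t)
    set a := wf (s n i t)
    set c := wf (s n j t)
    have ha : 0 < a := by linarith
    have hc : 0 < c := by linarith
    have e : b - V n j t / c - (b - V n i t / a)
      = -((V n j t - V n i t) / c) - V n i t * (a - c) / (a * c) := by
      field_simp; ring
    rw [e]
    refine (abs_sub _ _).trans (add_le_add ?_ ?_)
    · rw [abs_neg, abs_div, abs_of_pos hc]; exact div_le_self (abs_nonneg _) w2
    · rw [abs_div, abs_mul, abs_of_pos (mul_pos ha hc)]
      have hv := F.V_bd n hn t ht i hi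
      rw [abs_of_pos (hm.trans_le hv.1)]
      refine (div_le_self (by have := hm.trans_le hv.1; positivity) (by nlinarith)).trans ?_
      exact mul_le_mul_of_nonneg_right hv.2 (abs_nonneg _)
  have hKe : K * (ε / (K + 1)) ≤ ε := by
    rw [mul_div_assoc', div_le_iff₀ (by linarith)]; nlinarith
  calc K * _ ≤ K * (ε / (K + 1) + C * ((j:ℝ) / n - (i:ℝ) / n) + M * (Cs * ((j:ℝ) / n - (i:ℝ) / n))) := by
        apply mul_le_mul_of_nonneg_left _ hK
        refine key.trans (add_le_add hV (mul_le_mul_of_nonneg_left (hw.trans hs) hM))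
    _ = K * (ε / (K + 1)) + K * (C + M * Cs) * ((j:ℝ) / n - (i:ℝ) / n) := by ring
    _ ≤ _ := by linarith

lemma Fam.sg_x (F : Fam N α b κ η0 m M Cs u00 s0 n0 U V s h) (hN : 1 < N) (hα : 0 < α) (hb : 0 < b)
    (hη0 : 0 < η0) (hm : 0 < m) (hM : 0 ≤ M) (hCs : 0 < Cs) {t : ℝ} (ht0 : 0 ≤ t) {ε : ℝ} (hε : 0 < ε) :
    ∃ C : ℝ, 0 ≤ C ∧ ∀ n, n0 ≤ n → t ≤ (n:ℝ) → ∀ i j, 0 < i → i ≤ j → j < n →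
      |sg (s n j t) - sg (s n i t) - ((j:ℝ) / n - (i:ℝ) / n) * (h n i t - ((N:ℝ) - 1) * (sg (s n i t) / ((i:ℝ) / n)))|
      ≤ ((j:ℝ) / n - (i:ℝ) / n) * (ε + (C + C / ((i:ℝ) / n)) * ((j:ℝ) / n - (i:ℝ) / n)) := by
  have hN2 : (2:ℝ) ≤ N := by exact_mod_cast hN
  obtain ⟨C, hC, hCm⟩ := F.h_mod hN hα hb hη0 hm hM hCs ht0 hε
  have hN1 : 0 ≤ (N:ℝ) - 1 := by linarith
  set C2 := C + 2 * ((N:ℝ) - 1) * Cs with hC2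
  have hC20 : 2 * ((N:ℝ) - 1) * Cs ≤ C2 := by linarith
  refine ⟨C2, by positivity, ?_⟩
  intro n hn htn i j hi0 hij hj
  have ht : t ∈ Icc (0:ℝ) n := ⟨ht0, htn⟩
  have hn0 : (0:ℝ) < n := by exact_mod_cast F.npos hn
  apply disc_deriv (fun l => sg (s n l t)) (F.npos hn) hij
  intro l h1 h2
  rw [F.sg_step n hn t ht l (by omega)]
  have hl := hCm n hn htn i l h1 (by omega)
  have ri : 0 < (i:ℝ) / n := by have : (0:ℝ) < i := by exact_mod_cast hi0
                                positivity
  have hr1 : (i:ℝ) / n ≤ (l:ℝ) / n := div_le_div_of_nonneg_right (by exact_mod_cast h1) hn0.le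
  have hr2 : ((l + 1 : ℕ) : ℝ) / n ≤ (j:ℝ) / n := div_le_div_of_nonneg_right (by exact_mod_cast h2) hn0.le
  have hr3 : (l:ℝ) / n ≤ ((l + 1 : ℕ) : ℝ) / n := div_le_div_of_nonneg_right (by push_cast; linarith) hn0.le
  have hs1 := F.s_lip n hn t ht i (l + 1) (by omega) (by omega)
  have hs2 := F.s_mono n hn t ht i (l + 1) (by omega) (by omega)
  have hs3 := F.s_lip n hn t ht 0 i (by omega) (by omega)
  have hs4 := (F.s_bd hn ht (by omega : i ≤ n)).1
  rw [F.s_zero n hn t ht] at hs3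
  have hg1 : sg (s n (l+1) t) - sg (s n i t) ≤ Cs * (((l + 1 : ℕ) : ℝ) / n - (i:ℝ) / n) := (sg_sub_le hs2).trans hs1
  have hg2 : 0 ≤ sg (s n (l+1) t) - sg (s n i t) := by linarith [sg_mono hs2]
  have hg3 : sg (s n i t) ≤ Cs * ((i:ℝ) / n) := (sg_le_self hs4).trans (by simpa using hs3)
  have hg4 : 0 ≤ sg (s n i t) := sg_nonneg hs4
  set x := (i:ℝ) / n
  set y := ((l + 1 : ℕ) : ℝ) / n
  set z := (j:ℝ) / n
  set A := sg (s n i t)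
  set B := sg (s n (l+1) t)
  have hxy : x ≤ y := hr1.trans hr3
  have hy : 0 < y := by linarith
  have e : (n:ℝ) * (1 / n * (h n l t - ((N:ℝ) - 1) * (B / y))) - (h n i t - ((N:ℝ) - 1) * (A / x))
      = (h n l t - h n i t) - ((N:ℝ) - 1) * ((B - A) / y - A * (y - x) / (x * y)) := by
    field_simp; ring
  rw [e]
  have k1 : |(B - A) / y - A * (y - x) / (x * y)| ≤ 2 * Cs * (z - x) / x := by
    have a1 : (B - A) / y ≤ Cs * (z - x) / x := by
      apply div_le_div₀ (mul_nonneg hCs.le (by linarith)) _ ri hxy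
      exact hg1.trans (mul_le_mul_of_nonneg_left (by linarith) hCs.le)
    have a2 : A * (y - x) / (x * y) ≤ Cs * (z - x) / x := by
      rw [mul_comm x y, ← div_div]
      apply div_le_div₀ (mul_nonneg hCs.le (by linarith)) _ ri le_rfl
      rw [div_le_iff₀ hy]
      calc A * (y - x) ≤ (Cs * y) * (z - x) := by
            apply mul_le_mul _ (by linarith) (by linarith) (by positivity)
            exact hg3.trans (mul_le_mul_of_nonneg_left hxy hCs.le)
        _ = _ := by ring
    have a3 : 0 ≤ (B - A) / y := div_nonneg hg2 hy.le
    have a4 : 0 ≤ A * (y - x) / (x * y) := by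
      have : 0 ≤ y - x := by linarith
      positivity
    rw [show 2 * Cs * (z - x) / x = Cs * (z - x) / x + Cs * (z - x) / x by ring, abs_le]
    constructor <;> linarith
  refine (abs_sub _ _).trans ?_
  rw [abs_mul, abs_of_nonneg hN1]
  have k2 := mul_le_mul_of_nonneg_left k1 hN1
  have hzx : 0 ≤ z - x := by linarith
  calc _ ≤ (ε + C * (z - x)) + ((N:ℝ) - 1) * (2 * Cs * (z - x) / x) :=
        add_le_add (hl.trans (by
          have := mul_le_mul_of_nonneg_left (by linarith : (l:ℝ) / n - x ≤ z - x) hC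
          linarith)) k2
    _ = ε + (C * (z - x) + (2 * ((N:ℝ) - 1) * Cs / x) * (z - x)) := by ring
    _ ≤ ε + (C2 * (z - x) + (C2 / x) * (z - x)) := by
        have b1 : C * (z - x) ≤ C2 * (z - x) := mul_le_mul_of_nonneg_right (by
          have : 0 ≤ 2 * ((N:ℝ) - 1) * Cs := by positivity
          linarith) hzx
        have b2 : (2 * ((N:ℝ) - 1) * Cs / x) * (z - x) ≤ (C2 / x) * (z - x) :=
          mul_le_mul_of_nonneg_right (div_le_div_of_nonneg_right hC20 ri.le) hzx
        linarith
    _ = _ := by ring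

end

open Set Filter Topology

lemma lim_exists {N : ℕ} {α b κ η0 m M Cs u00 : ℝ} {s0 : ℝ → ℝ} {n0 : ℕ} {U V s h : ℕ → ℕ → ℝ → ℝ}
    (F : Fam N α b κ η0 m M Cs u00 s0 n0 U V s h) (hN : 1 < N) (hα : 0 < α) (hb : 0 < b) (hκ : 0 < κ)
    (hη0 : 0 < η0) (hm : 0 < m) (hCs : 0 < Cs) (hs0 : ContinuousOn s0 (Icc 0 1)) :
    ∃ u v sl hl : ℝ → ℝ → ℝ, Lim N α b κ η0 m M Cs u00 s0 u v sl hl := by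
  have hev : ∀ T : ℝ, ∀ᶠ n : ℕ in atTop, n0 ≤ n ∧ T ≤ (n:ℝ) := fun T =>
    (eventually_ge_atTop n0).and (tendsto_natCast_atTop_atTop.eventually_ge_atTop T)
  have hM : 0 ≤ M := by
    have h1 := F.V_bd n0 le_rfl 0 ⟨le_rfl, Nat.cast_nonneg _⟩ 0 (F.npos le_rfl)
    linarith [h1.1.trans h1.2]
  have hVa : ∀ n, n0 ≤ n → ∀ t ∈ Icc (0:ℝ) n, ∀ j, j < n → |V n j t| ≤ M := by
    intro n hn t ht j hj
    have h1 := F.V_bd n hn t ht j hj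
    rw [abs_of_pos (hm.trans_le h1.1)]; exact h1.2
  have exs : ∀ r t : ℝ, ∃ L, 0 ≤ t → Tendsto (fun n => s n (Jx r n) t) (hyperfilter ℕ : Filter ℕ) (𝓝 L) := by
    intro r t
    by_cases ht : 0 ≤ t
    · obtain ⟨L, hL⟩ := ulim_exists (fun n => s n (Jx r n) t) κ (by
        filter_upwards [hev t] with n hn
        have := F.s_bd hn.1 ⟨ht, hn.2⟩ (Jx_lt r (F.npos hn.1)).le
        rw [abs_of_nonneg this.1]; exact this.2)
      exact ⟨L, fun _ => hL⟩
    · exact ⟨0, fun h => absurd h ht⟩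
  have exv : ∀ r t : ℝ, ∃ L, 0 ≤ t → Tendsto (fun n => V n (Jx r n) t) (hyperfilter ℕ : Filter ℕ) (𝓝 L) := by
    intro r t
    by_cases ht : 0 ≤ t
    · obtain ⟨L, hL⟩ := ulim_exists (fun n => V n (Jx r n) t) M (by
        filter_upwards [hev t] with n hn
        exact hVa n hn.1 t ⟨ht, hn.2⟩ _ (Jx_lt r (F.npos hn.1)))
      exact ⟨L, fun _ => hL⟩
    · exact ⟨0, fun h => absurd h ht⟩
  have exu : ∀ r t : ℝ, ∃ L, 0 ≤ t → Tendsto (fun n => U n (Jx r n) t) (hyperfilter ℕ : Filter ℕ) (𝓝 L) := by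
    intro r t
    by_cases ht : 0 ≤ t
    · obtain ⟨L, hL⟩ := ulim_exists (fun n => U n (Jx r n) t) (|u00| + t * M + Cs) (by
        filter_upwards [hev t] with n hn
        have hm1 : t ∈ Icc (0:ℝ) n := ⟨ht, hn.2⟩
        have hm0 : (0:ℝ) ∈ Icc (0:ℝ) n := ⟨le_rfl, Nat.cast_nonneg _⟩
        have hj := Jx_lt r (F.npos hn.1)
        have h1 := F.U_x hCs hn.1 hm1 (Nat.zero_le _) hj
        have h2 := F.U_t hn.1 hm0 hm1 (F.npos hn.1) (A := 0) (E := M) (fun τ hτ => by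
          rw [sub_zero]
          exact hVa n hn.1 τ ((convex_Icc (0:ℝ) (n:ℝ)).ordConnected.uIcc_subset hm0 hm1 hτ) 0 (F.npos hn.1))
        rw [F.s_zero n hn.1 t hm1] at h1
        rw [F.U_init n hn.1, mul_zero, sub_zero, sub_zero, abs_of_nonneg ht] at h2
        rw [mul_zero, add_zero, Nat.cast_zero, zero_div, sub_zero] at h1
        have hf := frac_mem hj.le (F.npos hn.1)
        have h3 : (Jx r n : ℝ) / n * (Cs * ((Jx r n : ℝ) / n)) ≤ Cs := by
          have a1 : Cs * ((Jx r n : ℝ) / n) ≤ Cs := mul_le_of_le_one_right hCs.le hf.2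
          exact (mul_le_of_le_one_left (mul_nonneg hCs.le hf.1) hf.2).trans a1
        have h4 := abs_le.1 h1
        have h5 := abs_le.1 h2
        rw [abs_le]
        constructor <;> linarith [le_abs_self u00, neg_abs_le u00])
      exact ⟨L, fun _ => hL⟩
    · exact ⟨0, fun h => absurd h ht⟩
  choose sl hsl using exs
  choose v hv using exv
  choose u hu using exu
  have hJ : ∀ r ∈ Icc (0:ℝ) 1, Tendsto (fun n : ℕ => (Jx r n : ℝ) / n) (hyperfilter ℕ : Filter ℕ) (𝓝 r) :=
    fun r hr => (Jx_tendsto hr).mono_left hyp_le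
  have hev' : ∀ T : ℝ, ∀ᶠ n in (hyperfilter ℕ : Filter ℕ), n0 ≤ n ∧ T ≤ (n:ℝ) := fun T => (hev T).filter_mono hyp_le
  have hh : ∀ t, 0 ≤ t → ∀ r ∈ Icc (0:ℝ) 1, Tendsto (fun n => h n (Jx r n) t) (hyperfilter ℕ : Filter ℕ)
      (𝓝 ((b - v r t / wf (sl r t)) ^ (1 / α))) := by
    intro t ht r hr
    have h1 : Tendsto (fun n => (b - V n (Jx r n) t / wf (s n (Jx r n) t)) ^ (1 / α)) (hyperfilter ℕ : Filter ℕ)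
      (𝓝 ((b - v r t / wf (sl r t)) ^ (1 / α))) := by
      apply Tendsto.rpow_const
      · exact tendsto_const_nhds.sub ((hv r t ht).div ((continuous_wf.tendsto _).comp (hsl r t ht)) (wf_pos _).ne')
      · right; positivity
    refine h1.congr' ?_
    filter_upwards [hev' t] with n hn
    exact (F.h_eq n hn.1 t ⟨ht, hn.2⟩ _ (Jx_lt r (F.npos hn.1))).symm
  have hsgl : ∀ t, 0 ≤ t → ∀ r, Tendsto (fun n => sg (s n (Jx r n) t)) (hyperfilter ℕ : Filter ℕ) (𝓝 (sg (sl r t))) :=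
    fun t ht r => (continuous_sg.tendsto _).comp (hsl r t ht)
  refine ⟨u, v, sl, fun r t => (b - v r t / wf (sl r t)) ^ (1 / α), ?_, ?_, ?_, ?_, ?_, ?_, ?_, ?_, ?_, ?_, ?_, ?_, ?_, ?_, ?_⟩
  · -- s_zero
    intro t ht
    refine tendsto_nhds_unique (hsl 0 t ht) (tendsto_const_nhds.congr' ?_)
    filter_upwards [hev' t] with n hn
    rw [Jx_zero, F.s_zero n hn.1 t ⟨ht, hn.2⟩]
  · -- s_one
    intro t ht
    have h1 : Tendsto (fun n : ℕ => κ - Cs * (1 - (Jx 1 n : ℝ) / n)) (hyperfilter ℕ : Filter ℕ) (𝓝 (κ - Cs * (1 - 1))) :=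
      tendsto_const_nhds.sub (tendsto_const_nhds.mul (tendsto_const_nhds.sub (hJ 1 ⟨zero_le_one, le_rfl⟩)))
    rw [sub_self, mul_zero, sub_zero] at h1
    refine le_antisymm (le_of_tendsto (hsl 1 t ht) ?_) (le_of_tendsto_of_tendsto h1 (hsl 1 t ht) ?_)
    · filter_upwards [hev' t] with n hn
      exact (F.s_bd hn.1 ⟨ht, hn.2⟩ (Jx_lt 1 (F.npos hn.1)).le).2
    · filter_upwards [hev' t] with n hn
      have h2 := F.s_lip n hn.1 t ⟨ht, hn.2⟩ (Jx 1 n) n (Jx_lt 1 (F.npos hn.1)).le le_rfl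
      rw [F.s_last n hn.1 t ⟨ht, hn.2⟩, div_self (by exact_mod_cast (F.npos hn.1).ne')] at h2
      linarith
  · -- s_mono
    intro t ht r r' h0 hr h1
    refine le_of_tendsto_of_tendsto (hsl r t ht) (hsl r' t ht) ?_
    filter_upwards [hev' t] with n hn
    exact F.s_mono n hn.1 t ⟨ht, hn.2⟩ _ _ (Jx_mono hr n) (Jx_lt r' (F.npos hn.1)).le
  · -- s_lip
    intro t ht r r' h0 hr h1
    refine le_of_tendsto_of_tendsto ((hsl r' t ht).sub (hsl r t ht))
      (tendsto_const_nhds.mul ((hJ r' ⟨h0.trans hr, h1⟩).sub (hJ r ⟨h0, hr.trans h1⟩))) ?_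
    filter_upwards [hev' t] with n hn
    exact F.s_lip n hn.1 t ⟨ht, hn.2⟩ _ _ (Jx_mono hr n) (Jx_lt r' (F.npos hn.1)).le
  · -- u_x
    intro t ht r r' h0 hr h1
    have hd := (hJ r' ⟨h0.trans hr, h1⟩).sub (hJ r ⟨h0, hr.trans h1⟩)
    refine le_of_tendsto_of_tendsto (((hu r' t ht).sub (hu r t ht)).add (hd.mul (hsl r t ht))).abs
      (hd.mul (tendsto_const_nhds.mul hd)) ?_
    filter_upwards [hev' t] with n hn
    exact F.U_x hCs hn.1 ⟨ht, hn.2⟩ (Jx_mono hr n) (Jx_lt r' (F.npos hn.1))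
  · -- u_t
    intro T hT ε hε
    obtain ⟨C, hC, hCm⟩ := F.modt T hT ε hε
    refine ⟨C, hC, ?_⟩
    intro t ht t' ht' r hr
    refine le_of_tendsto (((hu r t' ht'.1).sub (hu r t ht.1)).sub (tendsto_const_nhds.mul (hv r t ht.1))).abs ?_
    filter_upwards [hev' T] with n hn
    refine F.U_t hn.1 ⟨ht.1, ht.2.trans hn.2⟩ ⟨ht'.1, ht'.2.trans hn.2⟩ (Jx_lt r (F.npos hn.1)) ?_
    intro τ hτ
    refine (hCm n hn.1 hn.2 t ht τ ((convex_Icc (0:ℝ) T).ordConnected.uIcc_subset ht ht' hτ) _ (Jx_lt r (F.npos hn.1))).trans ?_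
    have := abs_sub_left_of_mem_uIcc hτ
    have := mul_le_mul_of_nonneg_left this hC
    linarith
  · -- v_mod
    intro T hT ε hε
    obtain ⟨C, hC, hCm⟩ := F.modt T hT (ε / 2) (by positivity)
    obtain ⟨C', hC', hCm'⟩ := F.modx T hT (ε / 2) (by positivity)
    refine ⟨C + C', by positivity, ?_⟩
    intro t ht t' ht' r hr r' hr'
    have h1 : |v r' t' - v r t| ≤ (ε / 2 + C * |t' - t|) + (ε / 2 + C' * |r' - r|) := by
      refine le_of_tendsto_of_tendsto ((hv r' t' ht'.1).sub (hv r t ht.1)).abs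
        (tendsto_const_nhds.add (tendsto_const_nhds.add (tendsto_const_nhds.mul ((hJ r' hr').sub (hJ r hr)).abs))) ?_
      filter_upwards [hev' T] with n hn
      have a1 := hCm n hn.1 hn.2 t ht t' ht' _ (Jx_lt r' (F.npos hn.1))
      have a2 := hCm' n hn.1 hn.2 t ht _ _ (Jx_lt r' (F.npos hn.1)) (Jx_lt r (F.npos hn.1))
      have := abs_add_le (V n (Jx r' n) t' - V n (Jx r' n) t) (V n (Jx r' n) t - V n (Jx r n) t)
      rw [sub_add_sub_cancel] at this
      linarith
    have := mul_nonneg hC (abs_nonneg (r' - r))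
    have := mul_nonneg hC' (abs_nonneg (t' - t))
    linarith
  · intro t ht r hr; rfl
  · -- v_eq
    intro t ht r hr
    have h1 := ((tendsto_const_nhds (x := b)).sub ((hh t ht r hr).rpow_const (p := α) (Or.inr hα.le))).mul
      ((continuous_wf.tendsto _).comp (hsl r t ht))
    refine tendsto_nhds_unique (hv r t ht) (h1.congr' ?_)
    filter_upwards [hev' t] with n hn
    exact (F.V_eq n hn.1 t ⟨ht, hn.2⟩ _ (Jx_lt r (F.npos hn.1))).symm
  · -- v_bd
    intro t ht r hr
    constructor
    · refine ge_of_tendsto (hv r t ht) ?_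
      filter_upwards [hev' t] with n hn using (F.V_bd n hn.1 t ⟨ht, hn.2⟩ _ (Jx_lt r (F.npos hn.1))).1
    · refine le_of_tendsto (hv r t ht) ?_
      filter_upwards [hev' t] with n hn using (F.V_bd n hn.1 t ⟨ht, hn.2⟩ _ (Jx_lt r (F.npos hn.1))).2
  · -- h_bd
    intro t ht r hr
    constructor
    · refine ge_of_tendsto (hh t ht r hr) ?_
      filter_upwards [hev' t] with n hn using (F.h_bd n hn.1 t ⟨ht, hn.2⟩ _ (Jx_lt r (F.npos hn.1))).1
    · refine le_of_tendsto (hh t ht r hr) ?_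
      filter_upwards [hev' t] with n hn using (F.h_bd n hn.1 t ⟨ht, hn.2⟩ _ (Jx_lt r (F.npos hn.1))).2
  · -- sg_x
    intro t ht ε hε
    obtain ⟨C, hC, hCm⟩ := F.sg_x hN hα hb hη0 hm hM hCs ht hε
    refine ⟨C, hC, ?_⟩
    intro r r' h0 hr h1
    have hrm : r ∈ Icc (0:ℝ) 1 := ⟨h0.le, hr.trans h1⟩
    have hd := (hJ r' ⟨h0.le.trans hr, h1⟩).sub (hJ r hrm)
    refine le_of_tendsto_of_tendsto (((hsgl t ht r').sub (hsgl t ht r)).sub (hd.mul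
      ((hh t ht r hrm).sub (tendsto_const_nhds.mul ((hsgl t ht r).div (hJ r hrm) h0.ne'))))).abs
      (hd.mul (tendsto_const_nhds.add ((tendsto_const_nhds.add (tendsto_const_nhds.div (hJ r hrm) h0.ne')).mul hd))) ?_
    filter_upwards [hev' t, (hJ r hrm).eventually (eventually_gt_nhds h0)] with n hn hp
    refine hCm n hn.1 hn.2 _ _ ?_ (Jx_mono hr n) (Jx_lt r' (F.npos hn.1))
    rcases Nat.eq_zero_or_pos (Jx r n) with h | h
    · rw [h] at hp; simp at hp
    · exact h
  · -- sg_lo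
    intro t ht r hr
    refine le_of_tendsto_of_tendsto (tendsto_const_nhds.mul (hJ r hr)) (hsgl t ht r) ?_
    filter_upwards [hev' t] with n hn
    exact F.sg_lo n hn.1 t ⟨ht, hn.2⟩ _ (Jx_lt r (F.npos hn.1)).le
  · -- s_init
    intro r hr
    have h1 : Tendsto (fun n : ℕ => s0 ((Jx r n : ℝ) / n)) (hyperfilter ℕ : Filter ℕ) (𝓝 (s0 r)) := by
      refine (hs0 r hr).tendsto.comp (tendsto_nhdsWithin_iff.2 ⟨hJ r hr, ?_⟩)
      filter_upwards [hev' 0] with n hn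
      exact frac_mem (Jx_lt r (F.npos hn.1)).le (F.npos hn.1)
    refine tendsto_nhds_unique (hsl r 0 le_rfl) (h1.congr' ?_)
    filter_upwards [hev' 0] with n hn
    exact (F.s_init n hn.1 _ (Jx_lt r (F.npos hn.1)).le).symm
  · refine tendsto_nhds_unique (hu 0 0 le_rfl) (tendsto_const_nhds.congr' ?_)
    filter_upwards [hev' 0] with n hn
    rw [Jx_zero, F.U_init n hn.1]

open Set Filter Topology

lemma hd_of_est {f : ℝ → ℝ} {A x : ℝ} {S : Set ℝ}
    (h : ∀ ε > 0, ∃ δ > 0, ∀ y ∈ S, |y - x| < δ → |f y - f x - (y - x) * A| ≤ ε * |y - x|) :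
    HasDerivWithinAt f A S x := by
  rw [hasDerivWithinAt_iff_isLittleO, Asymptotics.isLittleO_iff]
  intro c hc
  obtain ⟨δ, hδ, H⟩ := h c hc
  rw [eventually_nhdsWithin_iff]
  filter_upwards [Metric.ball_mem_nhds x hδ] with y hy hyS
  rw [Metric.mem_ball, Real.dist_eq] at hy
  simpa [smul_eq_mul] using H y hyS hy

lemma cont_of_est {f : ℝ → ℝ → ℝ} {S : Set (ℝ × ℝ)} {r t : ℝ}
    (h : ∀ ε > 0, ∃ δ > 0, ∀ r' t', (r', t') ∈ S → |r' - r| < δ → |t' - t| < δ → |f r' t' - f r t| < ε) :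
    ContinuousWithinAt (fun p : ℝ × ℝ => f p.1 p.2) S (r, t) := by
  rw [Metric.continuousWithinAt_iff]
  intro ε hε
  obtain ⟨δ, hδ, H⟩ := h ε hε
  refine ⟨δ, hδ, ?_⟩
  rintro ⟨r', t'⟩ hm hd
  rw [Prod.dist_eq, max_lt_iff, Real.dist_eq, Real.dist_eq] at hd
  rw [Real.dist_eq]
  exact H r' t' hm hd.1 hd.2

lemma est_of_cont {f : ℝ → ℝ → ℝ} {S : Set (ℝ × ℝ)} {r t : ℝ}
    (hc : ContinuousWithinAt (fun p : ℝ × ℝ => f p.1 p.2) S (r, t)) :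
    ∀ ε > 0, ∃ δ > 0, ∀ r' t', (r', t') ∈ S → |r' - r| < δ → |t' - t| < δ → |f r' t' - f r t| < ε := by
  intro ε hε
  rw [Metric.continuousWithinAt_iff] at hc
  obtain ⟨δ, hδ, H⟩ := hc ε hε
  refine ⟨δ, hδ, ?_⟩
  intro r' t' hm h1 h2
  have := H hm (by rw [Prod.dist_eq, max_lt_iff, Real.dist_eq, Real.dist_eq]; exact ⟨h1, h2⟩)
  rwa [Real.dist_eq] at this

/-- comparison for the singular linear ODE -/
lemma ode_upper {N : ℕ} (hN : 1 < N) {σ H : ℝ → ℝ} {ρ B : ℝ} (hc : ContinuousOn σ (Icc 0 ρ)) (h0 : σ 0 = 0)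
    (hd : ∀ r ∈ Ioo 0 ρ, HasDerivAt σ (H r - ((N:ℝ) - 1) * (σ r / r)) r) (hB : ∀ r ∈ Ioo 0 ρ, H r ≤ B) :
    ∀ r ∈ Icc 0 ρ, (N:ℝ) * σ r ≤ B * r := by
  have hN0 : (0:ℝ) < N := by exact_mod_cast (by omega : 0 < N)
  set f : ℝ → ℝ := fun r => r ^ (N - 1) * ((N:ℝ) * σ r - B * r) with hf
  have hder : ∀ r ∈ Ioo 0 ρ, HasDerivAt f (r ^ (N - 1) * (N * (H r - B))) r := by
    intro r hr
    have h1 := (hasDerivAt_pow (N - 1) r).mul (((hd r hr).const_mul (N:ℝ)).sub ((hasDerivAt_id r).const_mul B))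
    refine h1.congr_deriv ?_
    obtain ⟨K, rfl⟩ : ∃ K, N = K + 2 := ⟨N - 2, by omega⟩
    have hr0 : r ≠ 0 := hr.1.ne'
    simp only [show K + 2 - 1 = K + 1 by omega, Nat.add_sub_cancel, id]
    push_cast
    rw [pow_succ]
    simp only [Pi.sub_apply]
    field_simp
    ring
  have hanti : AntitoneOn f (Icc 0 ρ) := by
    apply antitoneOn_of_deriv_nonpos (convex_Icc 0 ρ)
    · exact ((continuous_pow (N - 1)).continuousOn).mul ((continuousOn_const.mul hc).sub (continuous_const.mul continuous_id).continuousOn)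
    · rw [interior_Icc]; intro r hr; exact (hder r hr).differentiableAt.differentiableWithinAt
    · rw [interior_Icc]; intro r hr
      rw [(hder r hr).deriv]
      have := hB r hr
      have h2 : (N:ℝ) * (H r - B) ≤ 0 := mul_nonpos_of_nonneg_of_nonpos hN0.le (by linarith)
      exact mul_nonpos_of_nonneg_of_nonpos (pow_nonneg hr.1.le _) h2
  intro r hr
  rcases hr.1.eq_or_lt with h | h
  · rw [← h, h0]; simp
  · have h1 := hanti ⟨le_rfl, hr.1.trans hr.2⟩ hr hr.1
    simp only [hf] at h1
    rw [zero_pow (by omega : N - 1 ≠ 0), zero_mul] at h1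
    have := nonpos_of_mul_nonpos_right h1 (pow_pos h _)
    linarith

lemma ode_lower {N : ℕ} (hN : 1 < N) {σ H : ℝ → ℝ} {ρ A : ℝ} (hc : ContinuousOn σ (Icc 0 ρ)) (h0 : σ 0 = 0)
    (hd : ∀ r ∈ Ioo 0 ρ, HasDerivAt σ (H r - ((N:ℝ) - 1) * (σ r / r)) r) (hA : ∀ r ∈ Ioo 0 ρ, A ≤ H r) :
    ∀ r ∈ Icc 0 ρ, A * r ≤ (N:ℝ) * σ r := by
  intro r hr
  have := ode_upper hN (σ := fun r => - σ r) (H := fun r => - H r) (B := -A) hc.neg (by simp [h0])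
    (fun r hr => (hd r hr).neg.congr_deriv (by ring)) (fun r hr => by linarith [hA r hr]) r hr
  linarith

noncomputable def sgInv (y : ℝ) : ℝ := y / √(1 - y ^ 2)

lemma one_sub_sg_sq (s : ℝ) : √(1 - sg s ^ 2) = 1 / wf s := by
  have hw := wf_pos s
  rw [show 1 - sg s ^ 2 = (1 / wf s) ^ 2 by
    rw [sg, div_pow, div_pow, wf_sq]; have : (1 + s ^ 2) ≠ 0 := by positivity
    field_simp; ring]
  exact Real.sqrt_sq (by positivity)

lemma sgInv_sg (s : ℝ) : sgInv (sg s) = s := by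
  rw [sgInv, one_sub_sg_sq, div_div_eq_mul_div, div_one, sg_mul_wf]

lemma hasDerivAt_sgInv (s : ℝ) : HasDerivAt sgInv (wf s ^ 3) (sg s) := by
  have hw := wf_pos s
  have hpos : 0 < 1 - sg s ^ 2 := by
    have := abs_lt.1 (abs_sg_lt s); nlinarith
  have h1 : HasDerivAt (fun y : ℝ => 1 - y ^ 2) (-(2 * sg s)) (sg s) :=
    ((hasDerivAt_pow 2 (sg s)).const_sub 1).congr_deriv (by simp)
  have h2 := (hasDerivAt_id (sg s)).div (h1.sqrt hpos.ne') (Real.sqrt_pos.2 hpos).ne'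
  refine h2.congr_deriv ?_
  rw [one_sub_sg_sq]
  have e : sg s * wf s = s := sg_mul_wf s
  have e2 := wf_sq s
  have e3 : sg s ^ 2 * wf s ^ 2 = wf s ^ 2 - 1 := by rw [← mul_pow, e, e2]; ring
  simp only [id]
  field_simp
  nlinarith [e3]

section
variable {N : ℕ} {α b κ η0 m M Cs u00 : ℝ} {s0 : ℝ → ℝ} {u v s h : ℝ → ℝ → ℝ}

lemma Lim.s_bd (L : Lim N α b κ η0 m M Cs u00 s0 u v s h) {t r : ℝ} (ht : 0 ≤ t) (hr : r ∈ Icc (0:ℝ) 1) :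
    0 ≤ s r t ∧ s r t ≤ κ := by
  constructor
  · rw [← L.s_zero t ht]; exact L.s_mono t ht 0 r le_rfl hr.1 hr.2
  · rw [← L.s_one t ht]; exact L.s_mono t ht r 1 hr.1 hr.2 le_rfl

lemma Lim.s_abs (L : Lim N α b κ η0 m M Cs u00 s0 u v s h) {t r r' : ℝ} (ht : 0 ≤ t) (hr : r ∈ Icc (0:ℝ) 1)
    (hr' : r' ∈ Icc (0:ℝ) 1) : |s r' t - s r t| ≤ Cs * |r' - r| := by
  rcases le_total r r' with h | h
  · rw [abs_of_nonneg (by linarith [L.s_mono t ht r r' hr.1 h hr'.2]), abs_of_nonneg (by linarith)]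
    exact L.s_lip t ht r r' hr.1 h hr'.2
  · rw [abs_sub_comm, abs_sub_comm r' r, abs_of_nonneg (by linarith [L.s_mono t ht r' r hr'.1 h hr.2]), abs_of_nonneg (by linarith)]
    exact L.s_lip t ht r' r hr'.1 h hr.2

lemma Lim.u_xx (L : Lim N α b κ η0 m M Cs u00 s0 u v s h) {t r r' : ℝ} (ht : 0 ≤ t) (hr : r ∈ Icc (0:ℝ) 1)
    (hr' : r' ∈ Icc (0:ℝ) 1) : |u r' t - u r t - (r' - r) * (- s r t)| ≤ 2 * Cs * |r' - r| * |r' - r| := by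
  have hCs : 0 ≤ Cs * |r' - r| := (abs_nonneg _).trans (L.s_abs ht hr hr')
  rcases le_total r r' with h | h
  · have h1 := L.u_x t ht r r' hr.1 h hr'.2
    rw [abs_of_nonneg (by linarith : 0 ≤ r' - r)] at hCs ⊢
    rw [mul_neg, sub_neg_eq_add]
    have := mul_nonneg hCs (by linarith : 0 ≤ r' - r)
    linarith
  · have h1 := L.u_x t ht r' r hr'.1 h hr.2
    have h2 := L.s_abs ht hr hr'
    rw [abs_sub_comm r' r, abs_of_nonneg (by linarith : 0 ≤ r - r')] at hCs h2 ⊢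
    have e : u r' t - u r t - (r' - r) * (- s r t) = -(u r t - u r' t + (r - r') * s r' t) + (r - r') * (s r' t - s r t) := by ring
    rw [e]
    refine (abs_add_le _ _).trans ?_
    rw [abs_neg, abs_mul, abs_of_nonneg (by linarith : 0 ≤ r - r')]
    have := mul_le_mul_of_nonneg_left h2 (by linarith : 0 ≤ r - r')
    linarith

lemma Lim.der_x (L : Lim N α b κ η0 m M Cs u00 s0 u v s h) (hCs : 0 < Cs) {t r : ℝ} (ht : 0 ≤ t) (hr : r ∈ Icc (0:ℝ) 1) :
    HasDerivWithinAt (fun x => u x t) (- s r t) (Icc 0 1) r := by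
  apply hd_of_est
  intro ε hε
  refine ⟨ε / (2 * Cs), by positivity, ?_⟩
  intro y hy hd
  refine (L.u_xx ht hr hy).trans ?_
  apply mul_le_mul_of_nonneg_right _ (abs_nonneg _)
  rw [lt_div_iff₀ (by positivity)] at hd
  linarith

lemma Lim.der_t (L : Lim N α b κ η0 m M Cs u00 s0 u v s h) {t r : ℝ} (ht : 0 ≤ t) (hr : r ∈ Icc (0:ℝ) 1) :
    HasDerivWithinAt (fun x => u r x) (v r t) (Ici 0) t := by
  apply hd_of_est
  intro ε hε
  obtain ⟨C, hC, H⟩ := L.u_t (t + 1) (by linarith) (ε / 2) (by positivity)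
  refine ⟨min 1 (ε / 2 / (C + 1)), by positivity, ?_⟩
  intro y hy hd
  rw [lt_min_iff, lt_div_iff₀ (by linarith)] at hd
  have h1 := abs_lt.1 hd.1
  refine (H t ⟨ht, by linarith⟩ y ⟨hy, by linarith⟩ r hr).trans ?_
  rw [mul_comm]
  apply mul_le_mul_of_nonneg_right _ (abs_nonneg _)
  have := abs_nonneg (y - t)
  linarith [hd.2]

lemma Lim.lip_t (L : Lim N α b κ η0 m M Cs u00 s0 u v s h) (hm : 0 < m) {t t' r : ℝ} (ht : 0 ≤ t) (ht' : 0 ≤ t') (hr : r ∈ Icc (0:ℝ) 1) :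
    |u r t' - u r t| ≤ M * |t' - t| := by
  have := (convex_Ici (0:ℝ)).norm_image_sub_le_of_norm_hasDerivWithin_le
    (f := fun τ => u r τ) (f' := fun τ => v r τ) (C := M) (x := t) (y := t')
    (fun τ hτ => L.der_t hτ hr)
    (fun τ hτ => by
      have := L.v_bd τ hτ r hr
      rw [Real.norm_eq_abs, abs_of_pos (hm.trans_le this.1)]; exact this.2) ht ht'
  simpa [Real.norm_eq_abs] using this

lemma Lim.s_time (L : Lim N α b κ η0 m M Cs u00 s0 u v s h) (hm : 0 < m) {t t' r r' : ℝ} (ht : 0 ≤ t) (ht' : 0 ≤ t')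
    (hr : r ∈ Icc (0:ℝ) 1) (hr' : r' ∈ Icc (0:ℝ) 1) (hne : r' ≠ r) :
    |s r t' - s r t| ≤ 4 * Cs * |r' - r| + 2 * M * |t' - t| / |r' - r| := by
  have hd : 0 < |r' - r| := abs_pos.2 (sub_ne_zero.2 hne)
  have h1 := abs_le.1 (L.u_xx ht hr hr')
  have h2 := abs_le.1 (L.u_xx ht' hr hr')
  have h3 := abs_le.1 (L.lip_t hm ht ht' hr)
  have h4 := abs_le.1 (L.lip_t hm ht ht' hr')
  have key : |r' - r| * |s r t' - s r t| ≤ 4 * Cs * |r' - r| * |r' - r| + 2 * M * |t' - t| := by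
    rw [← abs_mul, abs_le]
    constructor <;> linarith
  have e : |r' - r| * (4 * Cs * |r' - r| + 2 * M * |t' - t| / |r' - r|) = 4 * Cs * |r' - r| * |r' - r| + 2 * M * |t' - t| := by
    field_simp
  rw [← e] at key
  exact le_of_mul_le_mul_left key hd

lemma Lim.M_pos (L : Lim N α b κ η0 m M Cs u00 s0 u v s h) (hm : 0 < m) : 0 < M := by
  have := L.v_bd 0 le_rfl 0 ⟨le_rfl, zero_le_one⟩
  linarith

lemma Lim.cont_s (L : Lim N α b κ η0 m M Cs u00 s0 u v s h) (hm : 0 < m) (hCs : 0 < Cs) :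
    ContinuousOn (fun p : ℝ × ℝ => s p.1 p.2) (Icc 0 1 ×ˢ Ici 0) := by
  rintro ⟨r, t⟩ ⟨hr, ht⟩
  simp only [mem_Ici] at hr ht
  have hM := L.M_pos hm
  apply cont_of_est
  intro ε hε
  set δ := min (1 / 2) (ε / (16 * Cs)) with hδ
  have hδ0 : 0 < δ := by positivity
  have hδ1 : δ ≤ 1 / 2 := min_le_left _ _
  have hδ2 : 4 * Cs * δ ≤ ε / 4 := by
    have : δ ≤ ε / (16 * Cs) := min_le_right _ _
    rw [le_div_iff₀ (by positivity)] at this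
    linarith
  refine ⟨min (ε / (4 * Cs)) (ε * δ / (8 * M)), by positivity, ?_⟩
  rintro r' t' ⟨hr', ht'⟩ h1 h2
  simp only [mem_Ici] at hr' ht'
  have h1' := h1.trans_le (min_le_left _ _)
  have h2' := h2.trans_le (min_le_right _ _)
  rw [lt_div_iff₀ (by positivity)] at h1' h2'
  have a1 := L.s_abs ht' hr hr'
  have a2 : |s r t' - s r t| ≤ 4 * Cs * δ + 2 * M * |t' - t| / δ := by
    by_cases hc : r + δ ≤ 1
    · have := L.s_time hm ht ht' hr (r' := r + δ) ⟨by linarith [hr.1], hc⟩ (by linarith)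
      rwa [add_sub_cancel_left, abs_of_pos hδ0] at this
    · have := L.s_time hm ht ht' hr (r' := r - δ) ⟨by linarith, by linarith [hr.2]⟩ (by linarith)
      rwa [sub_sub_cancel_left, abs_neg, abs_of_pos hδ0] at this
  have a3 : 2 * M * |t' - t| / δ ≤ ε / 4 := by
    rw [div_le_iff₀ hδ0]; linarith
  have := abs_add_le (s r' t' - s r t') (s r t' - s r t)
  rw [sub_add_sub_cancel] at this
  linarith

lemma Lim.cont_v (L : Lim N α b κ η0 m M Cs u00 s0 u v s h) :
    ContinuousOn (fun p : ℝ × ℝ => v p.1 p.2) (Icc 0 1 ×ˢ Ici 0) := by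
  rintro ⟨r, t⟩ ⟨hr, ht⟩
  simp only [mem_Ici] at hr ht
  apply cont_of_est
  intro ε hε
  obtain ⟨C, hC, H⟩ := L.v_mod (t + 1) (by linarith) (ε / 2) (by positivity)
  refine ⟨min 1 (ε / (4 * (C + 1))), by positivity, ?_⟩
  rintro r' t' ⟨hr', ht'⟩ h1 h2
  simp only [mem_Ici] at hr' ht'
  rw [lt_min_iff, lt_div_iff₀ (by positivity)] at h1 h2
  have := H t ⟨ht, by linarith⟩ t' ⟨ht', by linarith [(abs_lt.1 h2.1).2]⟩ r hr r' hr'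
  have := abs_nonneg (r' - r)
  have := abs_nonneg (t' - t)
  linarith [h1.2, h2.2]

lemma Lim.cont_u (L : Lim N α b κ η0 m M Cs u00 s0 u v s h) (hm : 0 < m) (hκ : 0 < κ) (hCs : 0 < Cs) :
    ContinuousOn (fun p : ℝ × ℝ => u p.1 p.2) (Icc 0 1 ×ˢ Ici 0) := by
  rintro ⟨r, t⟩ ⟨hr, ht⟩
  simp only [mem_Ici] at hr ht
  have hM := L.M_pos hm
  apply cont_of_est
  intro ε hε
  refine ⟨min (ε / (4 * (κ + 2 * Cs))) (ε / (4 * M)), by positivity, ?_⟩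
  rintro r' t' ⟨hr', ht'⟩ h1 h2
  simp only [mem_Ici] at hr' ht'
  have h1' := h1.trans_le (min_le_left _ _)
  have h2' := h2.trans_le (min_le_right _ _)
  rw [lt_div_iff₀ (by positivity)] at h1' h2'
  have a1 := L.lip_t hm ht ht' hr
  have a2 := L.u_xx ht' hr hr'
  have a3 := L.s_bd ht' hr
  have hle : |r' - r| ≤ 1 := by rw [abs_le]; constructor <;> linarith [hr.1, hr.2, hr'.1, hr'.2]
  have a4 : |(r' - r) * (- s r t')| ≤ |r' - r| * κ := by
    rw [abs_mul, abs_neg, abs_of_nonneg a3.1]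
    exact mul_le_mul_of_nonneg_left a3.2 (abs_nonneg _)
  have a5 : 2 * Cs * |r' - r| * |r' - r| ≤ 2 * Cs * |r' - r| :=
    mul_le_of_le_one_right (by positivity) hle
  have e : u r' t' - u r t = (u r' t' - u r t' - (r' - r) * (-s r t')) + (r' - r) * (- s r t') + (u r t' - u r t) := by ring
  rw [e]
  have b1 := abs_add_le ((u r' t' - u r t' - (r' - r) * (-s r t')) + (r' - r) * (- s r t')) (u r t' - u r t)
  have b2 := abs_add_le (u r' t' - u r t' - (r' - r) * (-s r t')) ((r' - r) * (- s r t'))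
  linarith

lemma Lim.cont_h (L : Lim N α b κ η0 m M Cs u00 s0 u v s h) (hm : 0 < m) (hα : 0 < α) (hCs : 0 < Cs) :
    ContinuousOn (fun p : ℝ × ℝ => h p.1 p.2) (Icc 0 1 ×ˢ Ici 0) := by
  have h1 : ContinuousOn (fun p : ℝ × ℝ => (b - v p.1 p.2 / wf (s p.1 p.2)) ^ (1 / α)) (Icc 0 1 ×ˢ Ici 0) := by
    apply ContinuousOn.rpow_const
    · exact continuousOn_const.sub (L.cont_v.div (continuous_wf.comp_continuousOn (L.cont_s hm hCs)) (fun p _ => (wf_pos _).ne'))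
    · intro p _; right; positivity
  exact h1.congr (fun p hp => L.h_eq p.2 hp.2 p.1 hp.1)

end

open Set Filter Topology

/-- radial derivative of `sg ∘ s` -/
noncomputable def kone (N : ℕ) (s h : ℝ → ℝ → ℝ) (r t : ℝ) : ℝ :=
  if r = 0 then h 0 t / N else h r t - ((N:ℝ) - 1) * (sg (s r t) / r)

lemma fix_t {f : ℝ → ℝ → ℝ} (hf : ContinuousOn (fun p : ℝ × ℝ => f p.1 p.2) (Icc 0 1 ×ˢ Ici 0)) {t : ℝ} (ht : 0 ≤ t) :
    ContinuousOn (fun r => f r t) (Icc 0 1) := by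
  have : ContinuousOn (fun r : ℝ => (r, t)) (Icc (0:ℝ) 1) := by fun_prop
  exact hf.comp this (fun r hr => ⟨hr, ht⟩)

section
variable {N : ℕ} {α b κ η0 m M Cs u00 : ℝ} {s0 : ℝ → ℝ} {u v s h : ℝ → ℝ → ℝ}

lemma Lim.der_sg_pos (L : Lim N α b κ η0 m M Cs u00 s0 u v s h) (hm : 0 < m) (hα : 0 < α) (hCs : 0 < Cs)
    {t r : ℝ} (ht : 0 ≤ t) (hr : r ∈ Ioc (0:ℝ) 1) :
    HasDerivWithinAt (fun x => sg (s x t)) (h r t - ((N:ℝ) - 1) * (sg (s r t) / r)) (Icc 0 1) r := by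
  have hrI : r ∈ Icc (0:ℝ) 1 := ⟨hr.1.le, hr.2⟩
  set A : ℝ → ℝ := fun x => h x t - ((N:ℝ) - 1) * (sg (s x t) / x) with hA
  have hcs := fix_t (L.cont_s hm hCs) ht
  have hch := fix_t (L.cont_h hm hα hCs) ht
  have hcA : ContinuousWithinAt A (Icc 0 1) r := by
    apply (hch r hrI).sub
    apply continuousWithinAt_const.mul
    exact (continuous_sg.continuousAt.comp_continuousWithinAt (hcs r hrI)).div continuousWithinAt_id hr.1.ne'
  apply hd_of_est
  intro ε hε
  obtain ⟨C, hC, H⟩ := L.sg_x t ht (ε / 3) (by positivity)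
  rw [Metric.continuousWithinAt_iff] at hcA
  obtain ⟨δ1, hδ1, HA⟩ := hcA (ε / 3) (by positivity)
  set C2 := C + C / (r / 2) with hC2
  have hr0 := hr.1
  have hC20 : 0 ≤ C2 := by positivity
  refine ⟨min (min δ1 (r / 2)) (ε / 3 / (C2 + 1)), by positivity, ?_⟩
  intro y hy hd
  rw [lt_min_iff, lt_min_iff] at hd
  obtain ⟨⟨hd1, hd2⟩, hd3⟩ := hd
  rw [lt_div_iff₀ (by linarith)] at hd3
  have hd2' := abs_lt.1 hd2
  have habs := abs_nonneg (y - r)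
  rcases le_total r y with h1 | h1
  · refine (H r y hr0 h1 hy.2).trans ?_
    rw [abs_of_nonneg (by linarith : 0 ≤ y - r)] at hd3 habs ⊢
    rw [mul_comm]
    apply mul_le_mul_of_nonneg_right _ habs
    have : (C + C / r) * (y - r) ≤ C2 * (y - r) := by
      apply mul_le_mul_of_nonneg_right _ habs
      have : C / r ≤ C / (r / 2) := div_le_div_of_nonneg_left hC (by linarith) (by linarith)
      linarith
    linarith
  · have hy0 : 0 < y := by linarith
    have h2 := H y r hy0 h1 hr.2
    have h3 := HA hy (by rw [Real.dist_eq]; exact hd1)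
    rw [Real.dist_eq] at h3
    rw [abs_sub_comm y r] at hd3 habs ⊢
    have e : sg (s y t) - sg (s r t) - (y - r) * A r = -(sg (s r t) - sg (s y t) - (r - y) * A y) - (r - y) * (A y - A r) := by ring
    rw [e]
    refine (abs_sub _ _).trans ?_
    rw [abs_neg, abs_mul]
    rw [abs_of_nonneg (by linarith : 0 ≤ r - y)] at hd3 habs ⊢
    have h4 := mul_le_mul_of_nonneg_left h3.le habs
    have h5 : (r - y) * (ε / 3 + (C + C / y) * (r - y)) ≤ (r - y) * (ε / 3 + ε / 3) := by
      apply mul_le_mul_of_nonneg_left _ habs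
      have : (C + C / y) * (r - y) ≤ C2 * (r - y) := by
        apply mul_le_mul_of_nonneg_right _ habs
        have : C / y ≤ C / (r / 2) := div_le_div_of_nonneg_left hC (by linarith) (by linarith)
        linarith
      linarith
    have h6 := h2.trans h5
    have h7 : |sg (s r t) - sg (s y t) - (r - y) * A y| ≤ (r - y) * (ε / 3 + ε / 3) := h6
    linarith

/-- behaviour of `sg s / r` near the axis -/
lemma Lim.axis (L : Lim N α b κ η0 m M Cs u00 s0 u v s h) (hN : 1 < N) (hm : 0 < m) (hα : 0 < α) (hCs : 0 < Cs)
    {t ρ h0 ε : ℝ} (ht : 0 ≤ t) (hρ : ρ ≤ 1) (hh : ∀ r ∈ Ioo 0 ρ, |h r t - h0| ≤ ε) :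
    ∀ r ∈ Icc 0 ρ, |(N:ℝ) * sg (s r t) - h0 * r| ≤ ε * r := by
  have hsub : Icc 0 ρ ⊆ Icc (0:ℝ) 1 := Icc_subset_Icc_right hρ
  have hc : ContinuousOn (fun x => sg (s x t)) (Icc 0 ρ) :=
    continuous_sg.comp_continuousOn ((fix_t (L.cont_s hm hCs) ht).mono hsub)
  have hd : ∀ r ∈ Ioo 0 ρ, HasDerivAt (fun x => sg (s x t)) (h r t - ((N:ℝ) - 1) * (sg (s r t) / r)) r := by
    intro r hr
    exact (L.der_sg_pos hm hα hCs ht ⟨hr.1, hr.2.le.trans hρ⟩).hasDerivAt (Icc_mem_nhds hr.1 (hr.2.trans_le hρ))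
  have hz : sg (s 0 t) = 0 := by rw [L.s_zero t ht, sg_zero]
  intro r hr
  have h1 := ode_upper hN (H := fun r => h r t) (B := h0 + ε) hc hz hd (fun r hr => by linarith [(abs_le.1 (hh r hr)).2]) r hr
  have h2 := ode_lower hN (H := fun r => h r t) (A := h0 - ε) hc hz hd (fun r hr => by linarith [(abs_le.1 (hh r hr)).1]) r hr
  rw [abs_le]; constructor <;> linarith

lemma Lim.der_sg (L : Lim N α b κ η0 m M Cs u00 s0 u v s h) (hN : 1 < N) (hm : 0 < m) (hα : 0 < α) (hCs : 0 < Cs)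
    {t r : ℝ} (ht : 0 ≤ t) (hr : r ∈ Icc (0:ℝ) 1) :
    HasDerivWithinAt (fun x => sg (s x t)) (kone N s h r t) (Icc 0 1) r := by
  rcases hr.1.eq_or_lt with h0 | h0
  · subst h0
    have hN0 : (0:ℝ) < N := by exact_mod_cast (by omega : 0 < N)
    rw [kone, if_pos rfl]
    apply hd_of_est
    intro ε hε
    have hch := est_of_cont (L.cont_h hm hα hCs (0, t) ⟨hr, ht⟩) ε hε
    obtain ⟨δ, hδ, H⟩ := hch
    refine ⟨min δ 1, by positivity, ?_⟩
    intro y hy hd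
    rw [lt_min_iff, sub_zero, abs_of_nonneg hy.1] at hd
    have h1 := L.axis hN hm hα hCs (t := t) (ρ := y) (h0 := h 0 t) (ε := ε) ht hy.2 (fun r hr => by
      refine (H r t ⟨⟨hr.1.le, by linarith [hr.2]⟩, ht⟩ ?_ (by simpa using hδ)).le
      rw [sub_zero, abs_of_pos hr.1]; linarith [hr.2]) y ⟨hy.1, le_rfl⟩
    rw [L.s_zero t ht, sg_zero, sub_zero, sub_zero, abs_of_nonneg hy.1]
    have e : sg (s y t) - y * (h 0 t / N) = (N * sg (s y t) - h 0 t * y) / N := by field_simp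
    rw [e, abs_div, abs_of_pos hN0]
    have hN1 : (1:ℝ) ≤ N := by exact_mod_cast hN.le
    exact (div_le_self (abs_nonneg _) hN1).trans h1
  · rw [kone, if_neg h0.ne']
    exact L.der_sg_pos hm hα hCs ht ⟨h0, hr.2⟩

lemma Lim.cont_k (L : Lim N α b κ η0 m M Cs u00 s0 u v s h) (hN : 1 < N) (hm : 0 < m) (hα : 0 < α) (hCs : 0 < Cs) :
    ContinuousOn (fun p : ℝ × ℝ => kone N s h p.1 p.2) (Icc 0 1 ×ˢ Ici 0) := by
  rintro ⟨r, t⟩ ⟨hr, ht⟩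
  simp only [mem_Ici] at hr ht
  have hch := L.cont_h hm hα hCs (r, t) ⟨hr, ht⟩
  rcases hr.1.eq_or_lt with h0 | h0
  · subst h0
    have hN0 : (0:ℝ) < N := by exact_mod_cast (by omega : 0 < N)
    have hN1 : (1:ℝ) ≤ N := by exact_mod_cast hN.le
    apply cont_of_est
    intro ε hε
    obtain ⟨δ, hδ, H⟩ := est_of_cont hch (ε / 3) (by positivity)
    refine ⟨δ, hδ, ?_⟩
    rintro r' t' ⟨hr', ht'⟩ h1 h2
    simp only [mem_Ici] at hr' ht'
    rw [sub_zero, abs_of_nonneg hr'.1] at h1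
    rw [kone, kone, if_pos rfl]
    split_ifs with hz
    · have := H 0 t' ⟨hr, ht'⟩ (by simpa using hδ) h2
      rw [← sub_div, abs_div, abs_of_pos hN0]
      exact lt_of_le_of_lt (div_le_self (abs_nonneg _) hN1) (by linarith)
    · have hrp : 0 < r' := lt_of_le_of_ne hr'.1 (Ne.symm hz)
      have a1 := L.axis hN hm hα hCs (t := t') (ρ := r') (h0 := h 0 t) (ε := ε / 3) ht' hr'.2 (fun x hx => by
        refine (H x t' ⟨⟨hx.1.le, by linarith [hx.2, hr'.2]⟩, ht'⟩ ?_ h2).le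
        rw [sub_zero, abs_of_pos hx.1]; linarith [hx.2]) r' ⟨hr'.1, le_rfl⟩
      have a2 := H r' t' ⟨hr', ht'⟩ (by rw [sub_zero, abs_of_pos hrp]; exact h1) h2
      have e : h r' t' - ((N:ℝ) - 1) * (sg (s r' t') / r') - h 0 t / N
          = (h r' t' - h 0 t) - ((N:ℝ) - 1) * ((N * sg (s r' t') - h 0 t * r') / (N * r')) := by
        field_simp; ring
      rw [e]
      refine lt_of_le_of_lt (abs_sub _ _) ?_
      have a3 : |((N:ℝ) - 1) * ((N * sg (s r' t') - h 0 t * r') / (N * r'))| ≤ ε / 3 := by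
        rw [abs_mul, abs_div, abs_of_nonneg (by linarith : 0 ≤ (N:ℝ) - 1), abs_of_pos (by positivity : 0 < (N:ℝ) * r'),
          mul_div_assoc', div_le_iff₀ (by positivity)]
        calc ((N:ℝ) - 1) * |N * sg (s r' t') - h 0 t * r'| ≤ N * (ε / 3 * r') :=
              mul_le_mul (by linarith) a1 (abs_nonneg _) hN0.le
          _ = _ := by ring
      linarith
  · have hcs := L.cont_s hm hCs (r, t) ⟨hr, ht⟩
    have hcA : ContinuousWithinAt (fun p : ℝ × ℝ => h p.1 p.2 - ((N:ℝ) - 1) * (sg (s p.1 p.2) / p.1)) (Icc 0 1 ×ˢ Ici 0) (r, t) := by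
      apply hch.sub
      apply continuousWithinAt_const.mul
      exact (continuous_sg.continuousAt.comp_continuousWithinAt hcs).div continuousWithinAt_fst h0.ne'
    refine hcA.congr_of_eventuallyEq ?_ ?_
    · have : ∀ᶠ p : ℝ × ℝ in 𝓝 (r, t), 0 < p.1 := continuous_fst.continuousAt.eventually (eventually_gt_nhds h0)
      filter_upwards [mem_nhdsWithin_of_mem_nhds this] with p hp
      rw [kone, if_neg (ne_of_gt hp)]
    · simp only [kone, if_neg h0.ne']

lemma Lim.der_s (L : Lim N α b κ η0 m M Cs u00 s0 u v s h) (hN : 1 < N) (hm : 0 < m) (hα : 0 < α) (hCs : 0 < Cs)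
    {t r : ℝ} (ht : 0 ≤ t) (hr : r ∈ Icc (0:ℝ) 1) :
    HasDerivWithinAt (fun x => s x t) (wf (s r t) ^ 3 * kone N s h r t) (Icc 0 1) r := by
  have h1 := (hasDerivAt_sgInv (s r t)).comp_hasDerivWithinAt r (L.der_sg hN hm hα hCs ht hr)
  refine h1.congr_of_mem (fun x _ => ?_) hr
  simp [sgInv_sg]

lemma Lim.k_nonneg (L : Lim N α b κ η0 m M Cs u00 s0 u v s h) (hN : 1 < N) (hm : 0 < m) (hα : 0 < α) (hCs : 0 < Cs)
    {t r : ℝ} (ht : 0 ≤ t) (hr : r ∈ Icc (0:ℝ) 1) : 0 ≤ kone N s h r t := by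
  have h1 : MonotoneOn (fun x => sg (s x t)) (Icc 0 1) := fun x hx y hy hxy => sg_mono (L.s_mono t ht x y hx.1 hxy hy.2)
  have h2 := h1.derivWithin_nonneg (x := r)
  rwa [(L.der_sg hN hm hα hCs ht hr).derivWithin ((uniqueDiffOn_Icc zero_lt_one) r hr)] at h2

lemma wf_cube (x : ℝ) : (1 + x ^ 2) ^ ((3:ℝ) / 2) = wf x ^ 3 := by
  rw [wf, Real.sqrt_eq_rpow, ← Real.rpow_natCast ((1 + x ^ 2) ^ ((1:ℝ) / 2)) 3, ← Real.rpow_mul (by positivity)]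
  norm_num

lemma meanCurv_kone (N : ℕ) (hN : 1 < N) (s h : ℝ → ℝ → ℝ) (r t : ℝ) (hs : s 0 t = 0) :
    meanCurv N r (- s r t) (-(wf (s r t) ^ 3 * kone N s h r t)) = - h r t := by
  have hN0 : (0:ℝ) < N := by exact_mod_cast (by omega : 0 < N)
  have hw := wf_pos (s r t)
  rw [meanCurv, kone]
  split_ifs with h0
  · subst h0; rw [hs, wf_zero]; field_simp
  · rw [neg_sq, wf_cube, show √(1 + s r t ^ 2) = wf (s r t) from rfl]
    rw [sg]; field_simp; ring

theorem Lim.flow (L : Lim N α b κ η0 m M Cs u00 s0 u v s h) (hN : 1 < N) (hm : 0 < m) (hα : 0 < α) (hb : 0 < b) (hCs : 0 < Cs)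
    (hη0 : 0 < η0) (hκ : 0 < κ) {u₀ u₀' u₀'' : ℝ → ℝ} (hdata : IsC2Data (-κ) u₀ u₀' u₀'')
    (hs0 : ∀ r, s0 r = - u₀' r) (hu0 : u00 = u₀ 0) :
    IsFlowSol N α b (-κ) u₀ u₀' u₀'' (Ici 0) u (fun r t => - s r t) (fun r t => -(wf (s r t) ^ 3 * kone N s h r t)) v := by
  have hcs := L.cont_s hm hCs
  refine ⟨L.cont_u hm hκ hCs, hcs.neg, ?_, L.cont_v, ?_, ?_, ?_, ?_, ?_, ?_⟩
  · exact (((continuous_wf.comp_continuousOn hcs).pow 3).mul (L.cont_k hN hm hα hCs)).neg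
  · exact fun t ht r hr => L.der_x hCs ht hr
  · exact fun t ht r hr => (L.der_s hN hm hα hCs ht hr).neg
  · exact fun r hr t ht => L.der_t ht hr
  · obtain ⟨d1, d2, -, -, -⟩ := hdata
    have hs : ∀ r ∈ Icc (0:ℝ) 1, - s r 0 = u₀' r := fun r hr => by rw [L.s_init r hr, hs0, neg_neg]
    intro r hr
    refine ⟨?_, hs r hr, ?_⟩
    · have := (convex_Icc (0:ℝ) 1).norm_image_sub_le_of_norm_hasDerivWithin_le
        (f := fun x => u x 0 - u₀ x) (f' := fun _ => 0) (C := 0) (x := 0) (y := r)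
        (fun x hx => ((L.der_x hCs le_rfl hx).sub (d1 x hx)).congr_deriv (by rw [hs x hx, sub_self]))
        (fun x hx => by simp) ⟨le_rfl, zero_le_one⟩ hr
      rw [zero_mul, L.u_init, hu0, sub_self, sub_zero] at this
      have := norm_le_zero_iff.1 this
      linarith
    · have e1 := (L.der_s hN hm hα hCs le_rfl hr).neg
      have e2 : HasDerivWithinAt (fun x => - s x 0) (u₀'' r) (Icc 0 1) r := (d2 r hr).congr_of_mem hs hr
      exact (uniqueDiffOn_Icc zero_lt_one r hr).eq_deriv _ e1 e2
  · intro t ht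
    exact ⟨by simp [L.s_zero t ht], by simp [L.s_one t ht]⟩
  · intro t ht r hr
    have hr' : r ∈ Icc (0:ℝ) 1 := ⟨hr.1.le, hr.2⟩
    have hN2 : (2:ℝ) ≤ N := by exact_mod_cast hN
    have hpos : 0 ≤ h r t := (mul_nonneg (by linarith) (eta_pos hη0 hb ht).le).trans (L.h_bd t ht r hr').1
    rw [meanCurv_kone N hN s h r t (L.s_zero t ht), oddPow_neg_of_nonneg hα hpos, L.v_eq t ht r hr', neg_sq]
    rw [show √(1 + s r t ^ 2) = wf (s r t) from rfl]; ring

end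

open Set Filter Topology

lemma est_of_hd {f : ℝ → ℝ} {A x : ℝ} {S : Set ℝ} (hd : HasDerivWithinAt f A S x) :
    ∀ ε > 0, ∃ δ > 0, ∀ y ∈ S, |y - x| < δ → |f y - f x - (y - x) * A| ≤ ε * |y - x| := by
  intro ε hε
  rw [hasDerivWithinAt_iff_isLittleO, Asymptotics.isLittleO_iff] at hd
  have h := hd hε
  rw [eventually_nhdsWithin_iff, Metric.eventually_nhds_iff] at h
  obtain ⟨δ, hδ, H⟩ := h
  refine ⟨δ, hδ, ?_⟩
  intro y hy hd
  simpa [smul_eq_mul] using H (by rw [Real.dist_eq]; exact hd) hy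

lemma left_nonneg {f : ℝ → ℝ} {A a b x : ℝ} (hd : HasDerivWithinAt f A (Icc a b) x) (hx : x ∈ Ioc a b)
    (hmax : ∀ y ∈ Icc a b, f y ≤ f x) : 0 ≤ A := by
  by_contra hA
  push Not at hA
  obtain ⟨δ, hδ, H⟩ := est_of_hd hd (-A / 2) (by linarith)
  set y := max a (x - δ / 2) with hy
  have hyx : y < x := max_lt hx.1 (by linarith)
  have hyd : x - y < δ := by have := le_max_right a (x - δ / 2); linarith
  have hym : y ∈ Icc a b := ⟨le_max_left _ _, hyx.le.trans hx.2⟩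
  have h1 := H y hym (by rw [abs_sub_comm, abs_of_pos (by linarith)]; exact hyd)
  rw [abs_sub_comm y x, abs_of_pos (by linarith : 0 < x - y)] at h1
  have h2 := (abs_le.1 h1).1
  have h3 := hmax y hym
  have : 0 < (x - y) * (-A) := mul_pos (by linarith) (by linarith)
  linarith

lemma second_test {f f' : ℝ → ℝ} {A a b x : ℝ} (hab : a < b) (hx : x ∈ Icc a b)
    (hf : ∀ y ∈ Icc a b, HasDerivWithinAt f (f' y) (Icc a b) y)
    (hf' : HasDerivWithinAt f' A (Icc a b) x) (h0 : f' x = 0)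
    (hmax : ∀ y ∈ Icc a b, f y ≤ f x) : A ≤ 0 := by
  by_contra hA
  push Not at hA
  obtain ⟨δ, hδ, H⟩ := est_of_hd hf' (A / 2) (by linarith)
  have hcont : ContinuousOn f (Icc a b) := fun y hy => (hf y hy).continuousWithinAt
  rcases hx.2.lt_or_eq with hxb | hxb
  · set y := min b (x + δ / 2) with hy
    have hyx : x < y := lt_min hxb (by linarith)
    have hyb : y ≤ b := min_le_left _ _
    have hyd : y ≤ x + δ / 2 := min_le_right _ _
    have hmono : StrictMonoOn f (Icc x y) := by
      apply strictMonoOn_of_deriv_pos (convex_Icc _ _) (hcont.mono (Icc_subset_Icc hx.1 hyb))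
      rw [interior_Icc]
      intro z hz
      have hzm : z ∈ Icc a b := ⟨hx.1.trans hz.1.le, hz.2.le.trans hyb⟩
      rw [((hf z hzm).hasDerivAt (Icc_mem_nhds (hx.1.trans_lt hz.1) (hz.2.trans_le hyb))).deriv]
      have h1 := H z hzm (by rw [abs_of_pos (by linarith [hz.1])]; linarith [hz.2])
      rw [abs_of_pos (by linarith [hz.1] : 0 < z - x), h0] at h1
      have h2 := (abs_le.1 h1).1
      have : 0 < (z - x) * A := mul_pos (by linarith [hz.1]) hA
      linarith
    have h1 := hmono ⟨le_rfl, hyx.le⟩ ⟨hyx.le, le_rfl⟩ hyx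
    have := hmax y ⟨hx.1.trans hyx.le, hyb⟩
    linarith
  · set y := max a (x - δ / 2) with hy
    have hyx : y < x := max_lt (by linarith) (by linarith)
    have hya : a ≤ y := le_max_left _ _
    have hyd : x - δ / 2 ≤ y := le_max_right _ _
    have hmono : StrictAntiOn f (Icc y x) := by
      apply strictAntiOn_of_deriv_neg (convex_Icc _ _) (hcont.mono (Icc_subset_Icc hya hx.2))
      rw [interior_Icc]
      intro z hz
      have hzm : z ∈ Icc a b := ⟨hya.trans hz.1.le, hz.2.le.trans hx.2⟩
      rw [((hf z hzm).hasDerivAt (Icc_mem_nhds (hya.trans_lt hz.1) (hz.2.trans_le hx.2))).deriv]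
      have h1 := H z hzm (by rw [abs_sub_comm, abs_of_pos (by linarith [hz.2])]; linarith [hz.1])
      rw [abs_sub_comm z x, abs_of_pos (by linarith [hz.2] : 0 < x - z), h0] at h1
      have h2 := (abs_le.1 h1).2
      have : 0 < (x - z) * A := mul_pos (by linarith [hz.2]) hA
      linarith
    have h1 := hmono ⟨le_rfl, hyx.le⟩ ⟨hyx.le, le_rfl⟩ hyx
    have := hmax y ⟨hya, hyx.le.trans hx.2⟩
    linarith

lemma interior_max {f : ℝ → ℝ} {A a b x : ℝ} (hx : x ∈ Ioo a b) (hf : HasDerivWithinAt f A (Icc a b) x)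
    (hmax : ∀ y ∈ Icc a b, f y ≤ f x) : A = 0 := by
  have h1 := hf.hasDerivAt (Icc_mem_nhds hx.1 hx.2)
  have : IsLocalMax f x := by
    filter_upwards [Icc_mem_nhds hx.1 hx.2] with y hy using hmax y hy
  exact this.hasDerivAt_eq_zero h1

/-- Classical solutions satisfying the equation up to the axis. -/
structure Good (N : ℕ) (α b k : ℝ) (u ur urr ut : ℝ → ℝ → ℝ) : Prop where
  cont : ContinuousOn (fun p : ℝ × ℝ => u p.1 p.2) (Icc 0 1 ×ˢ Ici 0)
  dx : ∀ t, 0 ≤ t → ∀ r ∈ Icc (0:ℝ) 1, HasDerivWithinAt (fun x => u x t) (ur r t) (Icc 0 1) r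
  dxx : ∀ t, 0 ≤ t → ∀ r ∈ Icc (0:ℝ) 1, HasDerivWithinAt (fun x => ur x t) (urr r t) (Icc 0 1) r
  dt : ∀ t, 0 ≤ t → ∀ r ∈ Icc (0:ℝ) 1, HasDerivWithinAt (fun x => u r x) (ut r t) (Ici 0) t
  bd : ∀ t, 0 ≤ t → ur 0 t = 0 ∧ ur 1 t = k
  eqn : ∀ t, 0 ≤ t → ∀ r ∈ Icc (0:ℝ) 1, ut r t = (oddPow (meanCurv N r (ur r t) (urr r t)) α + b) * wf (ur r t)

lemma meanCurv_mono (N : ℕ) (r p : ℝ) {x y : ℝ} (h : x ≤ y) : meanCurv N r p x ≤ meanCurv N r p y := by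
  unfold meanCurv
  split_ifs
  · exact mul_le_mul_of_nonneg_left h (Nat.cast_nonneg N)
  · have : x / (1 + p ^ 2) ^ ((3:ℝ) / 2) ≤ y / (1 + p ^ 2) ^ ((3:ℝ) / 2) :=
      div_le_div_of_nonneg_right h (by positivity)
    linarith

lemma Good.compare {N : ℕ} {α b k : ℝ} (hα : 0 < α) {u ur urr ut w wr wrr wt : ℝ → ℝ → ℝ}
    (hu : Good N α b k u ur urr ut) (hw : Good N α b k w wr wrr wt) {t0 C : ℝ} (ht0 : 0 ≤ t0)
    (h0 : ∀ r ∈ Icc (0:ℝ) 1, u r t0 - w r t0 ≤ C) :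
    ∀ t, t0 ≤ t → ∀ r ∈ Icc (0:ℝ) 1, u r t - w r t ≤ C := by
  have key : ∀ T, t0 ≤ T → ∀ ε > 0, ∀ r ∈ Icc (0:ℝ) 1, u r T - w r T ≤ C + ε * (T - t0) := by
    intro T hT ε hε r hr
    set g : ℝ × ℝ → ℝ := fun p => u p.1 p.2 - w p.1 p.2 - ε * (p.2 - t0) with hg
    have hsub : Icc (0:ℝ) 1 ×ˢ Icc t0 T ⊆ Icc (0:ℝ) 1 ×ˢ Ici 0 :=
      prod_mono le_rfl (fun x hx => ht0.trans hx.1)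
    have hcont : ContinuousOn g (Icc (0:ℝ) 1 ×ˢ Icc t0 T) := by
      apply ((hu.cont.mono hsub).sub (hw.cont.mono hsub)).sub
      fun_prop
    obtain ⟨⟨r1, t1⟩, ⟨hr1, ht1⟩, hmax⟩ := (isCompact_Icc.prod isCompact_Icc).exists_isMaxOn
      ⟨(r, T), ⟨hr, ⟨hT, le_rfl⟩⟩⟩ hcont
    simp only at hr1 ht1
    have hmax' : ∀ x ∈ Icc (0:ℝ) 1, ∀ τ ∈ Icc t0 T, u x τ - w x τ - ε * (τ - t0) ≤ u r1 t1 - w r1 t1 - ε * (t1 - t0) :=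
      fun x hx τ hτ => hmax (show (x, τ) ∈ _ from ⟨hx, hτ⟩)
    have hmT := hmax' r hr T ⟨hT, le_rfl⟩
    rcases ht1.1.eq_or_lt with he | hlt
    · subst he
      have := h0 r1 hr1
      linarith
    · exfalso
      have ht1' : 0 ≤ t1 := ht0.trans ht1.1
      -- time derivative
      have d1 := ((hu.dt t1 ht1' r1 hr1).mono (fun x hx => ht0.trans hx.1 : Icc t0 T ⊆ Ici 0)).sub
        ((hw.dt t1 ht1' r1 hr1).mono (fun x hx => ht0.trans hx.1 : Icc t0 T ⊆ Ici 0))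
      have d2 : HasDerivWithinAt (fun τ : ℝ => ε * (τ - t0)) (ε * 1) (Icc t0 T) t1 :=
        ((hasDerivWithinAt_id t1 _).sub_const t0).const_mul ε
      have h1 := left_nonneg (d1.sub d2) ⟨hlt, ht1.2⟩ (fun y hy => hmax' r1 hr1 y hy)
      -- space derivatives
      have hsm : ∀ x ∈ Icc (0:ℝ) 1, u x t1 - w x t1 ≤ u r1 t1 - w r1 t1 := fun x hx => by
        have := hmax' x hx t1 ht1; linarith
      have dx : ∀ x ∈ Icc (0:ℝ) 1, HasDerivWithinAt (fun x => u x t1 - w x t1) (ur x t1 - wr x t1) (Icc 0 1) x :=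
        fun x hx => (hu.dx t1 ht1' x hx).sub (hw.dx t1 ht1' x hx)
      have hz : ur r1 t1 - wr r1 t1 = 0 := by
        rcases hr1.1.eq_or_lt with e | e
        · rw [← e, (hu.bd t1 ht1').1, (hw.bd t1 ht1').1, sub_self]
        rcases hr1.2.eq_or_lt with e' | e'
        · rw [e', (hu.bd t1 ht1').2, (hw.bd t1 ht1').2, sub_self]
        exact interior_max ⟨e, e'⟩ (dx r1 hr1) hsm
      have h2 := second_test zero_lt_one hr1 dx ((hu.dxx t1 ht1' r1 hr1).sub (hw.dxx t1 ht1' r1 hr1)) hz hsm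
      have e1 : ur r1 t1 = wr r1 t1 := by linarith
      have h3 := hu.eqn t1 ht1' r1 hr1
      rw [e1] at h3
      have h4 := hw.eqn t1 ht1' r1 hr1
      have h5 := oddPow_mono hα (meanCurv_mono N r1 (wr r1 t1) (by linarith : urr r1 t1 ≤ wrr r1 t1))
      have h6 : ut r1 t1 ≤ wt r1 t1 := by
        rw [h3, h4]
        apply mul_le_mul_of_nonneg_right _ (wf_pos _).le
        simp only at h5; linarith
      linarith
  intro t ht r hr
  apply le_of_forall_pos_le_add
  intro ε hε
  have := key t ht (ε / (t - t0 + 1)) (by have : 0 < t - t0 + 1 := by linarith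
                                          positivity) r hr
  refine this.trans ?_
  have : ε / (t - t0 + 1) * (t - t0) ≤ ε := by
    rw [div_mul_eq_mul_div, div_le_iff₀ (by linarith)]
    nlinarith
  linarith

lemma meanCurv_of_ne {N : ℕ} {r : ℝ} (hr : r ≠ 0) (p x : ℝ) :
    meanCurv N r p x = x / wf p ^ 3 + ((N:ℝ) - 1) * (p / r) / wf p := by
  rw [meanCurv, if_neg hr, wf_cube, show √(1 + p ^ 2) = wf p from rfl]
  have := wf_pos p
  field_simp

lemma flow_good {N : ℕ} {α b k : ℝ} (hα : 0 < α) {u₀ u₀' u₀'' : ℝ → ℝ} {u ur urr ut : ℝ → ℝ → ℝ}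
    (F : IsFlowSol N α b k u₀ u₀' u₀'' (Ici 0) u ur urr ut) : Good N α b k u ur urr ut := by
  obtain ⟨c1, c2, c3, c4, d1, d2, d3, i1, b1, e1⟩ := F
  refine ⟨c1, d1, d2, fun t ht r hr => d3 r hr t ht, b1, ?_⟩
  intro t ht r hr
  rcases hr.1.eq_or_lt with h0 | h0
  · subst h0
    have hne : (𝓝[Ioc (0:ℝ) 1] 0).NeBot := by
      rw [nhdsWithin_Ioc_eq_nhdsGT zero_lt_one]; infer_instance
    have hle : 𝓝[Ioc (0:ℝ) 1] 0 ≤ 𝓝[Icc (0:ℝ) 1] 0 := nhdsWithin_mono _ Ioc_subset_Icc_self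
    have l1 : Tendsto (fun r => ut r t) (𝓝[Ioc (0:ℝ) 1] 0) (𝓝 (ut 0 t)) := (fix_t c4 ht 0 hr).tendsto.mono_left hle
    have l2 : Tendsto (fun r => ur r t) (𝓝[Ioc (0:ℝ) 1] 0) (𝓝 0) := by
      have := (fix_t c2 ht 0 hr).tendsto.mono_left hle
      rwa [(b1 t ht).1] at this
    have l3 : Tendsto (fun r => urr r t) (𝓝[Ioc (0:ℝ) 1] 0) (𝓝 (urr 0 t)) := (fix_t c3 ht 0 hr).tendsto.mono_left hle
    have l4 : Tendsto (fun r => ur r t / r) (𝓝[Ioc (0:ℝ) 1] 0) (𝓝 (urr 0 t)) := by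
      have h1 := ((d2 t ht 0 hr).mono Ioc_subset_Icc_self)
      rw [hasDerivWithinAt_iff_tendsto_slope' (by simp)] at h1
      refine h1.congr ?_
      intro x
      rw [slope_def_field, (b1 t ht).1, sub_zero, sub_zero]
    have l5 : Tendsto (fun r => wf (ur r t)) (𝓝[Ioc (0:ℝ) 1] 0) (𝓝 1) := by
      have := (continuous_wf.tendsto 0).comp l2
      rwa [wf_zero] at this
    have l6 := (l3.div (l5.pow 3) (by norm_num)).add (((tendsto_const_nhds (x := (N:ℝ) - 1)).mul l4).div l5 (by norm_num))
    have l7 := ((((oddPow_continuous hα).tendsto _).comp l6).add_const b).mul l5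
    have e : ut 0 t = _ := tendsto_nhds_unique (l1.congr' ?_) l7
    · rw [e, meanCurv, if_pos rfl, (b1 t ht).1, wf_zero]
      simp only [one_pow, div_one]
      congr 3; ring
    · filter_upwards [self_mem_nhdsWithin] with x hx
      rw [e1 t ht x hx, meanCurv_of_ne hx.1.ne']
      rfl
  · exact e1 t ht r ⟨h0, hr.2⟩

open Set Filter Topology

lemma profile_good {N : ℕ} (hN : 1 < N) {α b k ct RΦ : ℝ} (hα : 0 < α) {Φ Φ' Φ'' : ℝ → ℝ}
    (hΦ : IsMaxProfileSol N α b ct RΦ Φ Φ' Φ'') (hRΦ : 1 < RΦ) (hΦk : Φ' 1 = k) :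
    Good N α b k (fun r t => Φ r + ct * t) (fun r _ => Φ' r) (fun r _ => Φ'' r) (fun _ _ => ct) := by
  obtain ⟨_, ⟨p1, p2, p3, p4, p5⟩, _⟩ := hΦ
  have hsub : Icc (0:ℝ) 1 ⊆ Ico 0 RΦ := fun x hx => ⟨hx.1, hx.2.trans_lt hRΦ⟩
  have q3 : ∀ r ∈ Icc (0:ℝ) 1, HasDerivWithinAt Φ (Φ' r) (Icc 0 1) r := fun r hr => (p3 r (hsub hr)).mono hsub
  have q4 : ∀ r ∈ Icc (0:ℝ) 1, HasDerivWithinAt Φ' (Φ'' r) (Icc 0 1) r := fun r hr => (p4 r (hsub hr)).mono hsub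
  have c3 : ContinuousOn Φ (Icc 0 1) := fun r hr => (q3 r hr).continuousWithinAt
  have c4 : ContinuousOn Φ' (Icc 0 1) := fun r hr => (q4 r hr).continuousWithinAt
  have hN0 : (0:ℝ) < N := by exact_mod_cast (by omega : 0 < N)
  have hN1 : (1:ℝ) ≤ N := by exact_mod_cast hN.le
  set H : ℝ → ℝ := fun r => oddPow (ct / wf (Φ' r) - b) (1 / α) with hH
  have hmc : ∀ r ∈ Ioc (0:ℝ) 1, meanCurv N r (Φ' r) (Φ'' r) = H r := by
    intro r hr
    have h1 := p5 r (hsub ⟨hr.1.le, hr.2⟩) hr.1.ne'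
    rw [show √(1 + Φ' r ^ 2) = wf (Φ' r) from rfl, ← wf_sq] at h1
    have hw := wf_pos (Φ' r)
    have hr0 := hr.1.ne'
    rw [meanCurv_of_ne hr0]
    simp only [hH]
    have h2 : Φ'' r / wf (Φ' r) ^ 3 + ((N:ℝ) - 1) * (Φ' r / r) / wf (Φ' r)
      = (Φ'' r / wf (Φ' r) ^ 2 + ((N:ℝ) - 1) / r * Φ' r) / wf (Φ' r) := by
      field_simp
    rw [h2, h1]
    field_simp
  have hcH : ContinuousOn H (Icc 0 1) := by
    apply (oddPow_continuous (by positivity : 0 < 1 / α)).comp_continuousOn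
    exact (continuousOn_const.div (continuous_wf.comp_continuousOn c4) (fun r _ => (wf_pos _).ne')).sub continuousOn_const
  have hsgd : ∀ r ∈ Icc (0:ℝ) 1, HasDerivWithinAt (fun x => sg (Φ' x)) (1 / wf (Φ' r) ^ 3 * Φ'' r) (Icc 0 1) r :=
    fun r hr => (hasDerivAt_sg (Φ' r)).comp_hasDerivWithinAt r (q4 r hr)
  have hsg' : ∀ r ∈ Ioo (0:ℝ) 1, HasDerivAt (fun x => sg (Φ' x)) (H r - ((N:ℝ) - 1) * (sg (Φ' r) / r)) r := by
    intro r hr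
    have h1 := (hsgd r ⟨hr.1.le, hr.2.le⟩).hasDerivAt (Icc_mem_nhds hr.1 hr.2)
    refine h1.congr_deriv ?_
    rw [← hmc r ⟨hr.1, hr.2.le⟩, meanCurv_of_ne hr.1.ne', sg]
    have hw := wf_pos (Φ' r)
    have hr0 := hr.1.ne'
    field_simp; ring
  have h00 : (0:ℝ) ∈ Icc (0:ℝ) 1 := ⟨le_rfl, zero_le_one⟩
  have hmc0 : (N:ℝ) * Φ'' 0 = H 0 := by
    have e1 := hsgd 0 h00
    rw [p2, wf_zero, one_pow, div_one, one_mul] at e1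
    have e2 : HasDerivWithinAt (fun x => sg (Φ' x)) (H 0 / N) (Icc 0 1) 0 := by
      apply hd_of_est
      intro ε hε
      have hc0 := hcH 0 h00
      rw [Metric.continuousWithinAt_iff] at hc0
      obtain ⟨δ, hδ, HH⟩ := hc0 ε hε
      refine ⟨δ, hδ, ?_⟩
      intro y hy hd
      rw [sub_zero, abs_of_nonneg hy.1] at hd
      have hb : ∀ r ∈ Ioo 0 y, |H r - H 0| ≤ ε := by
        intro r hr
        have := HH (x := r) ⟨hr.1.le, hr.2.le.trans hy.2⟩ (by rw [Real.dist_eq, sub_zero, abs_of_pos hr.1]; linarith [hr.2])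
        rw [Real.dist_eq] at this
        exact this.le
      have hc : ContinuousOn (fun x => sg (Φ' x)) (Icc 0 y) :=
        continuous_sg.comp_continuousOn (c4.mono (Icc_subset_Icc_right hy.2))
      have hd' : ∀ r ∈ Ioo 0 y, HasDerivAt (fun x => sg (Φ' x)) (H r - ((N:ℝ) - 1) * (sg (Φ' r) / r)) r :=
        fun r hr => hsg' r ⟨hr.1, hr.2.trans_le hy.2⟩
      have hz : sg (Φ' 0) = 0 := by rw [p2, sg_zero]
      have h1 := ode_upper hN (B := H 0 + ε) hc hz hd' (fun r hr => by linarith [(abs_le.1 (hb r hr)).2]) y ⟨hy.1, le_rfl⟩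
      have h2 := ode_lower hN (A := H 0 - ε) hc hz hd' (fun r hr => by linarith [(abs_le.1 (hb r hr)).1]) y ⟨hy.1, le_rfl⟩
      rw [hz, sub_zero, sub_zero, abs_of_nonneg hy.1]
      have e : sg (Φ' y) - y * (H 0 / N) = (N * sg (Φ' y) - H 0 * y) / N := by field_simp
      rw [e, abs_div, abs_of_pos hN0]
      refine (div_le_self (abs_nonneg _) hN1).trans ?_
      rw [abs_le]; constructor <;> linarith
    have := (uniqueDiffOn_Icc (zero_lt_one (α := ℝ)) 0 h00).eq_deriv _ e1 e2
    rw [this]; field_simp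
  refine ⟨?_, ?_, ?_, ?_, ?_, ?_⟩
  · exact (c3.comp continuousOn_fst (fun p hp => hp.1)).add (by fun_prop)
  · exact fun t _ r hr => (q3 r hr).add_const _
  · exact fun t _ r hr => q4 r hr
  · intro t _ r hr
    exact (((hasDerivWithinAt_id t _).const_mul ct).const_add (Φ r)).congr_deriv (by simp)
  · exact fun t _ => ⟨p2, hΦk⟩
  · intro t _ r hr
    have : meanCurv N r (Φ' r) (Φ'' r) = H r := by
      rcases hr.1.eq_or_lt with e | e
      · subst e; rw [meanCurv, if_pos rfl, hmc0]
      · exact hmc r ⟨e, hr.2⟩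
    simp only [this, hH]
    rw [oddPow_oddPow hα]
    have hw := wf_pos (Φ' r)
    field_simp; ring

lemma profile_ne {N : ℕ} {α b k ct RΦ : ℝ} (hα : 0 < α) (hk : k < 0) {Φ Φ' Φ'' : ℝ → ℝ}
    (hΦ : IsMaxProfileSol N α b ct RΦ Φ Φ' Φ'') (hRΦ : 1 < RΦ) (hΦk : Φ' 1 = k) : ct ≠ b := by
  intro he
  obtain ⟨p0, ⟨p1, p2, p3, p4, p5⟩, pm⟩ := hΦ
  have h0 : oddPow 0 (1 / α) = 0 := by
    rw [oddPow_of_nonneg _ le_rfl, Real.zero_rpow (by positivity)]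
  have hs : IsProfileSolOn N α b ct (Ico 0 RΦ) (fun _ => 0) (fun _ => 0) (fun _ => 0) := by
    refine ⟨rfl, rfl, fun r _ => hasDerivWithinAt_const _ _ _, fun r _ => hasDerivWithinAt_const _ _ _, ?_⟩
    intro r _ _
    simp [he]
    simpa using h0.symm
  have h1 := (pm RΦ _ _ _ p0 hs).2
  have hm : (1:ℝ) ∈ Ico 0 RΦ := ⟨zero_le_one, hRΦ⟩
  have h2 : HasDerivWithinAt Φ 0 (Ico 0 RΦ) 1 :=
    (hasDerivWithinAt_const (1:ℝ) (Ico 0 RΦ) (0:ℝ)).congr_of_mem (fun x hx => (h1 hx).symm) hm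
  have h3 := (uniqueDiffOn_Ico 0 RΦ 1 hm).eq_deriv _ h2 (p3 1 hm)
  linarith

section
variable {N : ℕ} {α b k ct : ℝ} {Φ Φ' Φ'' : ℝ → ℝ} {u ur urr ut : ℝ → ℝ → ℝ}

lemma Good.bound (hα : 0 < α) (hu : Good N α b k u ur urr ut)
    (hw : Good N α b k (fun r t => Φ r + ct * t) (fun r _ => Φ' r) (fun r _ => Φ'' r) (fun _ _ => ct)) :
    ∃ M0, 0 < M0 ∧ ∀ t, 0 ≤ t → ∀ r ∈ Icc (0:ℝ) 1, |u r t - ct * t| ≤ M0 := by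
  have c1 := fix_t hu.cont le_rfl
  have c2 := fix_t (f := fun r t => Φ r + ct * t) hw.cont le_rfl
  obtain ⟨A, hA⟩ := isCompact_Icc.exists_bound_of_continuousOn (c1.sub c2)
  obtain ⟨B, hB⟩ := isCompact_Icc.exists_bound_of_continuousOn c2
  simp only [Real.norm_eq_abs, mul_zero, add_zero] at hA hB
  have h1 := hu.compare hα hw (C := A) le_rfl (fun r hr => by simpa using (abs_le.1 (hA r hr)).2)
  have h2 := hw.compare hα hu (C := A) le_rfl (fun r hr => by have := (abs_le.1 (hA r hr)).1; simp at this ⊢; linarith)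
  refine ⟨|A| + |B| + 1, by positivity, ?_⟩
  intro t ht r hr
  have h3 := h1 t ht r hr
  have h4 := h2 t ht r hr
  have h5 := abs_le.1 (hB r hr)

  rw [abs_le]
  constructor <;> linarith [le_abs_self A, le_abs_self B]

lemma Good.conv (hα : 0 < α) (hu : Good N α b k u ur urr ut)
    (hw : Good N α b k (fun r t => Φ r + ct * t) (fun r _ => Φ' r) (fun r _ => Φ'' r) (fun _ _ => ct)) :
    ∃ M : ℝ, Tendsto (fun t : ℝ => ⨆ r : Icc (0 : ℝ) 1, |u r.1 t - Φ r.1 - ct * t|) atTop (𝓝 M) := by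
  set D : ℝ → ℝ := fun t => ⨆ r : Icc (0 : ℝ) 1, |u r.1 t - Φ r.1 - ct * t| with hD
  have : Nonempty (Icc (0:ℝ) 1) := ⟨⟨0, le_rfl, zero_le_one⟩⟩
  have hbdd : ∀ t, 0 ≤ t → BddAbove (range (fun r : Icc (0 : ℝ) 1 => |u r.1 t - Φ r.1 - ct * t|)) := by
    intro t ht
    obtain ⟨A, hA⟩ := isCompact_Icc.exists_bound_of_continuousOn ((fix_t hu.cont ht).sub (fix_t (f := fun r t => Φ r + ct * t) hw.cont ht))
    refine ⟨A, ?_⟩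
    rintro _ ⟨r, rfl⟩
    have := hA r.1 r.2
    rw [Real.norm_eq_abs] at this
    simp only at this ⊢
    rwa [sub_sub]
  have hle : ∀ t, 0 ≤ t → ∀ r ∈ Icc (0:ℝ) 1, |u r t - Φ r - ct * t| ≤ D t :=
    fun t ht r hr => le_ciSup (hbdd t ht) (⟨r, hr⟩ : Icc (0:ℝ) 1)
  have hanti : ∀ t0 t, 0 ≤ t0 → t0 ≤ t → D t ≤ D t0 := by
    intro t0 t h0 h1
    apply ciSup_le
    rintro ⟨r, hr⟩
    have a1 := hu.compare hα hw (C := D t0) h0 (fun r hr => by linarith [(abs_le.1 (hle t0 h0 r hr)).2]) t h1 r hr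
    have a2 := hw.compare hα hu (C := D t0) h0 (fun r hr => by linarith [(abs_le.1 (hle t0 h0 r hr)).1]) t h1 r hr
    rw [abs_le]; constructor <;> linarith
  have hE : Antitone (fun t => D (max t 0)) := fun x y hxy => hanti _ _ (le_max_right _ _) (max_le_max_right 0 hxy)
  have hbb : BddBelow (range (fun t => D (max t 0))) := by
    refine ⟨0, ?_⟩
    rintro _ ⟨t, rfl⟩
    exact (abs_nonneg _).trans (hle _ (le_max_right _ _) 0 ⟨le_rfl, zero_le_one⟩)
  refine ⟨_, (tendsto_atTop_ciInf hE hbb).congr' ?_⟩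
  filter_upwards [eventually_ge_atTop 0] with t ht
  rw [max_eq_left ht]

end

open Set Filter Topology

lemma mono_of_hd {f f' : ℝ → ℝ} {a b : ℝ} (hf : ∀ x ∈ Icc a b, HasDerivWithinAt f (f' x) (Icc a b) x)
    (h0 : ∀ x ∈ Icc a b, 0 ≤ f' x) : MonotoneOn f (Icc a b) := by
  apply monotoneOn_of_deriv_nonneg (convex_Icc a b) (fun x hx => (hf x hx).continuousWithinAt)
  · rw [interior_Icc]
    intro x hx
    exact ((hf x ⟨hx.1.le, hx.2.le⟩).hasDerivAt (Icc_mem_nhds hx.1 hx.2)).differentiableAt.differentiableWithinAt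
  · rw [interior_Icc]
    intro x hx
    rw [((hf x ⟨hx.1.le, hx.2.le⟩).hasDerivAt (Icc_mem_nhds hx.1 hx.2)).deriv]
    exact h0 x ⟨hx.1.le, hx.2.le⟩

section
variable {N : ℕ} {α b κ η0 m M Cs u00 : ℝ} {s0 : ℝ → ℝ} {u v s h : ℝ → ℝ → ℝ}

lemma Lim.h_pos (L : Lim N α b κ η0 m M Cs u00 s0 u v s h) (hN : 1 < N) (hb : 0 < b) (hη0 : 0 < η0) {t r : ℝ}
    (ht : 0 ≤ t) (hr : r ∈ Icc (0:ℝ) 1) : 0 < h r t := by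
  have hN1 : (1:ℝ) < N := by exact_mod_cast hN
  exact (mul_pos (by linarith) (eta_pos hη0 hb ht)).trans_le (L.h_bd t ht r hr).1

lemma Lim.h_kone (L : Lim N α b κ η0 m M Cs u00 s0 u v s h) (hN : 1 < N) {t r ρ : ℝ}
    (hs : r ≠ 0 → sg (s r t) = r * ρ) :
    h r t = if r = 0 then N * kone N s h r t else kone N s h r t + ((N:ℝ) - 1) * ρ := by
  have hN0 : (0:ℝ) < N := by exact_mod_cast (by omega : 0 < N)
  split_ifs with h0
  · subst h0; rw [kone, if_pos rfl]; field_simp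
  · rw [kone, if_neg h0, hs h0]; field_simp; ring

/-- A small slope at radius `r` makes the centre move up almost with speed `b`. -/
lemma Lim.gain (L : Lim N α b κ η0 m M Cs u00 s0 u v s h) (hN : 1 < N) (hm : 0 < m) (hα : 0 < α) (hb : 0 < b)
    (hCs : 0 < Cs) (hη0 : 0 < η0) (hκ : 0 < κ) {t r A d τ c : ℝ} (ht : 0 ≤ t) (hr : r ∈ Ioc (0:ℝ) 1)
    (hA : 0 < A) (hd : 0 < d) (hτ : 0 < τ) (hAd : (2 * N * A) ^ α ≤ d)
    (hs : ∀ t'' ∈ Icc t (t + τ), s r t'' < 2 * A * r)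
    (hc : s r t ≤ c * r) (hcd : c ^ 2 * r ^ 2 ≤ 4 * A * (d * τ)) :
    (b - 3 * d) * τ ≤ u 0 (t + τ) - u 0 t := by
  have hN0 : (0:ℝ) < N := by exact_mod_cast (by omega : 0 < N)
  have hN1 : (1:ℝ) < N := by exact_mod_cast hN
  set g : ℝ × ℝ → ℝ := fun p => -(u p.1 p.2 + A * p.1 ^ 2 - (b - 2 * d) * (p.2 - t)) with hg
  have hsubr : Icc (0:ℝ) r ⊆ Icc 0 1 := Icc_subset_Icc_right hr.2
  have hsubt : Icc t (t + τ) ⊆ Ici (0:ℝ) := fun x hx => ht.trans hx.1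
  have hcont : ContinuousOn g (Icc (0:ℝ) r ×ˢ Icc t (t + τ)) := by
    have h1 := (L.cont_u hm hκ hCs).mono (prod_mono hsubr hsubt)
    apply ContinuousOn.neg
    apply ContinuousOn.sub (h1.add (by fun_prop)) (by fun_prop)
  obtain ⟨⟨ρ, t1⟩, ⟨hρ, ht1⟩, hmax⟩ := (isCompact_Icc.prod isCompact_Icc).exists_isMaxOn
    ⟨(0, t), ⟨⟨le_rfl, hr.1.le⟩, ⟨le_rfl, by linarith⟩⟩⟩ hcont
  simp only at hρ ht1
  have hmax' : ∀ x ∈ Icc (0:ℝ) r, ∀ τ' ∈ Icc t (t + τ), -(u x τ' + A * x ^ 2 - (b - 2 * d) * (τ' - t))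
      ≤ -(u ρ t1 + A * ρ ^ 2 - (b - 2 * d) * (t1 - t)) :=
    fun x hx τ' hτ => hmax (show (x, τ') ∈ _ from ⟨hx, hτ⟩)
  have ht10 : 0 ≤ t1 := ht.trans ht1.1
  have hρ1 := hsubr hρ
  rcases ht1.1.eq_or_lt with he | hlt
  · subst he
    have h1 := hmax' 0 ⟨le_rfl, hr.1.le⟩ (t + τ) ⟨by linarith, le_rfl⟩
    have h2 : MonotoneOn (fun x => u x t + s r t * x) (Icc 0 r) := by
      apply mono_of_hd (f' := fun x => - s x t + s r t * 1)
      · intro x hx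
        exact (((L.der_x hCs ht (hsubr hx)).mono hsubr).add ((hasDerivWithinAt_id x _).const_mul (s r t)))
      · intro x hx
        have := L.s_mono t ht x r hx.1 hx.2 hr.2
        linarith
    have h3 := h2 ⟨le_rfl, hr.1.le⟩ hρ hρ.1
    simp only [mul_zero, add_zero] at h3
    have h4 : s r t * ρ ≤ c * r * ρ := mul_le_mul_of_nonneg_right hc hρ.1
    have h5 : c * r * ρ ≤ A * ρ ^ 2 + d * τ := by
      have h6 : 4 * A * (c * r * ρ) ≤ 4 * A * (A * ρ ^ 2 + d * τ) := by nlinarith [sq_nonneg (2 * A * ρ - c * r)]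
      exact le_of_mul_le_mul_left h6 (by positivity)
    simp only [sub_self, mul_zero, sub_zero] at h1
    have e : (0:ℝ) ^ 2 = 0 := by norm_num
    rw [e] at h1
    linarith
  · exfalso
    have d1 := (L.der_t ht10 hρ1).mono hsubt
    have d2 : HasDerivWithinAt (fun τ' : ℝ => (b - 2 * d) * (τ' - t)) ((b - 2 * d) * 1) (Icc t (t + τ)) t1 :=
      ((hasDerivWithinAt_id t1 _).sub_const t).const_mul _
    have h1 := left_nonneg ((d1.add_const (A * ρ ^ 2)).sub d2).neg ⟨hlt, ht1.2⟩ (fun y hy => hmax' ρ hρ y hy)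
    have hsm : ∀ x ∈ Icc (0:ℝ) r, -(u x t1 + A * x ^ 2) ≤ -(u ρ t1 + A * ρ ^ 2) := fun x hx => by
      have := hmax' x hx t1 ht1; linarith
    have dx : ∀ x ∈ Icc (0:ℝ) r, HasDerivWithinAt (fun x => -(u x t1 + A * x ^ 2)) (s x t1 - 2 * A * x) (Icc 0 r) x := by
      intro x hx
      have e1 := ((L.der_x hCs ht10 (hsubr hx)).mono hsubr).add (((hasDerivWithinAt_id x (Icc 0 r)).pow 2).const_mul A)
      refine e1.neg.congr_deriv ?_
      simp; ring
    have hρr : ρ < r := by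
      rcases hρ.2.lt_or_eq with h2 | h2
      · exact h2
      · exfalso
        subst h2
        have := left_nonneg (dx ρ hρ) ⟨hr.1, le_rfl⟩ hsm
        have := hs t1 ht1
        linarith
    have hz : s ρ t1 - 2 * A * ρ = 0 := by
      rcases hρ.1.eq_or_lt with e | e
      · rw [← e, L.s_zero t1 ht10]; ring
      · exact interior_max ⟨e, hρr⟩ (dx ρ hρ) hsm
    have dxx : HasDerivWithinAt (fun x => s x t1 - 2 * A * x) (wf (s ρ t1) ^ 3 * kone N s h ρ t1 - 2 * A * 1) (Icc 0 r) ρ :=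
      ((L.der_s hN hm hα hCs ht10 hρ1).mono hsubr).sub ((hasDerivWithinAt_id ρ _).const_mul (2 * A))
    have h2 := second_test hr.1 hρ dx dxx hz hsm
    have hk0 := L.k_nonneg hN hm hα hCs ht10 hρ1
    have hk1 : kone N s h ρ t1 ≤ 2 * A := by
      have h3 : (1:ℝ) ≤ wf (s ρ t1) ^ 3 := one_le_pow₀ (one_le_wf _)
      have := mul_le_mul_of_nonneg_right h3 hk0
      linarith
    have hh : h ρ t1 ≤ 2 * N * A := by
      by_cases h0 : ρ = 0
      · rw [L.h_kone hN (ρ := 0) (fun h => absurd h0 h), if_pos h0]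
        have := mul_le_mul_of_nonneg_left hk1 hN0.le
        linarith
      · have hρ0 : 0 < ρ := lt_of_le_of_ne hρ.1 (Ne.symm h0)
        rw [L.h_kone hN (ρ := sg (s ρ t1) / ρ) (fun _ => by field_simp), if_neg h0]
        have h3 : sg (s ρ t1) / ρ ≤ 2 * A := by
          rw [div_le_iff₀ hρ0]
          have := sg_le_self (L.s_bd ht10 hρ1).1
          linarith
        have := mul_le_mul_of_nonneg_left h3 (by linarith : (0:ℝ) ≤ N - 1)
        linarith
    have hv := L.v_eq t1 ht10 ρ hρ1
    have hvm := (L.v_bd t1 ht10 ρ hρ1).1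
    have hw := one_le_wf (s ρ t1)
    have hpos : 0 < b - h ρ t1 ^ α := by
      by_contra hneg
      push Not at hneg
      have := mul_nonneg (by linarith : 0 ≤ -(b - h ρ t1 ^ α)) (wf_pos (s ρ t1)).le
      linarith
    have h7 := mul_le_mul_of_nonneg_left hw hpos.le
    have h8 : h ρ t1 ^ α ≤ (2 * N * A) ^ α := Real.rpow_le_rpow (L.h_pos hN hb hη0 ht10 hρ1).le hh hα.le
    linarith

/-- Barrier by expanding spheres. -/
lemma Lim.sphere (L : Lim N α b κ η0 m M Cs u00 s0 u v s h) (hN : 1 < N) (hm : 0 < m) (hα : 0 < α) (hb : 0 < b)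
    (hCs : 0 < Cs) (hη0 : 0 < η0) (hκ : 0 < κ) {t' c : ℝ} (ht' : 0 ≤ t') (hc0 : 0 < c) (hc1 : c ≤ sg κ)
    (h0 : ∀ r ∈ Icc (0:ℝ) 1, c * r ≤ sg (s r t')) :
    ∀ t, t' ≤ t → ∀ r ∈ Icc (0:ℝ) 1, r / (1 / c + b * (t - t')) ≤ sg (s r t) := by
  have hN0 : (0:ℝ) < N := by exact_mod_cast (by omega : 0 < N)
  have hN1 : (1:ℝ) < N := by exact_mod_cast hN
  have hc2 : c < 1 := hc1.trans_lt (sg_lt_one κ)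
  have hic : 1 < 1 / c := by rw [lt_div_iff₀ hc0]; linarith
  set ρ : ℝ → ℝ := fun t => 1 / c + b * (t - t') with hρdef
  have hρ1 : ∀ t, t' ≤ t → 1 < ρ t := fun t ht => by
    have := mul_nonneg hb.le (by linarith : 0 ≤ t - t')
    simp only [hρdef]; linarith
  set Z : ℝ → ℝ → ℝ := fun r t => √(ρ t ^ 2 - r ^ 2) with hZdef
  set z : ℝ → ℝ → ℝ := fun r t => r / Z r t with hzdef
  have hin : ∀ t, t' ≤ t → ∀ r ∈ Icc (0:ℝ) 1, 0 < ρ t ^ 2 - r ^ 2 := fun t ht r hr => by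
    have h1 := hρ1 t ht
    nlinarith [hr.1, hr.2]
  have hZ : ∀ t, t' ≤ t → ∀ r ∈ Icc (0:ℝ) 1, 0 < Z r t := fun t ht r hr => Real.sqrt_pos.2 (hin t ht r hr)
  have hZ2 : ∀ t, t' ≤ t → ∀ r ∈ Icc (0:ℝ) 1, Z r t ^ 2 = ρ t ^ 2 - r ^ 2 := fun t ht r hr =>
    Real.sq_sqrt (hin t ht r hr).le
  have hwz : ∀ t, t' ≤ t → ∀ r ∈ Icc (0:ℝ) 1, wf (z r t) = ρ t / Z r t := by
    intro t ht r hr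
    have h1 := hZ t ht r hr
    have h2 := hρ1 t ht
    have h3 : 1 + z r t ^ 2 = (ρ t / Z r t) ^ 2 := by
      simp only [hzdef]
      rw [div_pow, div_pow, hZ2 t ht r hr]
      have := (hin t ht r hr).ne'
      field_simp; ring
    rw [wf, h3, Real.sqrt_sq (by positivity)]
  have hsz : ∀ t, t' ≤ t → ∀ r ∈ Icc (0:ℝ) 1, sg (z r t) = r / ρ t := by
    intro t ht r hr
    have h1 := hZ t ht r hr
    have h2 := hρ1 t ht
    rw [sg, hwz t ht r hr]
    simp only [hzdef]
    field_simp
  have hZx : ∀ t, t' ≤ t → ∀ r ∈ Icc (0:ℝ) 1, HasDerivAt (fun x => Z x t) (- z r t) r := by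
    intro t ht r hr
    have h1 : HasDerivAt (fun x : ℝ => ρ t ^ 2 - x ^ 2) (-(2 * r)) r := by
      refine (((hasDerivAt_id r).pow 2).const_sub (ρ t ^ 2)).congr_deriv ?_
      simp
    have h2 := h1.sqrt (hin t ht r hr).ne'
    refine h2.congr_deriv ?_
    have := hZ t ht r hr
    simp only [hzdef]
    change -(2 * r) / (2 * Z r t) = -(r / Z r t)
    field_simp
  have hzx : ∀ t, t' ≤ t → ∀ r ∈ Icc (0:ℝ) 1, HasDerivAt (fun x => z x t) (wf (z r t) ^ 3 * (1 / ρ t)) r := by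
    intro t ht r hr
    have h1 := hZ t ht r hr
    have h2 := (hasDerivAt_id r).div (hZx t ht r hr) h1.ne'
    refine h2.congr_deriv ?_
    rw [hwz t ht r hr]
    simp only [hzdef, id]
    have h3 := hρ1 t ht
    have h4 := hZ2 t ht r hr
    field_simp
    linarith
  have hZt : ∀ t, t' ≤ t → ∀ r ∈ Icc (0:ℝ) 1, HasDerivAt (fun x => Z r x) (b * wf (z r t)) t := by
    intro t ht r hr
    have h0 : HasDerivAt ρ b t := by
      refine ((((hasDerivAt_id t).sub_const t').const_mul b).const_add (1 / c)).congr_deriv ?_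
      simp
    have h1 := (h0.pow 2).sub_const (r ^ 2)
    have h2 := h1.sqrt (hin t ht r hr).ne'
    refine h2.congr_deriv ?_
    rw [hwz t ht r hr]
    have := hZ t ht r hr
    change _ / (2 * Z r t) = _
    field_simp
    simp
    try ring
  have hZc : ContinuousOn (fun p : ℝ × ℝ => Z p.1 p.2) (Icc 0 1 ×ˢ Ici t') := by
    apply Continuous.continuousOn
    simp only [hZdef, hρdef]
    fun_prop
  have hmono0 : ∀ r1 r2, 0 ≤ r1 → r1 ≤ r2 → r2 ≤ 1 → u r2 t' - u r1 t' - (Z r2 t' - Z r1 t') ≤ 0 := by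
    have : MonotoneOn (fun x => Z x t' - u x t') (Icc 0 1) := by
      apply mono_of_hd (f' := fun x => - z x t' - (- s x t'))
      · exact fun x hx => (hZx t' le_rfl x hx).hasDerivWithinAt.sub (L.der_x hCs ht' hx)
      · intro x hx
        have h1 := h0 x hx
        have h2 := hsz t' le_rfl x hx
        have h3 : ρ t' = 1 / c := by simp [hρdef]
        rw [h3] at h2
        have h4 : sg (z x t') ≤ sg (s x t') := by
          rw [h2]; refine le_trans (le_of_eq ?_) h1; field_simp
        have := sg_strictMono.le_iff_le.1 h4
        linarith
    intro r1 r2 a1 a2 a3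
    have := this ⟨a1, a2.trans a3⟩ ⟨a1.trans a2, a3⟩ a2
    simp only at this
    linarith
  have key : ∀ T, t' ≤ T → ∀ ε > 0, ∀ x1 x2, 0 ≤ x1 → x1 ≤ x2 → x2 ≤ 1 →
      u x2 T - u x1 T - (Z x2 T - Z x1 T) - ε * (T - t') ≤ 0 := by
    intro T hT ε hε x1 x2 hx1 hx12 hx2
    set g : ℝ × ℝ × ℝ → ℝ := fun p => u p.2.1 p.2.2 - u p.1 p.2.2 - (Z p.2.1 p.2.2 - Z p.1 p.2.2) - ε * (p.2.2 - t') with hg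
    set K : Set (ℝ × ℝ × ℝ) := (Icc 0 1 ×ˢ Icc 0 1 ×ˢ Icc t' T) ∩ {p | p.1 ≤ p.2.1} with hK
    have hKc : IsCompact K := by
      apply IsCompact.inter_right (isCompact_Icc.prod (isCompact_Icc.prod isCompact_Icc))
      exact isClosed_le continuous_fst (continuous_fst.comp continuous_snd)
    have huc := L.cont_u hm hκ hCs
    have hcont : ContinuousOn g K := by
      have p1 : ContinuousOn (fun p : ℝ × ℝ × ℝ => (p.1, p.2.2)) K := by fun_prop
      have p2 : ContinuousOn (fun p : ℝ × ℝ × ℝ => (p.2.1, p.2.2)) K := by fun_prop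
      have m1 : MapsTo (fun p : ℝ × ℝ × ℝ => (p.1, p.2.2)) K (Icc 0 1 ×ˢ Ici 0) := fun p hp => ⟨hp.1.1, ht'.trans hp.1.2.2.1⟩
      have m2 : MapsTo (fun p : ℝ × ℝ × ℝ => (p.2.1, p.2.2)) K (Icc 0 1 ×ˢ Ici 0) := fun p hp => ⟨hp.1.2.1, ht'.trans hp.1.2.2.1⟩
      have m3 : MapsTo (fun p : ℝ × ℝ × ℝ => (p.1, p.2.2)) K (Icc 0 1 ×ˢ Ici t') := fun p hp => ⟨hp.1.1, hp.1.2.2.1⟩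
      have m4 : MapsTo (fun p : ℝ × ℝ × ℝ => (p.2.1, p.2.2)) K (Icc 0 1 ×ˢ Ici t') := fun p hp => ⟨hp.1.2.1, hp.1.2.2.1⟩
      exact (((huc.comp p2 m2).sub (huc.comp p1 m1)).sub ((hZc.comp p2 m4).sub (hZc.comp p1 m3))).sub (by fun_prop)
    obtain ⟨⟨r1, r2, t1⟩, ⟨⟨hr1, hr2, ht1⟩, hr12⟩, hmax⟩ := hKc.exists_isMaxOn
      ⟨(x1, x2, T), ⟨⟨hx1, hx12.trans hx2⟩, ⟨hx1.trans hx12, hx2⟩, ⟨hT, le_rfl⟩⟩, hx12⟩ hcont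
    simp only [mem_ofPred_eq] at hr1 hr2 ht1 hr12
    have hmax' : ∀ y1 ∈ Icc (0:ℝ) 1, ∀ y2 ∈ Icc (0:ℝ) 1, ∀ τ ∈ Icc t' T, y1 ≤ y2 →
        u y2 τ - u y1 τ - (Z y2 τ - Z y1 τ) - ε * (τ - t') ≤ u r2 t1 - u r1 t1 - (Z r2 t1 - Z r1 t1) - ε * (t1 - t') :=
      fun y1 h1 y2 h2 τ hτ h12 => hmax (show (y1, y2, τ) ∈ K from ⟨⟨h1, h2, hτ⟩, h12⟩)
    refine (hmax' x1 ⟨hx1, hx12.trans hx2⟩ x2 ⟨hx1.trans hx12, hx2⟩ T ⟨hT, le_rfl⟩ hx12).trans ?_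
    by_contra hpos
    push Not at hpos
    have hεt : 0 ≤ ε * (t1 - t') := mul_nonneg hε.le (by linarith [ht1.1])
    have hr12' : r1 < r2 := by
      rcases hr12.lt_or_eq with e | e
      · exact e
      · subst e; linarith
    have ht1' : t' < t1 := by
      rcases ht1.1.lt_or_eq with e | e
      · exact e
      · subst e
        have := hmono0 r1 r2 hr1.1 hr12 hr2.2
        linarith
    have ht10 : 0 ≤ t1 := ht'.trans ht1.1
    have hsubt : Icc t' T ⊆ Ici (0:ℝ) := fun x hx => ht'.trans hx.1
    have hρp := hρ1 t1 ht1.1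
    -- time derivative
    have d1 := ((L.der_t ht10 hr2).mono hsubt).sub ((L.der_t ht10 hr1).mono hsubt)
    have d2 := (hZt t1 ht1.1 r2 hr2).hasDerivWithinAt (s := Icc t' T) |>.sub (hZt t1 ht1.1 r1 hr1).hasDerivWithinAt
    have d3 : HasDerivWithinAt (fun τ : ℝ => ε * (τ - t')) (ε * 1) (Icc t' T) t1 :=
      ((hasDerivWithinAt_id t1 _).sub_const t').const_mul ε
    have k1 := left_nonneg ((d1.sub d2).sub d3) ⟨ht1', ht1.2⟩ (fun y hy => hmax' r1 hr1 r2 hr2 y hy hr12)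
    -- right point
    have hsub2 : Icc r1 1 ⊆ Icc (0:ℝ) 1 := Icc_subset_Icc_left hr1.1
    have hsub1 : Icc 0 r2 ⊆ Icc (0:ℝ) 1 := Icc_subset_Icc_right hr2.2
    have a2 : ∀ y ∈ Icc r1 1, HasDerivWithinAt (fun y => u y t1 - Z y t1) (- s y t1 - (- z y t1)) (Icc r1 1) y :=
      fun y hy => ((L.der_x hCs ht10 (hsub2 hy)).mono hsub2).sub (hZx t1 ht1.1 y (hsub2 hy)).hasDerivWithinAt
    have b2 : ∀ y ∈ Icc r1 1, u y t1 - Z y t1 ≤ u r2 t1 - Z r2 t1 := fun y hy => by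
      have := hmax' r1 hr1 y (hsub2 hy) t1 ht1 hy.1
      linarith
    have c2 : r2 < 1 := by
      rcases hr2.2.lt_or_eq with e | e
      · exact e
      · exfalso
        subst e
        have e1 := left_nonneg (a2 1 ⟨hr1.2, le_rfl⟩) ⟨hr12', le_rfl⟩ b2
        rw [L.s_one t1 ht10] at e1
        have e2 : sg κ ≤ sg (z 1 t1) := sg_mono (by linarith)
        rw [hsz t1 ht1.1 1 hr2] at e2
        have e3 : 1 / ρ t1 < c := by
          rw [div_lt_iff₀ (by linarith)]
          simp only [hρdef]
          have : 0 < c * (b * (t1 - t')) := mul_pos hc0 (mul_pos hb (by linarith))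
          rw [mul_add, mul_one_div_cancel hc0.ne']
          linarith
        linarith
    have z2 := interior_max ⟨hr12', c2⟩ (a2 r2 ⟨hr12, hr2.2⟩) b2
    have s2 : s r2 t1 = z r2 t1 := by linarith
    have aa2 : HasDerivWithinAt (fun y => - s y t1 - (- z y t1))
        (-(wf (s r2 t1) ^ 3 * kone N s h r2 t1) - (-(wf (z r2 t1) ^ 3 * (1 / ρ t1)))) (Icc r1 1) r2 :=
      ((L.der_s hN hm hα hCs ht10 hr2).mono hsub2).neg.sub (hzx t1 ht1.1 r2 hr2).hasDerivWithinAt.neg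
    have f2 := second_test (hr12'.trans c2) ⟨hr12, hr2.2⟩ a2 aa2 z2 b2
    rw [s2] at f2
    -- left point
    have a1 : ∀ y ∈ Icc 0 r2, HasDerivWithinAt (fun y => Z y t1 - u y t1) (- z y t1 - (- s y t1)) (Icc 0 r2) y :=
      fun y hy => (hZx t1 ht1.1 y (hsub1 hy)).hasDerivWithinAt.sub ((L.der_x hCs ht10 (hsub1 hy)).mono hsub1)
    have b1 : ∀ y ∈ Icc 0 r2, Z y t1 - u y t1 ≤ Z r1 t1 - u r1 t1 := fun y hy => by
      have := hmax' y (hsub1 hy) r2 hr2 t1 ht1 hy.2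
      linarith
    have z1 : - z r1 t1 - (- s r1 t1) = 0 := by
      rcases hr1.1.eq_or_lt with e | e
      · rw [← e, L.s_zero t1 ht10]; simp [hzdef]
      · exact interior_max ⟨e, hr12'⟩ (a1 r1 ⟨hr1.1, hr12⟩) b1
    have s1 : s r1 t1 = z r1 t1 := by linarith
    have aa1 : HasDerivWithinAt (fun y => - z y t1 - (- s y t1))
        (-(wf (z r1 t1) ^ 3 * (1 / ρ t1)) - (-(wf (s r1 t1) ^ 3 * kone N s h r1 t1))) (Icc 0 r2) r1 :=
      (hzx t1 ht1.1 r1 hr1).hasDerivWithinAt.neg.sub ((L.der_s hN hm hα hCs ht10 hr1).mono hsub1).neg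
    have f1 := second_test (hr1.1.trans_lt hr12') ⟨hr1.1, hr12⟩ a1 aa1 z1 b1
    rw [s1] at f1
    have k2 : 1 / ρ t1 ≤ kone N s h r2 t1 := by
      have : wf (z r2 t1) ^ 3 * (1 / ρ t1) ≤ wf (z r2 t1) ^ 3 * kone N s h r2 t1 := by linarith
      exact le_of_mul_le_mul_left this (pow_pos (wf_pos _) 3)
    have k3 : kone N s h r1 t1 ≤ 1 / ρ t1 := by
      have : wf (z r1 t1) ^ 3 * kone N s h r1 t1 ≤ wf (z r1 t1) ^ 3 * (1 / ρ t1) := by linarith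
      exact le_of_mul_le_mul_left this (pow_pos (wf_pos _) 3)
    have H2 : N * (1 / ρ t1) ≤ h r2 t1 := by
      rw [L.h_kone hN (ρ := 1 / ρ t1) (fun _ => by rw [s2, hsz t1 ht1.1 r2 hr2]; ring)]
      split_ifs
      · exact mul_le_mul_of_nonneg_left k2 hN0.le
      · linarith
    have H1 : h r1 t1 ≤ N * (1 / ρ t1) := by
      rw [L.h_kone hN (ρ := 1 / ρ t1) (fun _ => by rw [s1, hsz t1 ht1.1 r1 hr1]; ring)]
      split_ifs
      · exact mul_le_mul_of_nonneg_left k3 hN0.le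
      · linarith
    set P := (N * (1 / ρ t1)) ^ α with hP
    have hP0 : 0 ≤ P := by positivity
    have P2 : P ≤ h r2 t1 ^ α := Real.rpow_le_rpow (by positivity) H2 hα.le
    have P1 : h r1 t1 ^ α ≤ P := Real.rpow_le_rpow (L.h_pos hN hb hη0 ht10 hr1).le H1 hα.le
    have v2 := L.v_eq t1 ht10 r2 hr2
    have v1 := L.v_eq t1 ht10 r1 hr1
    rw [s2] at v2
    rw [s1] at v1
    have w2 : v r2 t1 ≤ (b - P) * wf (z r2 t1) := by
      rw [v2]; exact mul_le_mul_of_nonneg_right (by linarith) (wf_pos _).le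
    have w1 : (b - P) * wf (z r1 t1) ≤ v r1 t1 := by
      rw [v1]; exact mul_le_mul_of_nonneg_right (by linarith) (wf_pos _).le
    have zz : z r1 t1 ≤ z r2 t1 := by
      rw [← s1, ← s2]; exact L.s_mono t1 ht10 r1 r2 hr1.1 hr12 hr2.2
    have z0 : 0 ≤ z r1 t1 := by rw [← s1]; exact (L.s_bd ht10 hr1).1
    have ww : wf (z r1 t1) ≤ wf (z r2 t1) := wf_le_of_nonneg z0 zz
    have := mul_nonneg hP0 (by linarith : 0 ≤ wf (z r2 t1) - wf (z r1 t1))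
    linarith
  intro t ht r hr
  have ht0 : 0 ≤ t := ht'.trans ht
  have hanti : AntitoneOn (fun x => u x t - Z x t) (Icc 0 1) := by
    intro x hx y hy hxy
    simp only
    apply le_of_forall_pos_le_add
    intro ε hε
    have := key t ht (ε / (t - t' + 1)) (div_pos hε (by linarith)) x y hx.1 hxy hy.2
    have h2 : ε / (t - t' + 1) * (t - t') ≤ ε := by
      rw [div_mul_eq_mul_div, div_le_iff₀ (by linarith)]
      nlinarith
    linarith
  have h1 := hanti.derivWithin_nonpos (x := r)
  have hdd : HasDerivWithinAt (fun x => u x t - Z x t) (- s r t - (- z r t)) (Icc 0 1) r :=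
    (L.der_x hCs ht0 hr).sub (hZx t ht r hr).hasDerivWithinAt
  rw [hdd.derivWithin ((uniqueDiffOn_Icc zero_lt_one) r hr)] at h1
  have h2 : sg (z r t) ≤ sg (s r t) := sg_mono (by linarith)
  rwa [hsz t ht r hr] at h2

end

open Set Filter Topology

section
variable {N : ℕ} {α b κ η0 m M Cs u00 ct : ℝ} {s0 : ℝ → ℝ} {u v s h : ℝ → ℝ → ℝ}

lemma Lim.ct_le (L : Lim N α b κ η0 m M Cs u00 s0 u v s h) (hN : 1 < N) (hb : 0 < b) (hη0 : 0 < η0) {M0 : ℝ}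
    (hM0 : ∀ t, 0 ≤ t → ∀ r ∈ Icc (0:ℝ) 1, |u r t - ct * t| ≤ M0) : ct ≤ b := by
  have h00 : (0:ℝ) ∈ Icc (0:ℝ) 1 := ⟨le_rfl, zero_le_one⟩
  have hmono : ∀ T, 0 ≤ T → u 0 T - u 0 0 ≤ b * T := by
    intro T hT
    have : MonotoneOn (fun t => b * t - u 0 t) (Icc 0 T) := by
      apply mono_of_hd (f' := fun t => b * 1 - v 0 t)
      · exact fun x hx => ((hasDerivWithinAt_id x _).const_mul b).sub
          ((L.der_t hx.1 h00).mono (fun y hy => hy.1 : Icc 0 T ⊆ Ici 0))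
      · intro x hx
        have h1 := L.v_eq x hx.1 0 h00
        rw [L.s_zero x hx.1, wf_zero, mul_one] at h1
        have := Real.rpow_nonneg (L.h_pos hN hb hη0 hx.1 h00).le α
        linarith
    have := this ⟨le_rfl, hT⟩ ⟨hT, le_rfl⟩ hT
    simp only at this
    linarith
  by_contra hlt
  push Not at hlt
  have hM : 0 ≤ M0 := (abs_nonneg _).trans (hM0 0 le_rfl 0 h00)
  set T := (2 * M0 + 1) / (ct - b) with hT
  have hT0 : 0 ≤ T := div_nonneg (by linarith) (by linarith)
  have h1 := hmono T hT0
  have h2 := (abs_le.1 (hM0 T hT0 0 h00)).1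
  have h3 := (abs_le.1 (hM0 0 le_rfl 0 h00)).2
  have h4 : (ct - b) * T = 2 * M0 + 1 := mul_div_cancel₀ _ (by linarith)
  linarith

lemma Lim.window (L : Lim N α b κ η0 m M Cs u00 s0 u v s h) (hN : 1 < N) (hm : 0 < m) (hα : 0 < α) (hb : 0 < b)
    (hCs : 0 < Cs) (hη0 : 0 < η0) (hκ : 0 < κ) (hct : ct < b) {M0 : ℝ}
    (hM0 : ∀ t, 0 ≤ t → ∀ r ∈ Icc (0:ℝ) 1, |u r t - ct * t| ≤ M0) :
    ∃ c T : ℝ, 0 < c ∧ c ≤ sg κ ∧ 0 < T ∧ ∀ t0, 0 ≤ t0 → ∃ t' ∈ Icc t0 (t0 + T), ∀ r ∈ Icc (0:ℝ) 1, c * r ≤ sg (s r t') := by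
  have hN0 : (0:ℝ) < N := by exact_mod_cast (by omega : 0 < N)
  have h00 : (0:ℝ) ∈ Icc (0:ℝ) 1 := ⟨le_rfl, zero_le_one⟩
  have hM := L.M_pos hm
  have hM00 : 0 ≤ M0 := (abs_nonneg _).trans (hM0 0 le_rfl 0 h00)
  set d := (b - ct) / 8 with hd
  have hd0 : 0 < d := by simp only [hd]; linarith
  set A := d ^ (1 / α) / (2 * N) with hA
  have hA0 : 0 < A := by positivity
  have hAd : (2 * N * A) ^ α ≤ d := by
    have : 2 * N * A = d ^ (1 / α) := by simp only [hA]; field_simp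
    rw [this, ← Real.rpow_mul hd0.le, one_div_mul_cancel hα.ne', Real.rpow_one]
  set σ := A / (4 * Cs + 2 * M + A) with hσ
  have hσ0 : 0 < σ := by positivity
  have hσ1 : σ < 1 := by rw [hσ, div_lt_one (by positivity)]; linarith
  have hσA : (4 * Cs + 2 * M) * σ ≤ A := by
    have : (4 * Cs + 2 * M + A) * σ = A := mul_div_cancel₀ _ (by positivity)
    have := mul_pos hA0 hσ0
    linarith
  set c' := min (A / 2) (8 * d * σ ^ 2) with hc'
  have hc'0 : 0 < c' := lt_min (by positivity) (by positivity)
  have hc'1 : c' ≤ A / 2 := min_le_left _ _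
  have hc'2 : c' ≤ 8 * d * σ ^ 2 := min_le_right _ _
  have hwκ := wf_pos κ
  set c := min (c' / wf κ) (sg κ) with hc
  have hc0 : 0 < c := lt_min (by positivity) (sg_pos hκ)
  have hc1 : wf κ * c ≤ c' := by
    have : c ≤ c' / wf κ := min_le_left _ _
    rw [le_div_iff₀ hwκ] at this
    linarith
  set T := 2 * M0 / (5 * d) + 1 with hT
  have hT0 : 0 < T := by positivity
  refine ⟨c, T, hc0, min_le_right _ _, hT0, ?_⟩
  intro t0 ht0
  by_contra hno
  push Not at hno
  have step : ∀ t ∈ Icc t0 (t0 + T), ∃ τ, 0 < τ ∧ τ ≤ 1 ∧ (b - 3 * d) * τ ≤ u 0 (t + τ) - u 0 t := by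
    intro t ht
    obtain ⟨r, hr, hlt⟩ := hno t ht
    have ht' : 0 ≤ t := ht0.trans ht.1
    have hr0 : 0 < r := by
      rcases hr.1.eq_or_lt with e | e
      · exfalso
        rw [← e, L.s_zero t ht', sg_zero] at hlt
        simp at hlt
      · exact e
    have hsr := L.s_bd ht' hr
    have hsc : s r t ≤ c' * r := by
      have h1 : s r t = sg (s r t) * wf (s r t) := (sg_mul_wf _).symm
      have h2 : wf (s r t) ≤ wf κ := wf_le_of_nonneg hsr.1 hsr.2
      have h3 : sg (s r t) * wf (s r t) ≤ sg (s r t) * wf κ := mul_le_mul_of_nonneg_left h2 (sg_nonneg hsr.1)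
      have h4 : sg (s r t) * wf κ ≤ c * r * wf κ := mul_le_mul_of_nonneg_right hlt.le hwκ.le
      have h5 := mul_le_mul_of_nonneg_right hc1 hr0.le
      linarith
    have hσr : σ * r < r := by have := mul_lt_mul_of_pos_right hσ1 hr0; linarith
    have hσr0 : 0 < σ * r := mul_pos hσ0 hr0
    refine ⟨σ ^ 2 * r ^ 2, by positivity, ?_, ?_⟩
    · rw [← mul_pow]
      exact pow_le_one₀ hσr0.le (hσr.le.trans hr.2)
    · apply L.gain hN hm hα hb hCs hη0 hκ (c := c') ht' ⟨hr0, hr.2⟩ hA0 hd0 (by positivity) hAd _ hsc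
      · have h1 : c' * c' ≤ A / 2 * (8 * d * σ ^ 2) := mul_le_mul hc'1 hc'2 hc'0.le (by positivity)
        have h2 := mul_le_mul_of_nonneg_right h1 (sq_nonneg r)
        nlinarith
      · intro t'' ht''
        have h1 := L.s_time hm ht' (ht'.trans ht''.1) hr (r' := r - σ * r) ⟨by linarith, by linarith [hr.2]⟩ (by linarith [hσr0] : r - σ * r < r).ne
        rw [show r - σ * r - r = -(σ * r) by ring, abs_neg, abs_of_pos hσr0, abs_of_nonneg (by linarith [ht''.1] : 0 ≤ t'' - t)] at h1
        have h2 : 2 * M * (t'' - t) / (σ * r) ≤ 2 * M * (σ * r) := by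
          rw [div_le_iff₀ hσr0]
          have : t'' - t ≤ σ ^ 2 * r ^ 2 := by linarith [ht''.2]
          have := mul_le_mul_of_nonneg_left this (by positivity : 0 ≤ 2 * M)
          linarith
        have h3 := (abs_le.1 h1).2
        have h4 := mul_le_mul_of_nonneg_right hσA hr0.le
        have h5 := mul_le_mul_of_nonneg_right hc'1 hr0.le
        have h6 := mul_pos hA0 hr0
        linarith
  -- continuation argument
  set f : ℝ → ℝ := fun t => u 0 t - (b - 3 * d) * t with hf
  have hfc : ContinuousOn f (Icc t0 (t0 + T + 1)) := by
    have h1 := L.cont_u hm hκ hCs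
    have h2 : ContinuousOn (fun t : ℝ => ((0:ℝ), t)) (Icc t0 (t0 + T + 1)) := by fun_prop
    exact (h1.comp h2 (fun t ht => ⟨h00, ht0.trans ht.1⟩)).sub (by fun_prop)
  set S := Icc t0 (t0 + T + 1) ∩ f ⁻¹' (Ici (f t0)) with hS
  have hSc : IsCompact S := by
    apply isCompact_Icc.of_isClosed_subset (hfc.preimage_isClosed_of_isClosed isClosed_Icc isClosed_Ici) inter_subset_left
  have hSn : S.Nonempty := ⟨t0, ⟨le_rfl, by linarith⟩, le_refl (f t0)⟩
  obtain ⟨x, hxS, hx⟩ := hSc.exists_isGreatest hSn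
  have hxf : f t0 ≤ f x := hxS.2
  have hxT : t0 + T < x := by
    by_contra hle
    push Not at hle
    obtain ⟨τ, hτ0, hτ1, hg⟩ := step x ⟨hxS.1.1, hle⟩
    have hmem : x + τ ∈ S := by
      refine ⟨⟨by linarith [hxS.1.1], by linarith⟩, ?_⟩
      change f t0 ≤ f (x + τ)
      refine hxf.trans ?_
      simp only [hf]
      linarith
    have := hx hmem
    linarith
  simp only [hf] at hxf
  have hx0 : 0 ≤ x := by linarith
  have h1 := (abs_le.1 (hM0 x hx0 0 h00)).2
  have h2 := (abs_le.1 (hM0 t0 ht0 0 h00)).1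
  have h3 : 5 * d * T = 2 * M0 + 5 * d := by simp only [hT]; field_simp
  have h4 : 5 * d * T < 5 * d * (x - t0) := mul_lt_mul_of_pos_left (by linarith) (by linarith)
  have h5 : b = ct + 8 * d := by simp only [hd]; ring
  rw [h5] at hxf
  linarith

lemma Lim.h_lower (L : Lim N α b κ η0 m M Cs u00 s0 u v s h) (hN : 1 < N) (hm : 0 < m) (hα : 0 < α) (hb : 0 < b)
    (hCs : 0 < Cs) (hη0 : 0 < η0) (hκ : 0 < κ) (hct : ct < b) {M0 : ℝ}
    (hM0 : ∀ t, 0 ≤ t → ∀ r ∈ Icc (0:ℝ) 1, |u r t - ct * t| ≤ M0) :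
    ∃ Hlo, 0 < Hlo ∧ ∀ t, 0 ≤ t → ∀ r ∈ Ioc (0:ℝ) 1, Hlo ≤ h r t := by
  have hN1 : (0:ℝ) < N - 1 := by have : (1:ℝ) < N := by exact_mod_cast hN
                                 linarith
  obtain ⟨c, T, hc0, hc1, hT, H⟩ := L.window hN hm hα hb hCs hη0 hκ hct hM0
  have he := eta_pos hη0 hb hT.le
  have hq : 0 < 1 / c + b * T := by positivity
  refine ⟨min (((N:ℝ) - 1) * eta η0 b T) ((N - 1) * (1 / (1 / c + b * T))), by positivity, ?_⟩
  intro t ht r hr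
  have hrI : r ∈ Icc (0:ℝ) 1 := ⟨hr.1.le, hr.2⟩
  rcases le_total t T with h1 | h1
  · refine (min_le_left _ _).trans (le_trans ?_ (L.h_bd t ht r hrI).1)
    exact mul_le_mul_of_nonneg_left (eta_anti hη0 hb ht h1) hN1.le
  · refine (min_le_right _ _).trans ?_
    obtain ⟨t', ht', hs⟩ := H (t - T) (by linarith)
    have h2 := L.sphere hN hm hα hb hCs hη0 hκ (by linarith [ht'.1]) hc0 hc1 hs t (by linarith [ht'.2]) r hrI
    have h3 := L.k_nonneg hN hm hα hCs ht hrI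
    rw [kone, if_neg hr.1.ne'] at h3
    have h4 : 1 / (1 / c + b * T) ≤ sg (s r t) / r := by
      rw [le_div_iff₀ hr.1]
      refine le_trans ?_ h2
      rw [div_mul_eq_mul_div, one_mul]
      have h5 : b * (t - t') ≤ b * T := mul_le_mul_of_nonneg_left (by linarith [ht'.1]) hb.le
      have h6 : 0 ≤ b * (t - t') := mul_nonneg hb.le (by linarith [ht'.2])
      have h7 : 0 < 1 / c := by positivity
      exact div_le_div_of_nonneg_left hr.1.le (by linarith) (by linarith)
    have := mul_le_mul_of_nonneg_left h4 hN1.le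
    linarith

end

open Set Filter Topology

/-- global existence, a priori bounds and convergence, case
`α = q/p` odd, `b > 0 > k`, concave initial data: the flow has a unique global
classical solution with negative mean curvature, uniform bounds on `u − c̃t`, `u_r`,
`u_t`, `H`, `u_rr`, and `sup_{r∈[0,1]} |u(r,t) − Φ̃(r) − c̃t| → M` as `t → ∞`. -/
theorem stmt19 (N : ℕ) (hN : 1 < N) (α b k : ℝ) (p q : ℕ) (hp : Odd p) (hq : Odd q)
    (hp0 : 0 < p) (hq0 : 0 < q) (hαpq : α = (q : ℝ) / (p : ℝ))
    (hb : 0 < b) (hk : k < 0)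
    (hbk : b ^ (1 / α) * Real.sqrt (1 + k ^ 2) > -k * (N : ℝ))
    (u₀ u₀' u₀'' : ℝ → ℝ) (hdata : IsC2Data k u₀ u₀' u₀'')
    (hconc : ∀ r ∈ Set.Icc (0 : ℝ) 1, u₀'' r < 0)
    (hH0 : ∀ r ∈ Set.Icc (0 : ℝ) 1,
      0 < oddPow (meanCurv N r (u₀' r) (u₀'' r)) α + b)
    (ct RΦ : ℝ) (Φ Φ' Φ'' : ℝ → ℝ) (hct : 0 < ct)
    (hΦ : IsMaxProfileSol N α b ct RΦ Φ Φ' Φ'') (hRΦ : 1 < RΦ) (hΦk : Φ' 1 = k) :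
    ∃ u ur urr ut : ℝ → ℝ → ℝ,
      IsFlowSol N α b k u₀ u₀' u₀'' (Set.Ici 0) u ur urr ut ∧
      (∀ t ∈ Set.Ici (0 : ℝ), ∀ r ∈ Set.Icc (0 : ℝ) 1,
        meanCurv N r (ur r t) (urr r t) < 0) ∧
      (∀ v vr vrr vt : ℝ → ℝ → ℝ,
        IsFlowSol N α b k u₀ u₀' u₀'' (Set.Ici 0) v vr vrr vt →
        (∀ t ∈ Set.Ici (0 : ℝ), ∀ r ∈ Set.Icc (0 : ℝ) 1,
          meanCurv N r (vr r t) (vrr r t) < 0) →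
        ∀ t ∈ Set.Ici (0 : ℝ), ∀ r ∈ Set.Icc (0 : ℝ) 1, v r t = u r t) ∧
      (∃ M₀ M₁ M₂ Vlo Vhi Hlo Hhi : ℝ,
        0 < M₀ ∧ 0 < M₁ ∧ 0 < M₂ ∧ 0 < Vlo ∧ 0 < Vhi ∧ 0 < Hlo ∧ 0 < Hhi ∧
        ∀ t : ℝ, 0 ≤ t →
          (∀ r ∈ Set.Icc (0 : ℝ) 1, |u r t - ct * t| ≤ M₀) ∧
          (∀ r ∈ Set.Ioc (0 : ℝ) 1, ur r t < 0 ∧ -M₁ ≤ ur r t) ∧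
          (∀ r ∈ Set.Icc (0 : ℝ) 1, Vlo ≤ ut r t ∧ ut r t ≤ Vhi) ∧
          (∀ r ∈ Set.Ioc (0 : ℝ) 1,
            -Hhi ≤ meanCurv N r (ur r t) (urr r t) ∧
            meanCurv N r (ur r t) (urr r t) ≤ -Hlo) ∧
          (∀ r ∈ Set.Icc (0 : ℝ) 1, |urr r t| ≤ M₂)) ∧
      ∃ M : ℝ,
        Filter.Tendsto
          (fun t : ℝ => ⨆ r : Set.Icc (0 : ℝ) 1, |u r.1 t - Φ r.1 - ct * t|)
          Filter.atTop (nhds M) := by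
  have hα : 0 < α := by rw [hαpq]; positivity
  have hκ : 0 < -k := by linarith
  have hN1 : (1:ℝ) < N := by exact_mod_cast hN
  obtain ⟨D1, D2, D3, D4, D5⟩ := id hdata
  set s0 : ℝ → ℝ := fun r => - u₀' r with hs0
  set s1 : ℝ → ℝ := fun r => - u₀'' r with hs1
  have hsd : ∀ r ∈ Icc (0:ℝ) 1, HasDerivWithinAt s0 (s1 r) (Icc 0 1) r := fun r hr => (D2 r hr).neg
  have hs1p : ∀ r ∈ Icc (0:ℝ) 1, 0 < s1 r := fun r hr => by
    have := hconc r hr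
    simp only [hs1]; linarith
  have h00 : (0:ℝ) ∈ Icc (0:ℝ) 1 := ⟨le_rfl, zero_le_one⟩
  have hs00 : s0 0 = 0 := by simp [hs0, D4]
  have hs0p : ∀ r ∈ Icc (0:ℝ) 1, 0 ≤ s0 r := fun r hr => by
    have := mono_of_hd hsd (fun r hr => (hs1p r hr).le) h00 hr hr.1
    rwa [hs00] at this
  have hpos : ∀ r ∈ Icc (0:ℝ) 1, 0 < b - (if r = 0 then (N:ℝ) * s1 0 else s1 r / wf (s0 r) ^ 3 + ((N:ℝ) - 1) * (sg (s0 r) / r)) ^ α := by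
    intro r hr
    set X := (if r = 0 then (N:ℝ) * s1 0 else s1 r / wf (s0 r) ^ 3 + ((N:ℝ) - 1) * (sg (s0 r) / r)) with hX
    have hX0 : 0 ≤ X := by
      rw [hX]
      split_ifs with h0
      · have := (hs1p 0 h00).le
        positivity
      · have h2 := (hs1p r hr).le
        have h3 := wf_pos (s0 r)
        have h4 := sg_nonneg (hs0p r hr)
        have h5 := hr.1
        have h6 : (0:ℝ) ≤ N - 1 := by linarith
        positivity
    have hmc : meanCurv N r (u₀' r) (u₀'' r) = - X := by
      rw [hX]
      by_cases h0 : r = 0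
      · subst h0
        rw [meanCurv, if_pos rfl, if_pos rfl]
        simp only [hs1]; ring
      · rw [meanCurv_of_ne h0, if_neg h0]
        simp only [hs1, hs0]
        rw [wf_neg, sg_neg, sg]
        ring
    have h1 := hH0 r hr
    rw [hmc, oddPow_neg_of_nonneg hα hX0] at h1
    linarith
  obtain ⟨η0, m, M, Cs, n0, U, V, sn, hn, hη0, hηκ, hm, hCs, F⟩ := fam_exists N hN hα hb hκ s0 s1 (u₀ 0) hsd D3.neg
    hs00 (by simp [hs0, D5]) hs1p hpos
  obtain ⟨u, v, s, h, L⟩ := lim_exists F hN hα hb hκ hη0 hm hCs (fun r hr => (hsd r hr).continuousWithinAt)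
  have FS := L.flow hN hm hα hb hCs hη0 hκ (u₀ := u₀) (u₀' := u₀') (u₀'' := u₀'') (by rwa [neg_neg]) (fun r => rfl) rfl
  rw [neg_neg] at FS
  have G := flow_good hα FS
  have GP := profile_good hN hα hΦ hRΦ hΦk
  obtain ⟨M0, hM0, hbound⟩ := G.bound hα GP
  have hctb : ct < b := lt_of_le_of_ne (L.ct_le hN hb hη0 hbound) (profile_ne hα hk hΦ hRΦ hΦk)
  obtain ⟨Hlo, hHlo, hlow⟩ := L.h_lower hN hm hα hb hCs hη0 hκ hctb hbound
  have hmcv : ∀ t, 0 ≤ t → ∀ r, meanCurv N r (- s r t) (-(wf (s r t) ^ 3 * kone N s h r t)) = - h r t :=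
    fun t ht r => meanCurv_kone N hN s h r t (L.s_zero t ht)
  refine ⟨u, _, _, v, FS, ?_, ?_, ?_, G.conv hα GP⟩
  · intro t ht r hr
    have := L.h_pos hN hb hη0 ht hr
    simp only [hmcv t ht r]
    linarith
  · intro w wr wrr wt FW _ t ht r hr
    have GW := flow_good hα FW
    have i1 := FS.2.2.2.2.2.2.2.1
    have i2 := FW.2.2.2.2.2.2.2.1
    have e1 := G.compare hα GW (C := 0) le_rfl (fun x hx => by rw [(i1 x hx).1, (i2 x hx).1, sub_self]) t ht r hr
    have e2 := GW.compare hα G (C := 0) le_rfl (fun x hx => by rw [(i1 x hx).1, (i2 x hx).1, sub_self]) t ht r hr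
    linarith
  · have hB : 0 < b ^ (1 / α) := by positivity
    have hW := wf_pos (-k)
    refine ⟨M0, -k, wf (-k) ^ 3 * b ^ (1 / α), m, M, Hlo, b ^ (1 / α), hM0, hκ, by positivity, hm, L.M_pos hm, hHlo, hB, ?_⟩
    intro t ht
    refine ⟨hbound t ht, ?_, L.v_bd t ht, ?_, ?_⟩
    · intro r hr
      have hrI : r ∈ Icc (0:ℝ) 1 := ⟨hr.1.le, hr.2⟩
      have h1 := L.s_bd ht hrI
      have h2 := L.sg_lo t ht r hrI
      have h3 := mul_pos (eta_pos hη0 hb ht) hr.1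
      have h4 : 0 < s r t := by
        rcases h1.1.eq_or_lt with e | e
        · rw [← e, sg_zero] at h2; linarith
        · exact e
      constructor <;> linarith [h1.2]
    · intro r hr
      have hrI : r ∈ Icc (0:ℝ) 1 := ⟨hr.1.le, hr.2⟩
      simp only [hmcv t ht r]
      have h1 := (L.h_bd t ht r hrI).2
      have h2 := hlow t ht r hr
      constructor <;> linarith
    · intro r hr
      have h1 := L.s_bd ht hr
      have h2 := L.k_nonneg hN hm hα hCs ht hr
      have h3 : kone N s h r t ≤ h r t := by
        have h4 := L.h_pos hN hb hη0 ht hr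
        rw [kone]
        split_ifs with h0
        · subst h0
          exact div_le_self h4.le hN1.le
        · have h5 : 0 ≤ ((N:ℝ) - 1) * (sg (s r t) / r) :=
            mul_nonneg (by linarith) (div_nonneg (sg_nonneg h1.1) hr.1)
          linarith
      have h4 := (L.h_bd t ht r hr).2
      have h5 : wf (s r t) ^ 3 ≤ wf (-k) ^ 3 := pow_le_pow_left₀ (wf_pos _).le (wf_le_of_nonneg h1.1 h1.2) 3
      have h6 : 0 ≤ wf (s r t) ^ 3 := pow_nonneg (wf_pos _).le 3
      rw [abs_neg, abs_of_nonneg (mul_nonneg h6 h2)]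
      exact mul_le_mul h5 (h3.trans h4) h2 (by positivity)
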